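/- arXiv:1305.5365 — 3 statements merged into one kernel-verified Lean document; each statement's English description precedes it below -/
import Mathlib

section
/- Let (T(t))_{t≥0} be a bounded C₀-semigroup on a complex Hilbert space X with generator −A. Assume that σ(A) ∩ iℝ is empty and that ‖(is+A)^{-1}‖ = O(|s|^α / ℓ(|s|)) as |s| → ∞, where α > 0 and ℓ is an increasing slowly varying function. Then ‖T(t)A^{-1}‖ = O( (t · ℓ(t^{1/α}))^{-1/α} ) as t → ∞. -/
open Filter MeasureTheory Set Complex Asymptotics

noncomputable section

/-- A `C₀`-semigroup of bounded linear operators on `X`:  a strongly continuous family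
`(T t)_{t ≥ 0}` with `T 0 = 1` and `T (s+t) = T s ∘ T t`. -/
structure C0Semigroup (X : Type*) [NormedAddCommGroup X] [NormedSpace ℂ X] where
  T : ℝ → X →L[ℂ] X
  map_zero : T 0 = 1
  map_add : ∀ s t : ℝ, 0 ≤ s → 0 ≤ t → T (s + t) = T s ∘L T t
  strong_continuity : ∀ x : X, ContinuousOn (fun t : ℝ => T t x) (Set.Ici 0)

/-- A `C₀`-semigroup is bounded if `sup_{t ≥ 0} ‖T t‖ < ∞`. -/
def C0Semigroup.Bounded {X : Type*} [NormedAddCommGroup X] [NormedSpace ℂ X]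
    (Tsg : C0Semigroup X) : Prop :=
  ∃ K : ℝ, ∀ t : ℝ, 0 ≤ t → ‖Tsg.T t‖ ≤ K

/-- `R` is the bounded inverse `(lam + A)⁻¹` of `lam + A`, where `A` is a partially
defined linear operator on `X`. -/
structure IsResolvent {X : Type*} [NormedAddCommGroup X] [NormedSpace ℂ X]
    (A : X →ₗ.[ℂ] X) (lam : ℂ) (R : X →L[ℂ] X) : Prop where
  mem_domain : ∀ x : X, R x ∈ A.domain
  eq_apply : ∀ x : X, lam • R x + A ⟨R x, mem_domain x⟩ = x
  left_inv : ∀ x : A.domain, R (lam • (x : X) + A x) = x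

/-- `-A` is the generator of the `C₀`-semigroup `Tsg`:  the domain of `A` is exactly the
set of points `x` for which the right derivative of the orbit `t ↦ T t x` exists at `0`,
and there `A x` equals minus that derivative. -/
def IsGenerator {X : Type*} [NormedAddCommGroup X] [NormedSpace ℂ X]
    (Tsg : C0Semigroup X) (A : X →ₗ.[ℂ] X) : Prop :=
  ∀ x y : X,
    (∃ hx : x ∈ A.domain, A ⟨x, hx⟩ = y) ↔
      Filter.Tendsto (fun t : ℝ => (t : ℂ)⁻¹ • (Tsg.T t x - x))
        (nhdsWithin 0 (Set.Ioi 0)) (nhds (-y))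

/-- A positive measurable function `l` is slowly varying if `l (lam * s) / l s → 1`
as `s → ∞`, for every `lam > 0`. -/
def SlowlyVarying (l : ℝ → ℝ) : Prop :=
  Measurable l ∧ (∀ᶠ s in atTop, 0 < l s) ∧
    ∀ lam : ℝ, 0 < lam → Tendsto (fun s : ℝ => l (lam * s) / l s) atTop (nhds 1)

/-- `ls` is a de Bruijn conjugate of the slowly varying function `l`. -/
def IsDeBruijnConjugate (l ls : ℝ → ℝ) : Prop :=
  SlowlyVarying ls ∧
    Tendsto (fun s : ℝ => l s * ls (s * l s)) atTop (nhds 1) ∧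
    Tendsto (fun s : ℝ => ls s * l (s * ls s)) atTop (nhds 1)

/-- A monotonic slowly varying function `l` is dB-symmetric when `1 / l` is a
de Bruijn conjugate of `l`. -/
def DBSymmetric (l : ℝ → ℝ) : Prop := IsDeBruijnConjugate l fun s => (l s)⁻¹

/-- `g` is an asymptotic inverse of `f`:  `g (f s) ∼ s` and `f (g s) ∼ s` as `s → ∞`. -/
def IsAsympInverse (g f : ℝ → ℝ) : Prop :=
  Tendsto (fun s : ℝ => g (f s) / s) atTop (nhds 1) ∧
    Tendsto (fun s : ℝ => f (g s) / s) atTop (nhds 1)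

/-- The Balakrishnan integral defining the fractional power `B ^ γ` (`0 < γ < 1`) of a
bounded sectorial operator `B`. -/
def balakrishnan {X : Type*} [NormedAddCommGroup X] [NormedSpace ℂ X] [CompleteSpace X]
    (B : X →L[ℂ] X) (γ : ℝ) : X →L[ℂ] X :=
  (Real.sin (Real.pi * γ) / Real.pi) •
    ∫ t in Set.Ioi (0 : ℝ),
      (t ^ (γ - 1) : ℝ) • (B * Ring.inverse ((t : ℂ) • (1 : X →L[ℂ] X) + B))

/-- The fractional power `B ^ α`, `α ≥ 0`, of a bounded sectorial operator `B`, obtained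
from integer powers and the Balakrishnan formula for the fractional part. -/
def opPow {X : Type*} [NormedAddCommGroup X] [NormedSpace ℂ X] [CompleteSpace X]
    (B : X →L[ℂ] X) (α : ℝ) : X →L[ℂ] X :=
  if α = (⌊α⌋₊ : ℝ) then B ^ (⌊α⌋₊ : ℕ) else B ^ (⌊α⌋₊ : ℕ) * balakrishnan B (α - ⌊α⌋₊)

end


open FourierTransform in
theorem aux_plancherel {X : Type*} [NormedAddCommGroup X] [InnerProductSpace ℂ X]
    [CompleteSpace X] (f : ℝ → X) (h1 : Integrable f) (h2 : MemLp f 2) :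
    eLpNorm (𝓕 f) 2 volume = eLpNorm f 2 volume := by
  have hcont : Continuous (𝓕 f) :=
    VectorFourier.fourierIntegral_continuous Real.continuous_fourierChar
      (by exact continuous_inner) h1
  set F : Lp X 2 (volume : Measure ℝ) := h2.toLp f with hF
  have key : ∀ᵐ x : ℝ, (𝓕 F : Lp X 2 (volume : Measure ℝ)) x = 𝓕 f x := by
    apply ae_eq_of_integral_contDiff_smul_eq
    · exact (Lp.memLp _).locallyIntegrable (by norm_num)
    · exact hcont.locallyIntegrable
    intro g hg hgs
    have hgs' : HasCompactSupport (fun x => (g x : ℂ)) := hgs.comp_left (g := fun r : ℝ => (r : ℂ)) (by simp)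
    have hg' : ContDiff ℝ (↑(⊤ : ℕ∞)) (fun x => (g x : ℂ)) := Complex.ofRealCLM.contDiff.comp hg
    set φ : SchwartzMap ℝ ℂ := hgs'.toSchwartzMap hg' with hφ
    have hφx : ∀ x, φ x = (g x : ℂ) := fun x => rfl
    have e1 := congrArg (fun D : TemperedDistribution ℝ X => D φ) (Lp.fourier_toTemperedDistribution_eq F)
    simp only [TemperedDistribution.fourier_apply, Lp.toTemperedDistribution_apply] at e1
    have e2 : ∫ x, (𝓕 φ) x • F x = ∫ x, (𝓕 (φ : ℝ → ℂ)) x • f x := by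
      apply integral_congr_ae
      filter_upwards [h2.coeFn_toLp] with x hx
      rw [hF, hx, SchwartzMap.fourier_coe]
    have e3 : ∫ x, (𝓕 (φ : ℝ → ℂ)) x • f x = ∫ x, φ x • (𝓕 f) x := by
      simpa using! (VectorFourier.integral_fourierIntegral_smul_eq_flip (L := innerₗ ℝ)
        (μ := volume) (ν := volume) Real.continuous_fourierChar continuous_inner φ.integrable h1)
    have : ∀ (v : ℝ → X), ∫ x, g x • v x = ∫ x, φ x • v x := by
      intro v
      congr
    rw [this, this, ← e1, e2, e3]
  have n1 : ‖(𝓕 F : Lp X 2 (volume : Measure ℝ))‖ = ‖F‖ := Lp.norm_fourier_eq F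
  rw [Lp.norm_def, Lp.norm_def, ENNReal.toReal_eq_toReal_iff' (Lp.eLpNorm_ne_top _) (Lp.eLpNorm_ne_top _)] at n1
  rw [← eLpNorm_congr_ae key, n1]
  exact eLpNorm_congr_ae h2.coeFn_toLp

set_option linter.unusedSectionVars false

/-- The kernel `e^{-zτ} τ^m / m!`. -/
noncomputable def auxKer (m : ℕ) (z : ℂ) (τ : ℝ) : ℂ :=
  Complex.exp (-(z * τ)) * ((τ : ℂ) ^ m / (m.factorial : ℂ))

/-- Laplace transform of `τ^m/m! T(τ) v`. -/
noncomputable def auxLap {X : Type*} [NormedAddCommGroup X] [NormedSpace ℂ X]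
    (Tsg : C0Semigroup X) (m : ℕ) (z : ℂ) (v : X) : X :=
  ∫ τ in Set.Ioi (0 : ℝ), auxKer m z τ • Tsg.T τ v

theorem auxKer_continuous (m : ℕ) (z : ℂ) : Continuous (auxKer m z) := by
  unfold auxKer
  fun_prop

theorem auxKer_norm (m : ℕ) (z : ℂ) (τ : ℝ) (hτ : 0 ≤ τ) :
    ‖auxKer m z τ‖ = Real.exp (-(z.re * τ)) * (τ ^ m / (m.factorial : ℝ)) := by
  unfold auxKer
  rw [norm_mul, Complex.norm_exp]
  simp [abs_of_nonneg hτ]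

theorem auxKer_norm_le (m : ℕ) (z : ℂ) (hz : 0 < z.re) (τ : ℝ) (hτ : 0 ≤ τ) :
    ‖auxKer m z τ‖ ≤ (2 / z.re) ^ m * Real.exp (-(z.re / 2) * τ) := by
  rw [auxKer_norm m z τ hτ]
  have h := Real.pow_div_factorial_le_exp (z.re / 2 * τ) (by positivity) m
  have e1 : τ ^ m / (m.factorial : ℝ)
      = (2 / z.re) ^ m * ((z.re / 2 * τ) ^ m / (m.factorial : ℝ)) := by
    rw [← mul_div_assoc, ← mul_pow]
    congr 2
    field_simp
  have e2 : Real.exp (-(z.re / 2) * τ) = Real.exp (-(z.re * τ)) * Real.exp (z.re / 2 * τ) := by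
    rw [← Real.exp_add]
    congr 1
    ring
  rw [e1, e2]
  have : 0 < (2 / z.re) ^ m := by positivity
  calc Real.exp (-(z.re * τ)) * ((2 / z.re) ^ m * ((z.re / 2 * τ) ^ m / (m.factorial : ℝ)))
      ≤ Real.exp (-(z.re * τ)) * ((2 / z.re) ^ m * Real.exp (z.re / 2 * τ)) := by gcongr
    _ = _ := by ring

theorem auxKer_zero_left (z : ℂ) (τ : ℝ) : auxKer 0 z τ = Complex.exp (-(z * τ)) := by
  simp [auxKer]

theorem auxKer_hasDerivAt_zero (z : ℂ) (τ : ℝ) :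
    HasDerivAt (auxKer 0 z) (-z * auxKer 0 z τ) τ := by
  have h0 : HasDerivAt (fun τ : ℝ => (τ : ℂ)) 1 τ := Complex.ofRealCLM.hasDerivAt
  have h1 : HasDerivAt (fun τ : ℝ => Complex.exp (-(z * τ)))
      (Complex.exp (-(z * τ)) * (-(z * 1))) τ := (h0.const_mul z).neg.cexp
  have : auxKer 0 z = fun τ : ℝ => Complex.exp (-(z * τ)) := by
    ext τ
    exact auxKer_zero_left z τ
  rw [this]
  convert h1 using 1
  ring

theorem auxKer_hasDerivAt_succ (m : ℕ) (z : ℂ) (τ : ℝ) :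
    HasDerivAt (auxKer (m + 1) z) (auxKer m z τ - z * auxKer (m + 1) z τ) τ := by
  have h0 : HasDerivAt (fun τ : ℝ => (τ : ℂ)) 1 τ := Complex.ofRealCLM.hasDerivAt
  have h1 : HasDerivAt (fun τ : ℝ => Complex.exp (-(z * τ)))
      (Complex.exp (-(z * τ)) * (-(z * 1))) τ := (h0.const_mul z).neg.cexp
  have h2 := h1.mul ((h0.pow (m + 1)).div_const ((m + 1).factorial : ℂ))
  refine h2.congr_deriv ?_
  unfold auxKer
  have : ((m + 1).factorial : ℂ) = (m + 1) * m.factorial := by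
    rw [Nat.factorial_succ]; push_cast; ring
  have hm : (m.factorial : ℂ) ≠ 0 := by exact_mod_cast m.factorial_ne_zero
  have hm1 : (m + 1 : ℂ) ≠ 0 := by exact_mod_cast m.succ_ne_zero
  rw [this]
  push_cast
  rw [show ((fun τ : ℝ => (τ : ℂ)) ^ (m + 1)) τ = (τ : ℂ) ^ (m + 1) from rfl]
  field_simp
  ring

section
variable {X : Type*} [NormedAddCommGroup X] [NormedSpace ℂ X]

theorem aux_contOn (Tsg : C0Semigroup X) (m : ℕ) (z : ℂ) (v : X) :
    ContinuousOn (fun τ : ℝ => auxKer m z τ • Tsg.T τ v) (Set.Ici 0) :=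
  (auxKer_continuous m z).continuousOn.smul (Tsg.strong_continuity v)

theorem aux_norm_le (Tsg : C0Semigroup X) (K : ℝ) (hK : ∀ t : ℝ, 0 ≤ t → ‖Tsg.T t‖ ≤ K)
    (m : ℕ) (z : ℂ) (hz : 0 < z.re) (v : X) (τ : ℝ) (hτ : 0 ≤ τ) :
    ‖auxKer m z τ • Tsg.T τ v‖ ≤
      ((2 / z.re) ^ m * (K * ‖v‖)) * Real.exp (-(z.re / 2) * τ) := by
  rw [norm_smul]
  have h1 := auxKer_norm_le m z hz τ hτ
  have h2 : ‖Tsg.T τ v‖ ≤ K * ‖v‖ := (Tsg.T τ).le_of_opNorm_le (hK τ hτ) v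
  calc _ ≤ ((2 / z.re) ^ m * Real.exp (-(z.re / 2) * τ)) * (K * ‖v‖) := by gcongr
    _ = _ := by ring

theorem aux_integrable (Tsg : C0Semigroup X) (K : ℝ) (hK : ∀ t : ℝ, 0 ≤ t → ‖Tsg.T t‖ ≤ K)
    (m : ℕ) (z : ℂ) (hz : 0 < z.re) (v : X) :
    IntegrableOn (fun τ : ℝ => auxKer m z τ • Tsg.T τ v) (Set.Ioi 0) := by
  have h1 : IntegrableOn (fun τ : ℝ =>
      ((2 / z.re) ^ m * (K * ‖v‖)) * Real.exp (-(z.re / 2) * τ)) (Set.Ioi 0) :=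
    (integrableOn_exp_mul_Ioi (by linarith) 0).const_mul _
  refine Integrable.mono' h1 ?_ ?_
  · exact ((aux_contOn Tsg m z v).mono Set.Ioi_subset_Ici_self).aestronglyMeasurable
      measurableSet_Ioi
  · filter_upwards [ae_restrict_mem measurableSet_Ioi] with τ hτ
    exact aux_norm_le Tsg K hK m z hz v τ (le_of_lt hτ)

theorem aux_tendsto (Tsg : C0Semigroup X) (K : ℝ) (hK : ∀ t : ℝ, 0 ≤ t → ‖Tsg.T t‖ ≤ K)
    (m : ℕ) (z : ℂ) (hz : 0 < z.re) (v : X) :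
    Tendsto (fun τ : ℝ => auxKer m z τ • Tsg.T τ v) atTop (nhds 0) := by
  have h0 : Tendsto (fun τ : ℝ => Real.exp (-(z.re / 2) * τ)) atTop (nhds 0) := by
    apply Real.tendsto_exp_atBot.comp
    exact tendsto_id.const_mul_atTop_of_neg (by linarith)
  have h1 := h0.const_mul ((2 / z.re) ^ m * (K * ‖v‖))
  rw [mul_zero] at h1
  refine squeeze_zero_norm' ?_ h1
  filter_upwards [eventually_ge_atTop 0] with τ hτ
  exact aux_norm_le Tsg K hK m z hz v τ hτ

theorem aux_orbit_deriv (Tsg : C0Semigroup X) (A : X →ₗ.[ℂ] X) (hgen : IsGenerator Tsg A)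
    (w : A.domain) (τ : ℝ) (hτ : 0 ≤ τ) :
    HasDerivWithinAt (fun τ : ℝ => Tsg.T τ (w : X)) (-(Tsg.T τ (A w))) (Set.Ioi τ) τ := by
  have h := (hgen w (A w)).1 ⟨w.2, rfl⟩
  have h2 := ((Tsg.T τ).continuous.tendsto _).comp h
  rw [hasDerivWithinAt_iff_tendsto_slope' (by simp)]
  have h3 : Tendsto (fun y : ℝ => y - τ) (nhdsWithin τ (Set.Ioi τ)) (nhdsWithin 0 (Set.Ioi 0)) := by
    refine tendsto_nhdsWithin_of_tendsto_nhds_of_eventually_within _ ?_ ?_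
    · have : Tendsto (fun y : ℝ => y - τ) (nhds τ) (nhds (τ - τ)) :=
        (continuous_id.sub continuous_const).tendsto τ
      rw [sub_self] at this
      exact this.mono_left nhdsWithin_le_nhds
    · filter_upwards [self_mem_nhdsWithin] with y hy
      simpa using hy
  have h4 := h2.comp h3
  rw [map_neg] at h4
  refine h4.congr' ?_
  filter_upwards [self_mem_nhdsWithin] with y hy
  have hy' : 0 ≤ y - τ := by
    have : τ < y := hy
    linarith
  have e := Tsg.map_add τ (y - τ) hτ hy'
  rw [add_sub_cancel] at e
  simp only [Function.comp_apply, map_smul, map_sub, slope_def_module]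
  rw [e, ← Complex.ofReal_inv, Complex.coe_smul]
  rfl

theorem aux_commutes (Tsg : C0Semigroup X) (A : X →ₗ.[ℂ] X) (hgen : IsGenerator Tsg A)
    (w : A.domain) (τ : ℝ) (hτ : 0 ≤ τ) :
    ∃ h : Tsg.T τ (w : X) ∈ A.domain, A ⟨Tsg.T τ (w : X), h⟩ = Tsg.T τ (A w) := by
  rw [hgen]
  have h := (hgen w (A w)).1 ⟨w.2, rfl⟩
  have h2 := ((Tsg.T τ).continuous.tendsto _).comp h
  rw [map_neg] at h2
  refine h2.congr' ?_
  filter_upwards [self_mem_nhdsWithin] with y hy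
  have hy' : (0 : ℝ) ≤ y := le_of_lt hy
  have e1 := Tsg.map_add τ y hτ hy'
  have e2 := Tsg.map_add y τ hy' hτ
  have e3 : Tsg.T τ (Tsg.T y (w : X)) = Tsg.T y (Tsg.T τ (w : X)) := by
    have := congrArg (fun B : X →L[ℂ] X => B (w : X)) (e1.symm.trans ((congrArg Tsg.T (add_comm τ y)).trans e2))
    simpa using this
  simp [e3]

theorem aux_res_comm (Tsg : C0Semigroup X) (A : X →ₗ.[ℂ] X) (hgen : IsGenerator Tsg A)
    (lam : ℂ) (R : X →L[ℂ] X) (hR : IsResolvent A lam R) (τ : ℝ) (hτ : 0 ≤ τ) (v : X) :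
    Tsg.T τ (R v) = R (Tsg.T τ v) := by
  obtain ⟨h, e⟩ := aux_commutes Tsg A hgen ⟨R v, hR.mem_domain v⟩ τ hτ
  have h1 := hR.left_inv ⟨_, h⟩
  simp only at h1 e
  rw [e] at h1
  have h2 := congrArg (Tsg.T τ) (hR.eq_apply v)
  rw [map_add, map_smul] at h2
  rw [h2] at h1
  exact h1.symm

variable [CompleteSpace X]

theorem aux_lap_comm (Tsg : C0Semigroup X) (K : ℝ) (hK : ∀ t : ℝ, 0 ≤ t → ‖Tsg.T t‖ ≤ K)
    (A : X →ₗ.[ℂ] X) (hgen : IsGenerator Tsg A)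
    (lam : ℂ) (R : X →L[ℂ] X) (hR : IsResolvent A lam R) (m : ℕ) (z : ℂ) (hz : 0 < z.re) (v : X) :
    auxLap Tsg m z (R v) = R (auxLap Tsg m z v) := by
  unfold auxLap
  rw [← ContinuousLinearMap.integral_comp_comm R (aux_integrable Tsg K hK m z hz v)]
  refine setIntegral_congr_fun measurableSet_Ioi fun τ hτ => ?_
  simp only [map_smul]
  rw [aux_res_comm Tsg A hgen lam R hR τ (le_of_lt hτ)]

theorem aux_ftc (f f' : ℝ → X) (hc : ContinuousOn f (Set.Ici 0))
    (hd : ∀ x, 0 ≤ x → HasDerivWithinAt f (f' x) (Set.Ioi x) x)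
    (hi : IntegrableOn f' (Set.Ioi 0)) (hl : Tendsto f atTop (nhds 0)) :
    ∫ x in Set.Ioi (0 : ℝ), f' x = - f 0 := by
  have h1 := intervalIntegral_tendsto_integral_Ioi 0 hi tendsto_id
  have h2 : Tendsto (fun b : ℝ => f b - f 0) atTop (nhds (0 - f 0)) := hl.sub_const _
  rw [zero_sub] at h2
  refine tendsto_nhds_unique h1 (h2.congr' ?_)
  filter_upwards [eventually_ge_atTop 0] with b hb
  symm
  apply intervalIntegral.integral_eq_sub_of_hasDeriv_right_of_le hb
  · exact hc.mono Set.Icc_subset_Ici_self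
  · intro x hx
    exact hd x hx.1.le
  · rw [intervalIntegrable_iff_integrableOn_Ioc_of_le hb]
    exact hi.mono_set Set.Ioc_subset_Ioi_self

theorem aux_lap_zero (Tsg : C0Semigroup X) (K : ℝ) (hK : ∀ t : ℝ, 0 ≤ t → ‖Tsg.T t‖ ≤ K)
    (A : X →ₗ.[ℂ] X) (hgen : IsGenerator Tsg A) (z : ℂ) (hz : 0 < z.re) (w : A.domain) :
    auxLap Tsg 0 z (z • (w : X) + A w) = w := by
  have h := aux_ftc (fun τ : ℝ => auxKer 0 z τ • Tsg.T τ (w : X))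
    (fun τ => -(auxKer 0 z τ • Tsg.T τ (z • (w : X) + A w)))
    (aux_contOn Tsg 0 z w) ?_ ((aux_integrable Tsg K hK 0 z hz _).neg)
    (aux_tendsto Tsg K hK 0 z hz w)
  · rw [integral_neg] at h
    have := neg_injective h
    unfold auxLap
    rw [this]
    simp [auxKer, Tsg.map_zero]
  · intro x hx
    have h1 := (auxKer_hasDerivAt_zero z x).hasDerivWithinAt.smul (s := Set.Ioi x)
      (aux_orbit_deriv Tsg A hgen w x hx)
    refine h1.congr_deriv ?_
    simp only [map_add, map_smul]
    module

theorem aux_lap_succ (Tsg : C0Semigroup X) (K : ℝ) (hK : ∀ t : ℝ, 0 ≤ t → ‖Tsg.T t‖ ≤ K)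
    (A : X →ₗ.[ℂ] X) (hgen : IsGenerator Tsg A) (m : ℕ) (z : ℂ) (hz : 0 < z.re) (w : A.domain) :
    auxLap Tsg (m + 1) z (z • (w : X) + A w) = auxLap Tsg m z (w : X) := by
  have i1 := aux_integrable Tsg K hK m z hz (w : X)
  have i2 := aux_integrable Tsg K hK (m + 1) z hz (z • (w : X) + A w)
  have h := aux_ftc (fun τ : ℝ => auxKer (m + 1) z τ • Tsg.T τ (w : X))
    (fun τ => auxKer m z τ • Tsg.T τ (w : X) - auxKer (m + 1) z τ • Tsg.T τ (z • (w : X) + A w))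
    (aux_contOn Tsg (m + 1) z w) ?_ (i1.sub i2)
    (aux_tendsto Tsg K hK (m + 1) z hz w)
  · rw [integral_sub i1 i2] at h
    have h0 : auxKer (m + 1) z 0 = 0 := by simp [auxKer]
    rw [h0, zero_smul, neg_zero, sub_eq_zero] at h
    exact h.symm
  · intro x hx
    have h1 := (auxKer_hasDerivAt_succ m z x).hasDerivWithinAt.smul (s := Set.Ioi x)
      (aux_orbit_deriv Tsg A hgen w x hx)
    refine h1.congr_deriv ?_
    simp only [map_add, map_smul]
    module

theorem aux_lap_zero_norm (Tsg : C0Semigroup X) (K : ℝ) (hK : ∀ t : ℝ, 0 ≤ t → ‖Tsg.T t‖ ≤ K)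
    (z : ℂ) (hz : 0 < z.re) (v : X) :
    ‖auxLap Tsg 0 z v‖ ≤ K / z.re * ‖v‖ := by
  unfold auxLap
  have h1 : IntegrableOn (fun τ : ℝ => (K * ‖v‖) * Real.exp (-z.re * τ)) (Set.Ioi 0) :=
    (integrableOn_exp_mul_Ioi (by linarith) 0).const_mul _
  refine (norm_integral_le_of_norm_le h1 ?_).trans (le_of_eq ?_)
  · filter_upwards [ae_restrict_mem measurableSet_Ioi] with τ hτ
    have hτ' : (0 : ℝ) ≤ τ := le_of_lt hτ
    rw [norm_smul, auxKer_norm 0 z τ hτ']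
    have h2 : ‖Tsg.T τ v‖ ≤ K * ‖v‖ := (Tsg.T τ).le_of_opNorm_le (hK τ hτ') v
    simp only [pow_zero, Nat.factorial_zero, Nat.cast_one, div_one, mul_one, neg_mul]
    rw [mul_comm]
    gcongr
  · rw [integral_const_mul, integral_exp_mul_Ioi (by linarith)]
    simp
    field_simp

end

section
variable {X : Type*} [NormedAddCommGroup X] [NormedSpace ℂ X] [CompleteSpace X]

theorem aux_lap_add (Tsg : C0Semigroup X) (K : ℝ) (hK : ∀ t : ℝ, 0 ≤ t → ‖Tsg.T t‖ ≤ K)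
    (m : ℕ) (z : ℂ) (hz : 0 < z.re) (v w : X) :
    auxLap Tsg m z (v + w) = auxLap Tsg m z v + auxLap Tsg m z w := by
  unfold auxLap
  rw [← integral_add (aux_integrable Tsg K hK m z hz v) (aux_integrable Tsg K hK m z hz w)]
  simp only [map_add, smul_add]

theorem aux_lap_smul (Tsg : C0Semigroup X) (m : ℕ) (z : ℂ) (c : ℂ) (v : X) :
    auxLap Tsg m z (c • v) = c • auxLap Tsg m z v := by
  unfold auxLap
  rw [← integral_smul]
  simp only [map_smul, smul_comm c]

variable (Tsg : C0Semigroup X) (K : ℝ) (hK : ∀ t : ℝ, 0 ≤ t → ‖Tsg.T t‖ ≤ K)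
    (A : X →ₗ.[ℂ] X) (hgen : IsGenerator Tsg A)
    (Res : ℝ → X →L[ℂ] X)
    (hRes : ∀ s : ℝ, IsResolvent A (Complex.I * (s : ℂ)) (Res s))

theorem aux_A_res (A : X →ₗ.[ℂ] X)
    (Res : ℝ → X →L[ℂ] X)
    (hRes : ∀ s : ℝ, IsResolvent A (Complex.I * (s : ℂ)) (Res s)) (s a : ℝ) (v : X) :
    ((a : ℂ) + Complex.I * s) • Res s v + A ⟨Res s v, (hRes s).mem_domain v⟩ = (a : ℂ) • Res s v + v := by
  have h := (hRes s).eq_apply v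
  rw [add_smul, add_assoc, h]

theorem aux_re (s a : ℝ) : ((a : ℂ) + Complex.I * s).re = a := by simp

theorem aux_lap_zero_res (Tsg : C0Semigroup X) (K : ℝ) (hK : ∀ t : ℝ, 0 ≤ t → ‖Tsg.T t‖ ≤ K)
    (A : X →ₗ.[ℂ] X) (hgen : IsGenerator Tsg A)
    (Res : ℝ → X →L[ℂ] X)
    (hRes : ∀ s : ℝ, IsResolvent A (Complex.I * (s : ℂ)) (Res s)) (s a : ℝ) (ha : 0 < a) (v : X) :
    (a : ℂ) • auxLap Tsg 0 ((a : ℂ) + Complex.I * s) (Res s v)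
      + auxLap Tsg 0 ((a : ℂ) + Complex.I * s) v = Res s v := by
  have hz : 0 < ((a : ℂ) + Complex.I * s).re := by rwa [aux_re]
  have h := aux_lap_zero Tsg K hK A hgen _ hz ⟨Res s v, (hRes s).mem_domain v⟩
  simp only at h
  rw [aux_A_res A Res hRes, aux_lap_add Tsg K hK _ _ hz, aux_lap_smul] at h
  exact h

theorem aux_lap_succ_res (Tsg : C0Semigroup X) (K : ℝ) (hK : ∀ t : ℝ, 0 ≤ t → ‖Tsg.T t‖ ≤ K)
    (A : X →ₗ.[ℂ] X) (hgen : IsGenerator Tsg A)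
    (Res : ℝ → X →L[ℂ] X)
    (hRes : ∀ s : ℝ, IsResolvent A (Complex.I * (s : ℂ)) (Res s)) (m : ℕ)
    (s a : ℝ) (ha : 0 < a) (v : X) :
    (a : ℂ) • auxLap Tsg (m + 1) ((a : ℂ) + Complex.I * s) (Res s v)
      + auxLap Tsg (m + 1) ((a : ℂ) + Complex.I * s) v
      = auxLap Tsg m ((a : ℂ) + Complex.I * s) (Res s v) := by
  have hz : 0 < ((a : ℂ) + Complex.I * s).re := by rwa [aux_re]
  have h := aux_lap_succ Tsg K hK A hgen m _ hz ⟨Res s v, (hRes s).mem_domain v⟩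
  simp only at h
  rw [aux_A_res A Res hRes, aux_lap_add Tsg K hK _ _ hz, aux_lap_smul] at h
  exact h

theorem aux_lap_mul (Tsg : C0Semigroup X) (K : ℝ) (hK : ∀ t : ℝ, 0 ≤ t → ‖Tsg.T t‖ ≤ K)
    (A : X →ₗ.[ℂ] X) (hgen : IsGenerator Tsg A)
    (Res : ℝ → X →L[ℂ] X)
    (hRes : ∀ s : ℝ, IsResolvent A (Complex.I * (s : ℂ)) (Res s)) (m : ℕ)
    (s a : ℝ) (ha : 0 < a) (v : X) :
    auxLap Tsg (m + 1) ((a : ℂ) + Complex.I * s) v =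
      auxLap Tsg 0 ((a : ℂ) + Complex.I * s) (auxLap Tsg m ((a : ℂ) + Complex.I * s) v) := by
  have hz : 0 < ((a : ℂ) + Complex.I * s).re := by rwa [aux_re]
  have h1 := aux_lap_succ_res Tsg K hK A hgen Res hRes m s a ha v
  set z : ℂ := (a : ℂ) + Complex.I * s with hzd
  rw [aux_lap_comm Tsg K hK A hgen _ _ (hRes s) _ z hz,
    aux_lap_comm Tsg K hK A hgen _ _ (hRes s) _ z hz, ← map_smul] at h1
  set p := auxLap Tsg (m + 1) z v with hp
  set q := auxLap Tsg m z v with hq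
  have h2 : Res s (q - (a : ℂ) • p) = p := by
    rw [map_sub, ← h1]
    abel
  have h3 := aux_lap_zero_res Tsg K hK A hgen Res hRes s a ha (q - (a : ℂ) • p)
  rw [← hzd, h2, ← aux_lap_smul, ← aux_lap_add Tsg K hK _ _ hz] at h3
  rw [← h3]
  congr 1
  abel

theorem aux_lap_bound (Tsg : C0Semigroup X) (K : ℝ) (hK : ∀ t : ℝ, 0 ≤ t → ‖Tsg.T t‖ ≤ K)
    (A : X →ₗ.[ℂ] X) (hgen : IsGenerator Tsg A)
    (Res : ℝ → X →L[ℂ] X)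
    (hRes : ∀ s : ℝ, IsResolvent A (Complex.I * (s : ℂ)) (Res s))
    (s a : ℝ) (ha : 0 < a) (v : X) :
    ‖auxLap Tsg 0 ((a : ℂ) + Complex.I * s) v‖ ≤ (1 + K) * ‖Res s‖ * ‖v‖ := by
  have hz : 0 < ((a : ℂ) + Complex.I * s).re := by rwa [aux_re]
  have h1 := aux_lap_zero_res Tsg K hK A hgen Res hRes s a ha v
  have h2 := aux_lap_zero_norm Tsg K hK _ hz v
  rw [aux_re] at h2
  set z : ℂ := (a : ℂ) + Complex.I * s with hzd
  rw [aux_lap_comm Tsg K hK A hgen _ _ (hRes s) _ z hz, ← map_smul] at h1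
  have h3 : auxLap Tsg 0 z v = Res s (v - (a : ℂ) • auxLap Tsg 0 z v) := by
    rw [map_sub, ← h1, add_sub_cancel_left]
  have h4 : ‖v - (a : ℂ) • auxLap Tsg 0 z v‖ ≤ (1 + K) * ‖v‖ := by
    refine (norm_sub_le _ _).trans ?_
    rw [norm_smul, Complex.norm_real, Real.norm_of_nonneg ha.le]
    have : a * ‖auxLap Tsg 0 z v‖ ≤ a * (K / a * ‖v‖) := by gcongr
    have e : a * (K / a * ‖v‖) = K * ‖v‖ := by field_simp
    linarith
  calc ‖auxLap Tsg 0 z v‖ = ‖Res s (v - (a : ℂ) • auxLap Tsg 0 z v)‖ := by rw [← h3]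
    _ ≤ ‖Res s‖ * ‖v - (a : ℂ) • auxLap Tsg 0 z v‖ := (Res s).le_opNorm _
    _ ≤ ‖Res s‖ * ((1 + K) * ‖v‖) := by gcongr
    _ = _ := by ring

theorem aux_lap_res0 (Tsg : C0Semigroup X) (K : ℝ) (hK : ∀ t : ℝ, 0 ≤ t → ‖Tsg.T t‖ ≤ K)
    (A : X →ₗ.[ℂ] X) (hgen : IsGenerator Tsg A)
    (Res : ℝ → X →L[ℂ] X)
    (hRes : ∀ s : ℝ, IsResolvent A (Complex.I * (s : ℂ)) (Res s))
    (s a : ℝ) (ha : 0 < a) (p : ℝ) (hp0 : ‖Res 0‖ ≤ p)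
    (hp : ∀ v, ‖auxLap Tsg 0 ((a : ℂ) + Complex.I * s) v‖ ≤ p * ‖v‖) (v : X) :
    ‖auxLap Tsg 0 ((a : ℂ) + Complex.I * s) (Res 0 v)‖
      ≤ p * ((4 + 2 * ‖Res 0‖) / (1 + |s|)) * ‖v‖ := by
  have hz : 0 < ((a : ℂ) + Complex.I * s).re := by rwa [aux_re]
  have hpn : 0 ≤ p := (norm_nonneg _).trans hp0
  have hzs : |s| ≤ ‖(a : ℂ) + Complex.I * s‖ := by
    have := Complex.abs_im_le_norm ((a : ℂ) + Complex.I * s)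
    simpa using this
  have h := aux_lap_zero Tsg K hK A hgen _ hz ⟨Res 0 v, (hRes 0).mem_domain v⟩
  have hA : A ⟨Res 0 v, (hRes 0).mem_domain v⟩ = v := by
    have := (hRes 0).eq_apply v
    simpa using this
  simp only at h
  rw [hA, aux_lap_add Tsg K hK _ _ hz, aux_lap_smul] at h
  set z : ℂ := (a : ℂ) + Complex.I * s with hzd
  have h1 : z • auxLap Tsg 0 z (Res 0 v) = Res 0 v - auxLap Tsg 0 z v := eq_sub_of_add_eq h
  have h2 : |s| * ‖auxLap Tsg 0 z (Res 0 v)‖ ≤ 2 * p * ‖v‖ := by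
    calc |s| * ‖auxLap Tsg 0 z (Res 0 v)‖ ≤ ‖z‖ * ‖auxLap Tsg 0 z (Res 0 v)‖ := by gcongr
      _ = ‖Res 0 v - auxLap Tsg 0 z v‖ := by rw [← norm_smul, h1]
      _ ≤ ‖Res 0 v‖ + ‖auxLap Tsg 0 z v‖ := norm_sub_le _ _
      _ ≤ p * ‖v‖ + p * ‖v‖ := add_le_add ((Res 0).le_of_opNorm_le hp0 v) (hp v)
      _ = _ := by ring
  have h3 : ‖auxLap Tsg 0 z (Res 0 v)‖ ≤ p * (‖Res 0‖ * ‖v‖) :=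
    (hp _).trans (by gcongr; exact (Res 0).le_opNorm v)
  rw [mul_div_assoc', div_mul_eq_mul_div, le_div_iff₀ (by positivity)]
  have hn := norm_nonneg (auxLap Tsg 0 z (Res 0 v))
  have hpv : 0 ≤ p * ‖v‖ := by positivity
  have hprv : 0 ≤ p * ‖Res 0‖ * ‖v‖ := by positivity
  rcases le_total |s| 1 with hs | hs
  · have : ‖auxLap Tsg 0 z (Res 0 v)‖ * (1 + |s|) ≤ ‖auxLap Tsg 0 z (Res 0 v)‖ * 2 := by
      gcongr; linarith
    nlinarith
  · have : ‖auxLap Tsg 0 z (Res 0 v)‖ * (1 + |s|) ≤ 2 * (|s| * ‖auxLap Tsg 0 z (Res 0 v)‖) := by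
      nlinarith
    nlinarith

theorem aux_lap_pointwise (Tsg : C0Semigroup X) (K : ℝ) (hK : ∀ t : ℝ, 0 ≤ t → ‖Tsg.T t‖ ≤ K)
    (A : X →ₗ.[ℂ] X) (hgen : IsGenerator Tsg A)
    (Res : ℝ → X →L[ℂ] X)
    (hRes : ∀ s : ℝ, IsResolvent A (Complex.I * (s : ℂ)) (Res s))
    (s a : ℝ) (ha : 0 < a) (p : ℝ) (hp0 : ‖Res 0‖ ≤ p)
    (hp : ∀ v, ‖auxLap Tsg 0 ((a : ℂ) + Complex.I * s) v‖ ≤ p * ‖v‖) (x : X) (m : ℕ) :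
    ‖auxLap Tsg (m + 1) ((a : ℂ) + Complex.I * s) (Res 0 x)‖
      ≤ p ^ (m + 1) * ((4 + 2 * ‖Res 0‖) / (1 + |s|))
        * ‖auxLap Tsg 0 ((a : ℂ) + Complex.I * s) x‖ := by
  have hz : 0 < ((a : ℂ) + Complex.I * s).re := by rwa [aux_re]
  have hpn : 0 ≤ p := (norm_nonneg _).trans hp0
  induction m with
  | zero =>
    rw [aux_lap_mul Tsg K hK A hgen Res hRes 0 s a ha,
      aux_lap_comm Tsg K hK A hgen _ _ (hRes 0) _ _ hz]
    simpa using aux_lap_res0 Tsg K hK A hgen Res hRes s a ha p hp0 hp _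
  | succ m ih =>
    rw [aux_lap_mul Tsg K hK A hgen Res hRes (m + 1) s a ha]
    refine (hp _).trans ?_
    calc _ ≤ p * (p ^ (m + 1) * ((4 + 2 * ‖Res 0‖) / (1 + |s|))
        * ‖auxLap Tsg 0 ((a : ℂ) + Complex.I * s) x‖) := by gcongr
      _ = _ := by ring

end

open FourierTransform in
theorem aux_plancherel_real {X : Type*} [NormedAddCommGroup X] [InnerProductSpace ℂ X]
    [CompleteSpace X] (f g : ℝ → X) (hf1 : Integrable f) (hf2 : MemLp f 2)
    (hg1 : Integrable g) (hg2 : MemLp g 2) (B : ℝ) (hB : 0 ≤ B)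
    (h : ∀ ξ, ‖𝓕 f ξ‖ ≤ B * ‖𝓕 g ξ‖) :
    ∫ x, ‖f x‖ ^ 2 ≤ B ^ 2 * ∫ x, ‖g x‖ ^ 2 := by
  have h1 : eLpNorm (𝓕 f) 2 volume ≤ ENNReal.ofReal B * eLpNorm (𝓕 g) 2 volume :=
    eLpNorm_le_mul_eLpNorm_of_ae_le_mul (Filter.Eventually.of_forall h) 2
  rw [aux_plancherel f hf1 hf2, aux_plancherel g hg1 hg2] at h1
  have hsq : ∀ u : ℝ → X, MemLp u 2 →
      (eLpNorm u 2 volume).toReal ^ 2 = ∫ x, ‖u x‖ ^ 2 := by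
    intro u hu
    have h0 : 0 ≤ ∫ x, ‖u x‖ ^ 2 := integral_nonneg fun x => by positivity
    rw [hu.eLpNorm_eq_integral_rpow_norm (by norm_num) (by norm_num),
      ENNReal.toReal_ofReal (by positivity)]
    simp only [ENNReal.toReal_ofNat, Real.rpow_ofNat]
    rw [← Real.rpow_natCast, ← Real.rpow_mul h0]
    norm_num
  have h2 := ENNReal.toReal_mono (ENNReal.mul_ne_top ENNReal.ofReal_ne_top hg2.eLpNorm_ne_top) h1
  rw [ENNReal.toReal_mul, ENNReal.toReal_ofReal hB] at h2
  rw [← hsq f hf2, ← hsq g hg2, ← mul_pow]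
  exact pow_le_pow_left₀ ENNReal.toReal_nonneg h2 2

/-- The function `1_{τ>0} e^{-aτ} τ^m/m! T(τ) v`. -/
noncomputable def auxFun {X : Type*} [NormedAddCommGroup X] [NormedSpace ℂ X]
    (Tsg : C0Semigroup X) (m : ℕ) (a : ℝ) (v : X) : ℝ → X :=
  Set.indicator (Set.Ioi 0) (fun τ : ℝ => auxKer m (a : ℂ) τ • Tsg.T τ v)

section
variable {X : Type*} [NormedAddCommGroup X] [NormedSpace ℂ X] [CompleteSpace X]

theorem auxFun_integrable (Tsg : C0Semigroup X) (K : ℝ) (hK : ∀ t : ℝ, 0 ≤ t → ‖Tsg.T t‖ ≤ K)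
    (m : ℕ) (a : ℝ) (ha : 0 < a) (v : X) : Integrable (auxFun Tsg m a v) := by
  unfold auxFun
  rw [integrable_indicator_iff measurableSet_Ioi]
  exact aux_integrable Tsg K hK m a (by simpa using ha) v

theorem auxFun_memLp (Tsg : C0Semigroup X) (K : ℝ) (hK : ∀ t : ℝ, 0 ≤ t → ‖Tsg.T t‖ ≤ K)
    (m : ℕ) (a : ℝ) (ha : 0 < a) (v : X) : MemLp (auxFun Tsg m a v) 2 := by
  have hi := auxFun_integrable Tsg K hK m a ha v
  rw [memLp_two_iff_integrable_sq_norm hi.aestronglyMeasurable]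
  have hz : 0 < ((a : ℂ)).re := by simpa using ha
  have hK0 : 0 ≤ K := (norm_nonneg _).trans (hK 0 le_rfl)
  set M : ℝ := (2 / ((a : ℂ)).re) ^ m * (K * ‖v‖) with hM
  have hM0 : 0 ≤ M := by positivity
  refine Integrable.mono' (hi.norm.const_mul M) (hi.aestronglyMeasurable.norm.pow 2) ?_
  filter_upwards with τ
  rw [Real.norm_of_nonneg (by positivity), pow_two]
  refine mul_le_mul_of_nonneg_right ?_ (norm_nonneg _)
  unfold auxFun
  by_cases hτ : τ ∈ Set.Ioi (0 : ℝ)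
  · rw [Set.indicator_of_mem hτ]
    have hτ' : (0 : ℝ) < τ := hτ
    refine (aux_norm_le Tsg K hK m a hz v τ hτ'.le).trans ?_
    have : Real.exp (-(((a : ℂ)).re / 2) * τ) ≤ 1 := by
      rw [Real.exp_le_one_iff]
      have := mul_pos hz hτ'
      nlinarith
    exact mul_le_of_le_one_right hM0 this
  · rw [Set.indicator_of_notMem hτ, norm_zero]
    exact hM0

open FourierTransform in
theorem auxFun_fourier (Tsg : C0Semigroup X) (m : ℕ) (a : ℝ) (v : X) (ξ : ℝ) :
    𝓕 (auxFun Tsg m a v) ξ =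
      auxLap Tsg m ((a : ℂ) + Complex.I * ((2 * Real.pi * ξ : ℝ) : ℂ)) v := by
  rw [Real.fourier_real_eq_integral_exp_smul]
  unfold auxLap auxFun
  rw [← integral_indicator measurableSet_Ioi]
  congr 1
  ext τ
  by_cases hτ : τ ∈ Set.Ioi (0 : ℝ)
  · rw [Set.indicator_of_mem hτ, Set.indicator_of_mem hτ, smul_smul]
    congr 1
    unfold auxKer
    rw [← mul_assoc, ← Complex.exp_add]
    congr 2
    push_cast
    ring
  · rw [Set.indicator_of_notMem hτ, Set.indicator_of_notMem hτ, smul_zero]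

end

section
variable {X : Type*} [NormedAddCommGroup X] [InnerProductSpace ℂ X] [CompleteSpace X]

theorem aux_upper (Tsg : C0Semigroup X) (K : ℝ) (hK : ∀ t : ℝ, 0 ≤ t → ‖Tsg.T t‖ ≤ K)
    (t : ℝ) (ht : 0 < t) (x : X) :
    ∫ τ, ‖auxFun Tsg 0 (1 / t) x τ‖ ^ 2 ≤ (K * ‖x‖) ^ 2 * (t / 2) := by
  have ha : 0 < 1 / t := by positivity
  have hm := auxFun_memLp Tsg K hK 0 (1 / t) ha x
  have hi := hm.integrable_norm_pow (by norm_num)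
  have hneg : -(2 * (1 / t)) < 0 := by linarith
  have e : ∫ τ in Set.Ioi (0 : ℝ), (K * ‖x‖) ^ 2 * Real.exp (-(2 * (1 / t)) * τ)
      = (K * ‖x‖) ^ 2 * (t / 2) := by
    rw [integral_const_mul, integral_exp_mul_Ioi hneg]
    simp
    left
    field_simp
  have hi2 : IntegrableOn (fun τ : ℝ => (K * ‖x‖) ^ 2 * Real.exp (-(2 * (1 / t)) * τ))
      (Set.Ioi 0) := (integrableOn_exp_mul_Ioi hneg 0).const_mul _
  rw [← e, ← integral_indicator measurableSet_Ioi]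
  refine integral_mono hi ((integrable_indicator_iff measurableSet_Ioi).2 hi2) fun τ => ?_
  unfold auxFun
  by_cases hτ : τ ∈ Set.Ioi (0 : ℝ)
  · have hτ' : (0 : ℝ) < τ := hτ
    simp only [Set.indicator_of_mem hτ]
    rw [norm_smul, auxKer_norm 0 _ τ hτ'.le, mul_pow, mul_comm]
    have h2 : ‖Tsg.T τ x‖ ≤ K * ‖x‖ := (Tsg.T τ).le_of_opNorm_le (hK τ hτ'.le) x
    have h3 : (Real.exp (-((((1 / t : ℝ)) : ℂ).re * τ)) * (τ ^ 0 / ((Nat.factorial 0 : ℕ) : ℝ))) ^ 2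
        = Real.exp (-(2 * (1 / t)) * τ) := by
      rw [Complex.ofReal_re]
      simp only [pow_zero, Nat.factorial_zero, Nat.cast_one, div_one, mul_one]
      rw [← Real.exp_nat_mul]
      congr 1
      push_cast
      ring
    rw [h3]
    gcongr
  · simp only [Set.indicator_of_notMem hτ]
    simp

theorem aux_lower (Tsg : C0Semigroup X) (K : ℝ) (hK1 : 1 ≤ K)
    (hK : ∀ t : ℝ, 0 ≤ t → ‖Tsg.T t‖ ≤ K)
    (m : ℕ) (t : ℝ) (ht : 0 < t) (w : X) :
    (Real.exp (-1) * ((t / 2) ^ m / (m.factorial : ℝ)) * (‖Tsg.T t w‖ / K)) ^ 2 * (t / 2)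
      ≤ ∫ τ, ‖auxFun Tsg m (1 / t) w τ‖ ^ 2 := by
  have ha : 0 < 1 / t := by positivity
  have hm := auxFun_memLp Tsg K hK m (1 / t) ha w
  have hi := hm.integrable_norm_pow (by norm_num)
  set c : ℝ := (Real.exp (-1) * ((t / 2) ^ m / (m.factorial : ℝ)) * (‖Tsg.T t w‖ / K)) with hc
  have hc0 : 0 ≤ c := by positivity
  have e : ∫ τ in Set.Ioc (t / 2) t, c ^ 2 = c ^ 2 * (t / 2) := by
    rw [setIntegral_const, Measure.real, Real.volume_Ioc, ENNReal.toReal_ofReal (by linarith),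
      smul_eq_mul]
    ring
  rw [← e]
  calc ∫ τ in Set.Ioc (t / 2) t, c ^ 2
      ≤ ∫ τ in Set.Ioc (t / 2) t, ‖auxFun Tsg m (1 / t) w τ‖ ^ 2 := by
        refine setIntegral_mono_on (by simp) hi.integrableOn measurableSet_Ioc fun τ hτ => ?_
        have hτ0 : 0 < τ := lt_trans (by positivity) hτ.1
        have hτm : τ ∈ Set.Ioi (0 : ℝ) := hτ0
        refine pow_le_pow_left₀ hc0 ?_ 2
        unfold auxFun
        rw [Set.indicator_of_mem hτm, norm_smul, auxKer_norm m _ τ hτ0.le, Complex.ofReal_re, hc]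
        have h1 : ‖Tsg.T t w‖ / K ≤ ‖Tsg.T τ w‖ := by
          rw [div_le_iff₀ (by linarith), mul_comm]
          have e1 := Tsg.map_add (t - τ) τ (by linarith [hτ.2]) hτ0.le
          rw [sub_add_cancel] at e1
          rw [e1]
          exact (Tsg.T (t - τ)).le_of_opNorm_le (hK _ (by linarith [hτ.2])) _
        have h2 : Real.exp (-1) ≤ Real.exp (-(1 / t * τ)) := by
          apply Real.exp_le_exp.2
          have : 1 / t * τ ≤ 1 := by
            rw [one_div_mul_eq_div, div_le_one ht]
            exact hτ.2
          linarith
        have h3 : t / 2 ≤ τ := hτ.1.le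
        gcongr
    _ ≤ ∫ τ, ‖auxFun Tsg m (1 / t) w τ‖ ^ 2 := by
        refine setIntegral_le_integral hi ?_
        exact Filter.Eventually.of_forall fun τ => by positivity

theorem aux_core (Tsg : C0Semigroup X) (K : ℝ) (hK1 : 1 ≤ K)
    (hK : ∀ t : ℝ, 0 ≤ t → ‖Tsg.T t‖ ≤ K)
    (A : X →ₗ.[ℂ] X) (hgen : IsGenerator Tsg A)
    (Res : ℝ → X →L[ℂ] X)
    (hRes : ∀ s : ℝ, IsResolvent A (Complex.I * (s : ℂ)) (Res s))
    (D : ℝ) (hD : 0 ≤ D) (n : ℕ) (t : ℝ) (ht : 0 < t) (R : ℝ) (hR : 1 ≤ R)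
    (h : ∀ s : ℝ, |s| ≤ R → ‖Res s‖ ≤ D * t * ((1 + |s|) / R) ^ (1 / ((n : ℝ) + 1))) :
    ‖Tsg.T t ∘L Res 0‖ ≤
      (((1 + K) * (D + 1)) ^ (n + 1) * (4 + 2 * ‖Res 0‖) * K ^ 2 * Real.exp 1
        * 2 ^ (n + 1) * ((n + 1).factorial : ℝ)) / R := by
  set P : ℝ := (1 + K) * (D + 1) with hP
  have hPK : K ≤ P := by nlinarith
  have hPD : (1 + K) * D ≤ P := by nlinarith
  have hPDD : D ≤ P := by nlinarith
  have hP0 : 0 < P := by positivity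
  have hR0 : 0 < R := by linarith
  set β : ℝ := 1 / ((n : ℝ) + 1) with hβ
  have hβ0 : 0 < β := by positivity
  have ha : 0 < 1 / t := by positivity
  set B : ℝ := P ^ (n + 1) * t ^ (n + 1) * (4 + 2 * ‖Res 0‖) / R with hB
  have hB0 : 0 ≤ B := by positivity
  have key : ∀ (s : ℝ) (x : X),
      ‖auxLap Tsg (n + 1) (((1 / t : ℝ) : ℂ) + Complex.I * s) (Res 0 x)‖
        ≤ B * ‖auxLap Tsg 0 (((1 / t : ℝ) : ℂ) + Complex.I * s) x‖ := by
    intro s x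
    set ρ : ℝ := min 1 ((1 + |s|) / R) with hρ
    have hs0 : 0 ≤ |s| := abs_nonneg s
    have hρ0 : 0 < ρ := by positivity
    have hρR : 1 / R ≤ ρ := by
      refine le_min ?_ ?_
      · rw [div_le_one hR0]; exact hR
      · gcongr; linarith
    have hp0 : ‖Res 0‖ ≤ P * t * ρ ^ β := by
      have := h 0 (by simpa using hR0.le)
      rw [abs_zero, add_zero] at this
      refine this.trans ?_
      gcongr
    have hp : ∀ v, ‖auxLap Tsg 0 (((1 / t : ℝ) : ℂ) + Complex.I * s) v‖ ≤ P * t * ρ ^ β * ‖v‖ := by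
      intro v
      rcases le_total ((1 + |s|) / R) 1 with hc | hc
      · have hsR : |s| ≤ R := by
          rw [div_le_one hR0] at hc
          linarith
        have hρe : ρ = (1 + |s|) / R := min_eq_right hc
        refine (aux_lap_bound Tsg K hK A hgen Res hRes s (1 / t) ha v).trans ?_
        rw [hρe]
        refine mul_le_mul_of_nonneg_right ?_ (norm_nonneg _)
        calc (1 + K) * ‖Res s‖ ≤ (1 + K) * (D * t * ((1 + |s|) / R) ^ β) := by
              gcongr
              exact h s hsR
          _ = ((1 + K) * D) * t * ((1 + |s|) / R) ^ β := by ring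
          _ ≤ _ := by gcongr
      · have hρe : ρ = 1 := min_eq_left hc
        have hz : 0 < ((((1 / t : ℝ) : ℂ)) + Complex.I * s).re := by rwa [aux_re]
        refine (aux_lap_zero_norm Tsg K hK _ hz v).trans ?_
        rw [aux_re, hρe, Real.one_rpow, mul_one, div_div_eq_mul_div, div_one]
        gcongr
    refine (aux_lap_pointwise Tsg K hK A hgen Res hRes s (1 / t) ha _ hp0 hp x n).trans ?_
    refine mul_le_mul_of_nonneg_right ?_ (norm_nonneg _)
    have e1 : (P * t * ρ ^ β) ^ (n + 1) = P ^ (n + 1) * t ^ (n + 1) * ρ := by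
      rw [mul_pow, mul_pow, ← Real.rpow_natCast (ρ ^ β), ← Real.rpow_mul hρ0.le]
      have : β * ((n + 1 : ℕ) : ℝ) = 1 := by
        rw [hβ]
        push_cast
        field_simp
      rw [this, Real.rpow_one]
    have e2 : ρ / (1 + |s|) ≤ 1 / R := by
      rw [div_le_iff₀ (by positivity), one_div_mul_eq_div]
      exact min_le_right _ _
    rw [e1, hB]
    calc P ^ (n + 1) * t ^ (n + 1) * ρ * ((4 + 2 * ‖Res 0‖) / (1 + |s|))
        = P ^ (n + 1) * t ^ (n + 1) * (4 + 2 * ‖Res 0‖) * (ρ / (1 + |s|)) := by ring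
      _ ≤ P ^ (n + 1) * t ^ (n + 1) * (4 + 2 * ‖Res 0‖) * (1 / R) := by gcongr
      _ = _ := by ring
  refine ContinuousLinearMap.opNorm_le_bound _ (by positivity) fun x => ?_
  rw [ContinuousLinearMap.comp_apply]
  set w := Res 0 x with hw
  have h1 := aux_lower Tsg K hK1 hK (n + 1) t ht w
  have h2 := aux_upper Tsg K hK t ht x
  have h3 := aux_plancherel_real (auxFun Tsg (n + 1) (1 / t) w) (auxFun Tsg 0 (1 / t) x)
    (auxFun_integrable Tsg K hK _ _ ha _) (auxFun_memLp Tsg K hK _ _ ha _)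
    (auxFun_integrable Tsg K hK _ _ ha _) (auxFun_memLp Tsg K hK _ _ ha _) B hB0 (by
      intro ξ
      rw [auxFun_fourier, auxFun_fourier]
      exact key _ x)
  have h4 : (Real.exp (-1) * ((t / 2) ^ (n + 1) / ((n + 1).factorial : ℝ)) * (‖Tsg.T t w‖ / K)) ^ 2
      ≤ (B * (K * ‖x‖)) ^ 2 := by
    have : (Real.exp (-1) * ((t / 2) ^ (n + 1) / ((n + 1).factorial : ℝ)) * (‖Tsg.T t w‖ / K)) ^ 2
        * (t / 2) ≤ (B * (K * ‖x‖)) ^ 2 * (t / 2) := by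
      calc _ ≤ _ := h1
        _ ≤ _ := h3
        _ ≤ B ^ 2 * ((K * ‖x‖) ^ 2 * (t / 2)) := by gcongr
        _ = _ := by ring
    exact le_of_mul_le_mul_right this (by positivity)
  have h5 := (pow_le_pow_iff_left₀ (by positivity) (by positivity) (by norm_num)).1 h4
  have hf : (0 : ℝ) < ((n + 1).factorial : ℝ) := by positivity
  have h6 : ‖Tsg.T t w‖ = (Real.exp (-1) * ((t / 2) ^ (n + 1) / ((n + 1).factorial : ℝ))
      * (‖Tsg.T t w‖ / K)) * (Real.exp 1 * 2 ^ (n + 1) * ((n + 1).factorial : ℝ) * K / t ^ (n + 1)) := by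
    rw [Real.exp_neg, div_pow]
    field_simp
  rw [h6]
  calc _ ≤ (B * (K * ‖x‖)) * (Real.exp 1 * 2 ^ (n + 1) * ((n + 1).factorial : ℝ) * K / t ^ (n + 1)) := by
        gcongr
    _ = _ := by
        rw [hB]
        field_simp

end

theorem aux_potter (l : ℝ → ℝ) (hsv : SlowlyVarying l) (hmono : Monotone l)
    (ε : ℝ) (hε : 0 < ε) (S : ℝ) :
    ∃ S1 : ℝ, 1 ≤ S1 ∧ S ≤ S1 ∧ (∀ u, S1 ≤ u → 0 < l u) ∧
      ∀ u, S1 ≤ u → ∀ v, u ≤ v → l v ≤ 2 ^ ε * (v / u) ^ ε * l u := by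
  obtain ⟨-, hpos, hlim⟩ := hsv
  have h2 : (1 : ℝ) < 2 ^ ε := Real.one_lt_rpow (by norm_num) hε
  have hev := (hlim 2 (by norm_num)).eventually (gt_mem_nhds h2)
  obtain ⟨S0, hS0⟩ := Filter.eventually_atTop.1 (hpos.and hev)
  refine ⟨max S0 (max 1 S), by simp, by simp, fun u hu => ?_, fun u hu v hv => ?_⟩
  · exact (hS0 u (le_trans (le_max_left _ _) hu)).1
  have hu0 : S0 ≤ u := le_trans (le_max_left _ _) hu
  have hu1 : 1 ≤ u := le_trans (le_trans (le_max_left _ _) (le_max_right _ _)) hu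
  have hlu := (hS0 u hu0).1
  have step : ∀ k : ℕ, l (2 ^ k * u) ≤ (2 ^ ε) ^ k * l u := by
    intro k
    induction k with
    | zero => simp
    | succ k ih =>
      have hk : S0 ≤ 2 ^ k * u := by
        have : (1 : ℝ) ≤ 2 ^ k := one_le_pow₀ (by norm_num)
        nlinarith
      obtain ⟨p1, p2⟩ := hS0 _ hk
      rw [div_lt_iff₀ p1] at p2
      have e : (2 : ℝ) ^ (k + 1) * u = 2 * (2 ^ k * u) := by ring
      rw [e]
      calc l (2 * (2 ^ k * u)) ≤ 2 ^ ε * l (2 ^ k * u) := p2.le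
        _ ≤ 2 ^ ε * ((2 ^ ε) ^ k * l u) := by gcongr
        _ = _ := by ring
  have hvu : 1 ≤ v / u := by
    rw [le_div_iff₀ (by linarith)]
    linarith
  obtain ⟨k, hk1, hk2⟩ := exists_nat_pow_near hvu (one_lt_two)
  rw [div_lt_iff₀ (by linarith)] at hk2
  have e : ((2 : ℝ) ^ ε) ^ k = ((2 : ℝ) ^ k) ^ ε := by
    rw [← Real.rpow_natCast, ← Real.rpow_mul (by norm_num), mul_comm,
      Real.rpow_mul (by norm_num), Real.rpow_natCast]
  calc l v ≤ l (2 ^ (k + 1) * u) := hmono hk2.le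
    _ ≤ (2 ^ ε) ^ (k + 1) * l u := step _
    _ = 2 ^ ε * ((2 : ℝ) ^ k) ^ ε * l u := by rw [← e]; ring
    _ ≤ _ := by gcongr

theorem aux_locbdd {X : Type*} [NormedAddCommGroup X] [NormedSpace ℂ X]
    (A : X →ₗ.[ℂ] X) (Res : ℝ → X →L[ℂ] X)
    (hRes : ∀ s : ℝ, IsResolvent A (Complex.I * (s : ℂ)) (Res s)) (S : ℝ) :
    ∃ M : ℝ, 0 ≤ M ∧ ∀ s : ℝ, |s| ≤ S → ‖Res s‖ ≤ M := by
  have h : ∃ M : ℝ, 0 ≤ M ∧ ∀ s ∈ Set.Icc (-S) S, ‖Res s‖ ≤ M := by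
    refine (isCompact_Icc (a := -S) (b := S)).induction_on
      (p := fun U : Set ℝ => ∃ M : ℝ, 0 ≤ M ∧ ∀ s ∈ U, ‖Res s‖ ≤ M) ?_ ?_ ?_ ?_
    · exact ⟨0, le_rfl, fun s hs => absurd hs (Set.notMem_empty s)⟩
    · rintro U V hUV ⟨M, hM, hV⟩
      exact ⟨M, hM, fun s hs => hV s (hUV hs)⟩
    · rintro U V ⟨M, hM, hU⟩ ⟨N, hN, hV⟩
      refine ⟨M + N, by positivity, fun s hs => ?_⟩
      rcases hs with hs | hs
      · linarith [hU s hs]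
      · linarith [hV s hs]
    · intro s0 _
      have hr : 0 < 1 / (2 * (‖Res s0‖ + 1)) := by positivity
      refine ⟨Metric.ball s0 (1 / (2 * (‖Res s0‖ + 1))),
        mem_nhdsWithin_of_mem_nhds (Metric.ball_mem_nhds s0 hr), 2 * ‖Res s0‖, by positivity,
        fun s hs => ?_⟩
      rw [Metric.mem_ball, Real.dist_eq, lt_div_iff₀ (by positivity)] at hs
      refine ContinuousLinearMap.opNorm_le_bound _ (by positivity) fun v => ?_
      have h1 := (hRes s).eq_apply v
      have h2 := (hRes s0).left_inv ⟨Res s v, (hRes s).mem_domain v⟩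
      simp only at h2
      have h3 : (Complex.I * (s0 : ℂ)) • Res s v + A ⟨Res s v, (hRes s).mem_domain v⟩
          = v + (Complex.I * ((s0 - s : ℝ) : ℂ)) • Res s v := by
        have h1' : A ⟨Res s v, (hRes s).mem_domain v⟩ = v - (Complex.I * (s : ℂ)) • Res s v :=
          eq_sub_of_add_eq (by rw [add_comm]; exact h1)
        rw [h1']
        push_cast
        module
      rw [h3] at h2
      have h4 : ‖Res s v‖ ≤ ‖Res s0‖ * (‖v‖ + |s - s0| * ‖Res s v‖) := by
        calc ‖Res s v‖ = ‖Res s0 (v + (Complex.I * ((s0 - s : ℝ) : ℂ)) • Res s v)‖ := by rw [h2]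
          _ ≤ ‖Res s0‖ * ‖v + (Complex.I * ((s0 - s : ℝ) : ℂ)) • Res s v‖ := (Res s0).le_opNorm _
          _ ≤ ‖Res s0‖ * (‖v‖ + ‖(Complex.I * ((s0 - s : ℝ) : ℂ)) • Res s v‖) := by
            gcongr; exact norm_add_le _ _
          _ = _ := by
            rw [norm_smul, norm_mul, Complex.norm_I, one_mul, Complex.norm_real, Real.norm_eq_abs,
              abs_sub_comm]
      have hn := norm_nonneg (Res s v)
      have h5 : |s - s0| * ‖Res s0‖ ≤ 1 / 2 := by
        have := abs_nonneg (s - s0)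
        nlinarith
      have h6 : (|s - s0| * ‖Res s0‖) * ‖Res s v‖ ≤ 1 / 2 * ‖Res s v‖ := by gcongr
      nlinarith
  obtain ⟨M, hM, h⟩ := h
  exact ⟨M, hM, fun s hs => h s (abs_le.1 hs)⟩


/-- Let `(T(t))_{t≥0}` be a bounded `C₀`-semigroup on a complex Hilbert
space `X` with generator `−A`.  Assume that `σ(A) ∩ iℝ` is empty (i.e. `(is+A)⁻¹` exists
for every real `s`) and that `‖(is+A)⁻¹‖ = O(|s|^α / ℓ(|s|))` as `|s| → ∞`, where `α > 0`
and `ℓ` is an increasing slowly varying function.  Then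
`‖T(t)A⁻¹‖ = O((t·ℓ(t^{1/α}))^{-1/α})` as `t → ∞`.  (Here `A⁻¹ = (i·0 + A)⁻¹ = Res 0`.) -/
theorem decay_rate_singularity_at_infinity_ell_increasing
    {X : Type*} [NormedAddCommGroup X] [InnerProductSpace ℂ X] [CompleteSpace X]
    (Tsg : C0Semigroup X) (hbdd : Tsg.Bounded)
    (A : X →ₗ.[ℂ] X) (hgen : IsGenerator Tsg A)
    (Res : ℝ → X →L[ℂ] X)
    (hRes : ∀ s : ℝ, IsResolvent A (Complex.I * (s : ℂ)) (Res s))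
    (α : ℝ) (hα : 0 < α)
    (l : ℝ → ℝ) (hsv : SlowlyVarying l) (hmono : Monotone l)
    (hbound : ∃ C > (0 : ℝ), ∃ S : ℝ, ∀ s : ℝ, S ≤ |s| →
      ‖Res s‖ ≤ C * (|s| ^ α / l |s|)) :
    (fun t : ℝ => ‖Tsg.T t ∘L Res 0‖) =O[atTop]
      fun t : ℝ => (t * l (t ^ (1 / α))) ^ (-(1 / α)) := by
  obtain ⟨K0, hK0⟩ := hbdd
  obtain ⟨C, hC, S, hS⟩ := hbound
  set K : ℝ := max 1 K0 with hKd
  have hK1 : 1 ≤ K := le_max_left _ _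
  have hK : ∀ t : ℝ, 0 ≤ t → ‖Tsg.T t‖ ≤ K := fun t ht => (hK0 t ht).trans (le_max_right _ _)
  set ε : ℝ := α / 2 with hε
  have hε0 : 0 < ε := by positivity
  obtain ⟨n, hn⟩ := exists_nat_one_div_lt hε0
  obtain ⟨S1, hS1, hSS1, hlpos, hpot⟩ := aux_potter l hsv hmono ε hε0 S
  obtain ⟨M, hM0, hM⟩ := aux_locbdd A Res hRes S1
  set β : ℝ := 1 / ((n : ℝ) + 1) with hβ
  have hβ0 : 0 < β := by positivity
  set δ : ℝ := l S1 with hδ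
  have hδ0 : 0 < δ := hlpos S1 le_rfl
  set c : ℝ := max 1 ((δ ^ (1 / α))⁻¹) with hc
  have hc1 : 1 ≤ c := le_max_left _ _
  have hS10 : 0 < S1 := by linarith
  set G : ℝ := 2 ^ ε * c ^ ε with hG
  have hG0 : 0 < G := by positivity
  set H : ℝ := δ * G * S1 ^ β / S1 ^ α with hH
  have hH0 : 0 < H := by positivity
  set D : ℝ := C * G + M * H with hD
  have hD0 : 0 ≤ D := by positivity
  refine IsBigO.of_bound (((1 + K) * (D + 1)) ^ (n + 1) * (4 + 2 * ‖Res 0‖) * K ^ 2 * Real.exp 1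
        * 2 ^ (n + 1) * ((n + 1).factorial : ℝ)) ?_
  have htend := tendsto_rpow_atTop (y := 1 / α) (by positivity)
  filter_upwards [eventually_gt_atTop 0, htend.eventually_ge_atTop (c * S1)] with t ht htc
  have htS1 : S1 ≤ t ^ (1 / α) := by nlinarith
  set Lt : ℝ := l (t ^ (1 / α)) with hLt
  have hLδ : δ ≤ Lt := hmono htS1
  have hLt0 : 0 < Lt := by linarith
  set R : ℝ := (t * Lt) ^ (1 / α) with hRd
  have hRα : R ^ α = t * Lt := by
    rw [hRd, ← Real.rpow_mul (by positivity), one_div_mul_cancel hα.ne', Real.rpow_one]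
  have hR0 : 0 < R := by positivity
  have htR : t ^ (1 / α) ≤ c * R := by
    have h1 : t ^ (1 / α) * δ ^ (1 / α) ≤ R := by
      rw [hRd, Real.mul_rpow ht.le hLt0.le]
      gcongr
    have h2 : 0 < δ ^ (1 / α) := by positivity
    calc t ^ (1 / α) = (δ ^ (1 / α))⁻¹ * (t ^ (1 / α) * δ ^ (1 / α)) := by field_simp
      _ ≤ c * R := by
        gcongr
        exact le_max_right _ _
  have hRS1 : S1 ≤ R := le_of_mul_le_mul_left (htc.trans htR) (by linarith)
  have hR1 : 1 ≤ R := hS1.trans hRS1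
  have Q : ∀ u, S1 ≤ u → u ≤ R → u ^ α / l u ≤ G * t * (u / R) ^ β := by
    intro u hu1 hu2
    have hu0 : 0 < u := by linarith
    have hlu := hlpos u hu1
    have q1 : Lt ≤ G * (R / u) ^ ε * l u := by
      have hle : u ≤ c * R := by nlinarith
      calc Lt ≤ l (c * R) := hmono htR
        _ ≤ 2 ^ ε * (c * R / u) ^ ε * l u := hpot u hu1 _ hle
        _ = _ := by
          rw [mul_div_assoc, Real.mul_rpow (by positivity) (by positivity), hG]
          ring
    have q2 : (u / R) ^ α * (R / u) ^ ε = (u / R) ^ ε := by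
      have : R / u = (u / R)⁻¹ := by rw [inv_div]
      rw [this, Real.inv_rpow (by positivity), ← Real.rpow_neg (by positivity),
        ← Real.rpow_add (by positivity)]
      congr 1
      rw [hε]
      ring
    have q3 : (u / R) ^ ε ≤ (u / R) ^ β :=
      Real.rpow_le_rpow_of_exponent_ge (by positivity) ((div_le_one hR0).2 hu2) hn.le
    have q4 : u ^ α = (u / R) ^ α * (t * Lt) := by
      rw [← hRα, ← Real.mul_rpow (by positivity) (by positivity), div_mul_cancel₀ _ hR0.ne']
    rw [div_le_iff₀ hlu, q4]
    calc (u / R) ^ α * (t * Lt) ≤ (u / R) ^ α * (t * (G * (R / u) ^ ε * l u)) := by gcongr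
      _ = G * t * ((u / R) ^ α * (R / u) ^ ε) * l u := by ring
      _ = G * t * (u / R) ^ ε * l u := by rw [q2]
      _ ≤ _ := by gcongr
  have hmain : ∀ s : ℝ, |s| ≤ R → ‖Res s‖ ≤ D * t * ((1 + |s|) / R) ^ (1 / ((n : ℝ) + 1)) := by
    intro s hs
    have hs0 := abs_nonneg s
    rcases le_total S1 |s| with h | h
    · have h1 := hS s (hSS1.trans h)
      have h2 := Q |s| h hs
      calc ‖Res s‖ ≤ C * (|s| ^ α / l |s|) := h1
        _ ≤ C * (G * t * (|s| / R) ^ β) := by gcongr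
        _ = (C * G) * t * (|s| / R) ^ β := by ring
        _ ≤ D * t * ((1 + |s|) / R) ^ β := by
          gcongr
          · rw [hD]
            have : 0 ≤ M * H := by positivity
            linarith
          · linarith
    · have h1 := hM s h
      have h2 := Q S1 le_rfl hRS1
      have h3 : 1 ≤ H * (t * (1 / R) ^ β) := by
        have e : (S1 / R) ^ β = S1 ^ β * (1 / R) ^ β := by
          rw [← Real.mul_rpow (by positivity) (by positivity), mul_one_div]
        rw [← hδ, e, div_le_iff₀ hδ0] at h2
        have e2 : H * (t * (1 / R) ^ β)
            = (G * t * (S1 ^ β * (1 / R) ^ β) * δ) / S1 ^ α := by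
          rw [hH]
          ring
        rw [e2, le_div_iff₀ (by positivity), one_mul]
        exact h2
      calc ‖Res s‖ ≤ M := h1
        _ ≤ M * (H * (t * (1 / R) ^ β)) := le_mul_of_one_le_right hM0 h3
        _ = (M * H) * t * (1 / R) ^ β := by ring
        _ ≤ D * t * ((1 + |s|) / R) ^ β := by
          gcongr
          · rw [hD]
            have : 0 ≤ C * G := by positivity
            linarith
          · linarith
  have hfin := aux_core Tsg K hK1 hK A hgen Res hRes D hD0 n t ht R hR1 hmain
  rw [norm_norm]
  refine hfin.trans (le_of_eq ?_)
  rw [Real.rpow_neg (by positivity), Real.norm_of_nonneg (by positivity), div_eq_mul_inv]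
end

section
/- Let (T(t))_{t≥0} be a bounded C₀-semigroup on a complex Hilbert space X with generator −A. Assume that σ(A) ∩ iℝ is empty, that ‖(is+A)^{-1}‖ = O(|s|^α / ℓ(|s|)) as |s| → ∞ with α > 0 and ℓ an increasing slowly varying function, and that ℓ is dB-symmetric. Then ‖T(t)A^{-1}‖ = O( 1 / M^{-1}(t) ) as t → ∞, where M^{-1} is any asymptotic inverse of the function M(s) = s^α / ℓ(s). -/
open Filter MeasureTheory Set Complex Asymptotics

theorem plancherel_aux {X : Type*} [NormedAddCommGroup X] [InnerProductSpace ℂ X]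
    [CompleteSpace X] (f : ℝ → X) (h1 : Integrable f) (h2 : MemLp f 2) :
    Integrable (fun ξ => ‖FourierTransform.fourier f ξ‖ ^ 2) ∧
      ∫ ξ, ‖FourierTransform.fourier f ξ‖ ^ 2 = ∫ x, ‖f x‖ ^ 2 := by
  set F : Lp X 2 (volume : Measure ℝ) := h2.toLp f with hF
  set G : Lp X 2 (volume : Measure ℝ) := FourierTransform.fourier F with hG
  have hcont : Continuous (FourierTransform.fourier f) :=
    VectorFourier.fourierIntegral_continuous Real.continuous_fourierChar
      (L := innerₗ ℝ) continuous_inner h1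
  have hae : ∀ᵐ ξ : ℝ, G ξ = FourierTransform.fourier f ξ := by
    apply ae_eq_of_integral_contDiff_smul_eq
    · exact (Lp.memLp G).locallyIntegrable (by norm_num)
    · exact hcont.locallyIntegrable
    · intro g g_smooth g_cpt
      have hg₁ : HasCompactSupport (Complex.ofRealCLM ∘ g) := g_cpt.comp_left rfl
      have hg₂ : ContDiff ℝ ((⊤ : ℕ∞) : WithTop ℕ∞) (Complex.ofRealCLM ∘ g) := by fun_prop
      set φ := hg₁.toSchwartzMap hg₂ with hφ
      have e1 : ∫ x, g x • G x = Lp.toTemperedDistribution G φ := by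
        simp [hφ]
      rw [e1, hG, ← Lp.fourier_toTemperedDistribution_eq, TemperedDistribution.fourier_apply,
        Lp.toTemperedDistribution_apply]
      have e2 : ∫ x, (FourierTransform.fourier φ) x • F x
          = ∫ x, (FourierTransform.fourier φ) x • f x := by
        apply integral_congr_ae
        filter_upwards [h2.coeFn_toLp] with x hx
        rw [hF, hx]
      rw [e2]
      have e3 := VectorFourier.integral_fourierIntegral_smul_eq_flip (L := innerₗ ℝ)
        (μ := volume) (ν := volume) Real.continuous_fourierChar continuous_inner
        φ.integrable h1
      rw [flip_innerₗ] at e3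
      refine e3.trans ?_
      apply integral_congr_ae
      filter_upwards with x
      simp [hφ]
      rfl
  have hnorm : ∀ H : Lp X 2 (volume : Measure ℝ), ‖H‖ ^ 2 = ∫ x, ‖H x‖ ^ 2 := by
    intro H
    rw [Lp.norm_def, MeasureTheory.MemLp.eLpNorm_eq_integral_rpow_norm (by norm_num) (by norm_num)
      (Lp.memLp H), ENNReal.toReal_ofReal (by positivity)]
    simp only [ENNReal.toReal_ofNat, Real.rpow_ofNat]
    rw [← one_div, ← Real.sqrt_eq_rpow]
    exact Real.sq_sqrt (by positivity)
  have hGF : ‖G‖ = ‖F‖ := Lp.norm_fourier_eq F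
  have i1 : ∫ x, ‖G x‖ ^ 2 = ∫ ξ, ‖FourierTransform.fourier f ξ‖ ^ 2 := by
    apply integral_congr_ae
    filter_upwards [hae] with x hx
    rw [hx]
  have i2 : ∫ x, ‖F x‖ ^ 2 = ∫ ξ, ‖f ξ‖ ^ 2 := by
    apply integral_congr_ae
    filter_upwards [h2.coeFn_toLp] with x hx
    rw [hF, hx]
  refine ⟨?_, ?_⟩
  · have : Integrable (fun x => ‖G x‖ ^ 2) := (Lp.memLp G).integrable_norm_pow (by norm_num)
    refine this.congr ?_
    filter_upwards [hae] with x hx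
    rw [hx]
  · rw [← i1, ← i2, ← hnorm, ← hnorm, hGF]

section BTSemigroup

variable {X : Type*} [NormedAddCommGroup X] [InnerProductSpace ℂ X] [CompleteSpace X]

set_option linter.unusedSectionVars false

theorem bt_orbit (Tsg : C0Semigroup X) (A : X →ₗ.[ℂ] X) (hgen : IsGenerator Tsg A)
    (z y : X) (hz : ∃ hx : z ∈ A.domain, A ⟨z, hx⟩ = y) (τ : ℝ) (hτ : 0 ≤ τ) :
    ∃ hx : Tsg.T τ z ∈ A.domain, A ⟨Tsg.T τ z, hx⟩ = Tsg.T τ y := by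
  rw [hgen] at hz ⊢
  have h := ((Tsg.T τ).continuous.tendsto _).comp hz
  rw [map_neg] at h
  refine h.congr' ?_
  filter_upwards [self_mem_nhdsWithin] with h hh
  have hh : 0 ≤ h := le_of_lt hh
  have e1 : Tsg.T h (Tsg.T τ z) = Tsg.T τ (Tsg.T h z) := by
    have := Tsg.map_add h τ hh hτ
    rw [add_comm, Tsg.map_add τ h hτ hh] at this
    exact (congrArg (fun B => B z) this).symm
  simp [e1]

theorem bt_hasDeriv (Tsg : C0Semigroup X) (A : X →ₗ.[ℂ] X) (hgen : IsGenerator Tsg A)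
    (z y : X) (hz : ∃ hx : z ∈ A.domain, A ⟨z, hx⟩ = y) (τ : ℝ) (hτ : 0 ≤ τ) :
    HasDerivWithinAt (fun τ : ℝ => Tsg.T τ z) (-(Tsg.T τ y)) (Ioi τ) τ := by
  have h0 := (hgen _ _).1 (bt_orbit Tsg A hgen z y hz τ hτ)
  rw [hasDerivWithinAt_iff_tendsto_slope' (by simp)]
  have hm : Tendsto (fun u : ℝ => u - τ) (nhdsWithin τ (Ioi τ)) (nhdsWithin 0 (Ioi 0)) := by
    apply tendsto_nhdsWithin_of_tendsto_nhds_of_eventually_within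
    · have : Tendsto (fun u : ℝ => u - τ) (nhds τ) (nhds (τ - τ)) :=
        (continuous_id.sub continuous_const).tendsto τ
      rw [sub_self] at this
      exact this.mono_left nhdsWithin_le_nhds
    · filter_upwards [self_mem_nhdsWithin] with u hu
      simpa using hu
  refine (h0.comp hm).congr' ?_
  filter_upwards [self_mem_nhdsWithin] with u hu
  have hu' : 0 ≤ u - τ := by have : τ < u := hu; linarith
  have e : Tsg.T u z = Tsg.T (u - τ) (Tsg.T τ z) := by
    have := Tsg.map_add (u - τ) τ hu' hτ
    rw [sub_add_cancel] at this
    rw [this]; rfl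
  simp only [Function.comp, slope_def_module, e]
  rw [← Complex.ofReal_inv, Complex.coe_smul]

theorem bt_commute (Tsg : C0Semigroup X) (A : X →ₗ.[ℂ] X) (hgen : IsGenerator Tsg A)
    (lam : ℂ) (R : X →L[ℂ] X) (hR : IsResolvent A lam R) (τ : ℝ) (hτ : 0 ≤ τ) (z : X) :
    R (Tsg.T τ z) = Tsg.T τ (R z) := by
  obtain ⟨hx, h⟩ := bt_orbit Tsg A hgen (R z) _ ⟨hR.mem_domain z, rfl⟩ τ hτ
  have h2 := hR.left_inv ⟨_, hx⟩
  rw [h] at h2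
  simp only at h2
  rw [← map_smul, ← map_add, hR.eq_apply] at h2
  exact h2

/-- The weighted orbit. -/
noncomputable def btg (Tsg : C0Semigroup X) (t : ℝ) (p : Polynomial ℝ) (z : X) : ℝ → X :=
  fun τ => p.eval (τ / t) • Tsg.T τ z

/-- The finite Fourier integral of the weighted orbit. -/
noncomputable def btF (Tsg : C0Semigroup X) (t : ℝ) (p : Polynomial ℝ) (z : X) (s : ℝ) : X :=
  ∫ τ in (0 : ℝ)..t, Complex.exp (-(Complex.I * s) * τ) • btg Tsg t p z τ

theorem btg_cont (Tsg : C0Semigroup X) (t : ℝ) (p : Polynomial ℝ) (z : X) :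
    ContinuousOn (btg Tsg t p z) (Ici 0) := by
  have : Continuous fun τ : ℝ => p.eval (τ / t) :=
    p.continuous.comp (continuous_id.div_const t)
  exact this.continuousOn.smul (Tsg.strong_continuity z)

theorem btF_cont (Tsg : C0Semigroup X) (t : ℝ) (p : Polynomial ℝ) (z : X) (s : ℝ) :
    ContinuousOn (fun τ : ℝ => Complex.exp (-(Complex.I * s) * τ) • btg Tsg t p z τ)
      (Ici 0) := by
  apply ContinuousOn.smul
  · have : Continuous fun τ : ℝ => Complex.exp (-(Complex.I * s) * τ) := by fun_prop
    exact this.continuousOn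
  · exact btg_cont Tsg t p z

theorem btF_int (Tsg : C0Semigroup X) (t : ℝ) (ht : 0 < t) (p : Polynomial ℝ) (z : X) (s : ℝ) :
    IntervalIntegrable (fun τ : ℝ => Complex.exp (-(Complex.I * s) * τ) • btg Tsg t p z τ)
      volume 0 t := by
  apply ContinuousOn.intervalIntegrable
  rw [uIcc_of_le ht.le]
  exact (btF_cont Tsg t p z s).mono Icc_subset_Ici_self

theorem btF_add (Tsg : C0Semigroup X) (t : ℝ) (ht : 0 < t) (p : Polynomial ℝ) (z w : X)
    (s : ℝ) : btF Tsg t p (z + w) s = btF Tsg t p z s + btF Tsg t p w s := by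
  unfold btF
  rw [← intervalIntegral.integral_add (btF_int Tsg t ht p z s) (btF_int Tsg t ht p w s)]
  simp [btg]

theorem btF_smul (Tsg : C0Semigroup X) (t : ℝ) (p : Polynomial ℝ) (c : ℂ) (z : X)
    (s : ℝ) : btF Tsg t p (c • z) s = c • btF Tsg t p z s := by
  unfold btF
  rw [← intervalIntegral.integral_smul]
  congr 1
  ext τ
  simp only [btg, map_smul]
  rw [smul_comm c (Complex.exp _), smul_comm c (Polynomial.eval (τ / t) p)]

theorem btF_comm (Tsg : C0Semigroup X) (t : ℝ) (ht : 0 < t) (p : Polynomial ℝ) (B : X →L[ℂ] X)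
    (hB : ∀ τ : ℝ, 0 ≤ τ → ∀ z, B (Tsg.T τ z) = Tsg.T τ (B z)) (z : X) (s : ℝ) :
    btF Tsg t p (B z) s = B (btF Tsg t p z s) := by
  unfold btF
  rw [← B.intervalIntegral_comp_comm (btF_int Tsg t ht p z s)]
  apply intervalIntegral.integral_congr
  intro τ hτ
  rw [uIcc_of_le ht.le] at hτ
  simp only [btg, map_smul]
  rw [← hB τ hτ.1, B.map_smul_of_tower]

theorem btF_ibp (Tsg : C0Semigroup X) (A : X →ₗ.[ℂ] X) (hgen : IsGenerator Tsg A)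
    (t : ℝ) (ht : 0 < t) (p : Polynomial ℝ) (h0 : p.eval 0 = 0) (h1 : p.eval 1 = 0)
    (z y : X) (hz : ∃ hx : z ∈ A.domain, A ⟨z, hx⟩ = y) (s : ℝ) :
    (Complex.I * s) • btF Tsg t p z s =
      ((t⁻¹ : ℝ) : ℂ) • btF Tsg t (Polynomial.derivative p) z s - btF Tsg t p y s := by
  have key : ∫ τ in (0 : ℝ)..t,
      ((-(Complex.I * s)) • (Complex.exp (-(Complex.I * s) * τ) • btg Tsg t p z τ)
      + (((t⁻¹ : ℝ) : ℂ) • (Complex.exp (-(Complex.I * s) * τ) •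
          btg Tsg t (Polynomial.derivative p) z τ)
      - Complex.exp (-(Complex.I * s) * τ) • btg Tsg t p y τ)) = 0 := by
    rw [intervalIntegral.integral_eq_sub_of_hasDeriv_right_of_le ht.le
      (f := fun τ : ℝ => Complex.exp (-(Complex.I * s) * τ) • btg Tsg t p z τ)]
    · simp [btg, h0, h1, div_self ht.ne']
    · exact (btF_cont Tsg t p z s).mono Icc_subset_Ici_self
    · intro τ hτ
      have d1 : HasDerivWithinAt (fun τ : ℝ => Complex.exp (-(Complex.I * s) * τ))
          (Complex.exp (-(Complex.I * s) * τ) * (-(Complex.I * s))) (Ioi τ) τ := by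
        have : HasDerivAt (fun τ : ℝ => -(Complex.I * s) * (τ : ℂ)) (-(Complex.I * s) * 1) τ :=
          (HasDerivAt.ofReal_comp (hasDerivAt_id τ)).const_mul _
        rw [mul_one] at this
        exact this.cexp.hasDerivWithinAt
      have d2 : HasDerivWithinAt (fun τ : ℝ => p.eval (τ / t))
          ((Polynomial.derivative p).eval (τ / t) * t⁻¹) (Ioi τ) τ := by
        have h := (p.hasDerivAt (τ / t)).comp τ ((hasDerivAt_id τ).div_const t)
        rw [one_div] at h
        exact h.hasDerivWithinAt
      have d3 := bt_hasDeriv Tsg A hgen z y hz τ hτ.1.le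
      have d := d1.smul (d2.smul d3)
      refine d.congr_deriv ?_
      simp only [btg, Complex.coe_smul, Pi.smul_apply']
      module
    · exact ((btF_int Tsg t ht p z s).smul _).add
        (((btF_int Tsg t ht _ z s).smul _).sub (btF_int Tsg t ht p y s))
  rw [intervalIntegral.integral_add, intervalIntegral.integral_sub,
    intervalIntegral.integral_smul, intervalIntegral.integral_smul] at key
  · change (-(Complex.I * s)) • btF Tsg t p z s + (((t⁻¹ : ℝ) : ℂ) •
      btF Tsg t (Polynomial.derivative p) z s - btF Tsg t p y s) = 0 at key
    rw [neg_smul, neg_add_eq_zero] at key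
    exact key
  · exact (btF_int Tsg t ht _ z s).smul _
  · exact btF_int Tsg t ht p y s
  · exact (btF_int Tsg t ht p z s).smul _
  · exact ((btF_int Tsg t ht _ z s).smul _).sub (btF_int Tsg t ht p y s)

theorem btF_step (Tsg : C0Semigroup X) (A : X →ₗ.[ℂ] X) (hgen : IsGenerator Tsg A)
    (t : ℝ) (ht : 0 < t) (p : Polynomial ℝ) (h0 : p.eval 0 = 0) (h1 : p.eval 1 = 0)
    (s : ℝ) (R : X →L[ℂ] X) (hR : IsResolvent A (Complex.I * s) R) (z : X) :
    btF Tsg t p z s = ((t⁻¹ : ℝ) : ℂ) • R (btF Tsg t (Polynomial.derivative p) z s) := by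
  have h := btF_ibp Tsg A hgen t ht p h0 h1 (R z) _ ⟨hR.mem_domain z, rfl⟩ s
  rw [btF_comm Tsg t ht (Polynomial.derivative p) R (bt_commute Tsg A hgen _ R hR)] at h
  have e : btF Tsg t p z s = (Complex.I * s) • btF Tsg t p (R z) s +
      btF Tsg t p (A ⟨R z, hR.mem_domain z⟩) s := by
    rw [← btF_smul, ← btF_add Tsg t ht, hR.eq_apply z]
  rw [e, h]
  abel

theorem btF_iter (Tsg : C0Semigroup X) (A : X →ₗ.[ℂ] X) (hgen : IsGenerator Tsg A)
    (t : ℝ) (ht : 0 < t) (s : ℝ) (R : X →L[ℂ] X) (hR : IsResolvent A (Complex.I * s) R)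
    (z : X) (k : ℕ) : ∀ p : Polynomial ℝ,
    (∀ j < k, (Polynomial.derivative^[j] p).eval 0 = 0 ∧
      (Polynomial.derivative^[j] p).eval 1 = 0) →
    btF Tsg t p z s =
      ((t⁻¹ : ℝ) : ℂ) ^ k • (R ^ k) (btF Tsg t (Polynomial.derivative^[k] p) z s) := by
  induction k with
  | zero => intro p _; simp
  | succ k ih =>
    intro p hp
    rw [btF_step Tsg A hgen t ht p (hp 0 (by omega)).1 (hp 0 (by omega)).2 s R hR,
      ih (Polynomial.derivative p) (fun j hj => hp (j + 1) (by omega))]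
    rw [map_smul, smul_smul, ← pow_succ', pow_succ' R, Function.iterate_succ_apply]
    rfl

/-- high frequency estimate -/
theorem btF_high (Tsg : C0Semigroup X) (A : X →ₗ.[ℂ] X) (hgen : IsGenerator Tsg A)
    (t : ℝ) (ht : 0 < t) (p : Polynomial ℝ) (h0 : p.eval 0 = 0) (h1 : p.eval 1 = 0)
    (s : ℝ) (R : X →L[ℂ] X) (hR : IsResolvent A 0 R) (z : X) :
    |s| * ‖btF Tsg t p (R z) s‖ ≤
      t⁻¹ * ‖R‖ * ‖btF Tsg t (Polynomial.derivative p) z s‖ + ‖btF Tsg t p z s‖ := by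
  have e : A ⟨R z, hR.mem_domain z⟩ = z := by simpa using hR.eq_apply z
  have h := btF_ibp Tsg A hgen t ht p h0 h1 (R z) z ⟨hR.mem_domain z, e⟩ s
  rw [btF_comm Tsg t ht (Polynomial.derivative p) R (bt_commute Tsg A hgen _ R hR)] at h
  have h2 := congrArg norm h
  rw [norm_smul, norm_mul, Complex.norm_I, one_mul, Complex.norm_real, Real.norm_eq_abs] at h2
  rw [h2]
  refine (norm_sub_le _ _).trans ?_
  gcongr
  rw [norm_smul, Complex.norm_real, Real.norm_eq_abs, abs_of_pos (inv_pos.2 ht), mul_assoc]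
  gcongr
  exact R.le_opNorm _

/-- The weighted orbit on the whole line. -/
noncomputable def btG (Tsg : C0Semigroup X) (t : ℝ) (p : Polynomial ℝ) (z : X) : ℝ → X :=
  (Ioc 0 t).indicator (btg Tsg t p z)

theorem btG_bound (Tsg : C0Semigroup X) (K : ℝ) (hK : ∀ t : ℝ, 0 ≤ t → ‖Tsg.T t‖ ≤ K)
    (t : ℝ) (ht : 0 < t) (p : Polynomial ℝ) (B : ℝ) (hB : ∀ u ∈ Icc (0 : ℝ) 1, |p.eval u| ≤ B)
    (z : X) (τ : ℝ) (hτ : τ ∈ Ioc 0 t) : ‖btg Tsg t p z τ‖ ≤ B * (K * ‖z‖) := by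
  have hu : τ / t ∈ Icc (0 : ℝ) 1 :=
    ⟨div_nonneg hτ.1.le ht.le, (div_le_one ht).2 hτ.2⟩
  have hB0 : 0 ≤ B := (abs_nonneg _).trans (hB _ hu)
  unfold btg
  rw [norm_smul, Real.norm_eq_abs]
  exact mul_le_mul (hB _ hu) ((Tsg.T τ).le_of_opNorm_le (hK τ hτ.1.le) z) (norm_nonneg _) hB0

theorem btG_meas (Tsg : C0Semigroup X) (t : ℝ) (p : Polynomial ℝ) (z : X) :
    AEStronglyMeasurable (btg Tsg t p z) (volume.restrict (Ioc 0 t)) :=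
  ((btg_cont Tsg t p z).mono (fun _ hx => hx.1.le)).aestronglyMeasurable measurableSet_Ioc

theorem btG_memLp (Tsg : C0Semigroup X) (K : ℝ) (hK : ∀ t : ℝ, 0 ≤ t → ‖Tsg.T t‖ ≤ K)
    (t : ℝ) (ht : 0 < t) (p : Polynomial ℝ) (B : ℝ) (hB : ∀ u ∈ Icc (0 : ℝ) 1, |p.eval u| ≤ B)
    (z : X) (q : ENNReal) : MemLp (btG Tsg t p z) q := by
  unfold btG
  rw [memLp_indicator_iff_restrict measurableSet_Ioc]
  apply MemLp.of_bound (btG_meas Tsg t p z) (B * (K * ‖z‖))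
  exact ae_restrict_of_forall_mem measurableSet_Ioc (btG_bound Tsg K hK t ht p B hB z)

theorem btG_fourier (Tsg : C0Semigroup X) (t : ℝ) (ht : 0 < t) (p : Polynomial ℝ)
    (z : X) (ξ : ℝ) :
    FourierTransform.fourier (btG Tsg t p z) ξ = btF Tsg t p z (2 * Real.pi * ξ) := by
  rw [Real.fourier_real_eq_integral_exp_smul]
  unfold btF btG
  rw [intervalIntegral.integral_of_le ht.le, ← integral_indicator measurableSet_Ioc]
  congr 1
  ext τ
  by_cases hx : τ ∈ Ioc 0 t
  · simp only [hx, indicator_of_mem]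
    congr 2
    push_cast
    ring
  · simp [hx]

theorem btG_norm_sq (Tsg : C0Semigroup X) (t : ℝ) (p : Polynomial ℝ) (z : X) :
    ∫ x, ‖btG Tsg t p z x‖ ^ 2 = ∫ x in Ioc 0 t, ‖btg Tsg t p z x‖ ^ 2 := by
  rw [← integral_indicator measurableSet_Ioc]
  congr 1
  ext x
  unfold btG
  by_cases hx : x ∈ Ioc 0 t <;> simp [hx]

theorem btG_upper (Tsg : C0Semigroup X) (K : ℝ) (hK : ∀ t : ℝ, 0 ≤ t → ‖Tsg.T t‖ ≤ K)
    (t : ℝ) (ht : 0 < t) (p : Polynomial ℝ) (B : ℝ) (hB : ∀ u ∈ Icc (0 : ℝ) 1, |p.eval u| ≤ B)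
    (z : X) : ∫ x, ‖btG Tsg t p z x‖ ^ 2 ≤ t * (B * (K * ‖z‖)) ^ 2 := by
  have hi : Integrable (fun x => ‖btG Tsg t p z x‖ ^ 2) :=
    (btG_memLp Tsg K hK t ht p B hB z 2).integrable_norm_pow (by norm_num)
  rw [btG_norm_sq]
  have h := setIntegral_mono_on (μ := volume) (s := Ioc 0 t)
    (f := fun x => ‖btg Tsg t p z x‖ ^ 2)
    (g := fun _ => (B * (K * ‖z‖)) ^ 2) ?_ (integrableOn_const (by simp)) measurableSet_Ioc ?_
  · refine h.trans ?_
    simp [ht.le]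
  · refine hi.integrableOn.congr_fun (s := Ioc 0 t) ?_ measurableSet_Ioc
    intro x hx
    simp [btG, hx]
  · intro x hx
    gcongr
    exact btG_bound Tsg K hK t ht p B hB z x hx

theorem btG_lower (Tsg : C0Semigroup X) (K : ℝ) (hK : ∀ t : ℝ, 0 ≤ t → ‖Tsg.T t‖ ≤ K)
    (t : ℝ) (ht : 0 < t) (p : Polynomial ℝ) (B : ℝ) (hB : ∀ u ∈ Icc (0 : ℝ) 1, |p.eval u| ≤ B)
    (z : X) : t * (∫ u in (0 : ℝ)..1, (p.eval u) ^ 2) * ‖Tsg.T t z‖ ^ 2 ≤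
      K ^ 2 * ∫ x, ‖btG Tsg t p z x‖ ^ 2 := by
  have hi : Integrable (fun x => ‖btG Tsg t p z x‖ ^ 2) :=
    (btG_memLp Tsg K hK t ht p B hB z 2).integrable_norm_pow (by norm_num)
  have e : t * (∫ u in (0 : ℝ)..1, (p.eval u) ^ 2) = ∫ x in Ioc 0 t, (p.eval (x / t)) ^ 2 := by
    rw [← intervalIntegral.integral_of_le ht.le,
      intervalIntegral.integral_comp_div (fun u => (p.eval u) ^ 2) ht.ne']
    simp [div_self ht.ne']
  rw [btG_norm_sq, e, ← integral_mul_const, ← integral_const_mul]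
  apply setIntegral_mono_on _ _ measurableSet_Ioc
  · intro x hx
    have h1 : ‖Tsg.T t z‖ ≤ K * ‖Tsg.T x z‖ := by
      have := Tsg.map_add (t - x) x (by linarith [hx.2]) hx.1.le
      rw [sub_add_cancel] at this
      rw [this]
      exact (Tsg.T (t - x)).le_of_opNorm_le (hK _ (by linarith [hx.2])) _
    have h2 : ‖Tsg.T t z‖ ^ 2 ≤ (K * ‖Tsg.T x z‖) ^ 2 := by gcongr
    unfold btg
    rw [norm_smul, mul_pow, Real.norm_eq_abs, sq_abs]
    nlinarith [mul_le_mul_of_nonneg_left h2 (sq_nonneg (p.eval (x / t)))]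
  · apply Integrable.mul_const
    have : Continuous fun τ : ℝ => (p.eval (τ / t)) ^ 2 :=
      (p.continuous.comp (continuous_id.div_const t)).pow 2
    exact (this.integrableOn_Icc).mono_set Ioc_subset_Icc_self
  · apply Integrable.const_mul
    refine hi.integrableOn.congr_fun (s := Ioc 0 t) ?_ measurableSet_Ioc
    intro x hx
    simp [btG, hx]

end BTSemigroup

section BTMain

variable {X : Type*} [NormedAddCommGroup X] [InnerProductSpace ℂ X] [CompleteSpace X]

set_option linter.unusedSectionVars false

theorem bt_res_id (A : X →ₗ.[ℂ] X) (Res : ℝ → X →L[ℂ] X)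
    (hRes : ∀ s : ℝ, IsResolvent A (Complex.I * (s : ℂ)) (Res s)) (a b : ℝ) :
    Res a - Res b = (Complex.I * ((b - a : ℝ) : ℂ)) • (Res a * Res b) := by
  ext z
  have h1 := (hRes b).eq_apply z
  have h2 := (hRes a).left_inv ⟨Res b z, (hRes b).mem_domain z⟩
  simp only at h2
  have h3 : (Complex.I * (a : ℂ)) • Res b z + A ⟨Res b z, (hRes b).mem_domain z⟩ =
      z - (Complex.I * ((b - a : ℝ) : ℂ)) • Res b z := by
    rw [← eq_sub_iff_add_eq'] at h1
    rw [h1]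
    push_cast
    module
  rw [h3, map_sub, map_smul] at h2
  change Res a z - Res b z = (Complex.I * ((b - a : ℝ) : ℂ)) • Res a (Res b z)
  rw [sub_eq_iff_eq_add] at h2 ⊢
  rw [h2, add_comm]

theorem bt_res_loc (A : X →ₗ.[ℂ] X) (Res : ℝ → X →L[ℂ] X)
    (hRes : ∀ s : ℝ, IsResolvent A (Complex.I * (s : ℂ)) (Res s)) (S : ℝ) :
    ∃ C : ℝ, ∀ s : ℝ, |s| ≤ S → ‖Res s‖ ≤ C := by
  have : ∃ C : ℝ, ∀ s ∈ Icc (-S) S, ‖Res s‖ ≤ C := by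
    refine isCompact_Icc.induction_on (p := fun E => ∃ C : ℝ, ∀ s ∈ E, ‖Res s‖ ≤ C)
      ⟨0, by simp⟩ ?_ ?_ ?_
    · rintro s t hst ⟨C, hC⟩
      exact ⟨C, fun x hx => hC x (hst hx)⟩
    · rintro s t ⟨C, hC⟩ ⟨D, hD⟩
      refine ⟨max C D, fun x hx => ?_⟩
      rcases hx with hx | hx
      · exact (hC x hx).trans (le_max_left _ _)
      · exact (hD x hx).trans (le_max_right _ _)
    · intro a _
      have hpos : 0 < (2 * (‖Res a‖ + 1))⁻¹ := by positivity
      refine ⟨Metric.ball a (2 * (‖Res a‖ + 1))⁻¹,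
        mem_nhdsWithin_of_mem_nhds (Metric.ball_mem_nhds _ hpos), 2 * ‖Res a‖, ?_⟩
      intro s hs
      rw [Metric.mem_ball, Real.dist_eq] at hs
      have h := bt_res_id A Res hRes s a
      have h1 : ‖Res s‖ ≤ ‖Res a‖ + |s - a| * (‖Res s‖ * ‖Res a‖) := by
        have e : Res s = Res a + (Complex.I * ((a - s : ℝ) : ℂ)) • (Res s * Res a) := by
          rw [← h]; abel
        calc ‖Res s‖ = ‖Res a + (Complex.I * ((a - s : ℝ) : ℂ)) • (Res s * Res a)‖ := by
              rw [← e]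
          _ ≤ ‖Res a‖ + ‖(Complex.I * ((a - s : ℝ) : ℂ)) • (Res s * Res a)‖ := norm_add_le _ _
          _ ≤ _ := by
              rw [norm_smul, norm_mul, Complex.norm_I, one_mul, Complex.norm_real,
                Real.norm_eq_abs, abs_sub_comm]
              gcongr
              exact norm_mul_le _ _
      have h2 : |s - a| * ‖Res a‖ ≤ 1 / 2 := by
        calc |s - a| * ‖Res a‖ ≤ (2 * (‖Res a‖ + 1))⁻¹ * (‖Res a‖ + 1) := by
              gcongr; linarith
          _ = 1 / 2 := by field_simp
      nlinarith [norm_nonneg (Res s), norm_nonneg (Res a)]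
  obtain ⟨C, hC⟩ := this
  exact ⟨C, fun s hs => hC s (abs_le.1 hs)⟩

theorem bt_res_pow (A : X →ₗ.[ℂ] X) (Res : ℝ → X →L[ℂ] X)
    (hRes : ∀ s : ℝ, IsResolvent A (Complex.I * (s : ℂ)) (Res s)) (s : ℝ) (k : ℕ) :
    |s| * ‖Res s ^ (k + 1) * Res 0‖ ≤ (1 + ‖Res 0‖) * (1 + ‖Res s‖ ^ (k + 1)) := by
  have h := bt_res_id A Res hRes s 0
  have h1 : |s| * ‖Res s * Res 0‖ ≤ ‖Res s‖ + ‖Res 0‖ := by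
    have h2 := congrArg norm h
    rw [norm_smul, norm_mul, Complex.norm_I, one_mul, Complex.norm_real,
                Real.norm_eq_abs, zero_sub, abs_neg] at h2
    rw [← h2]
    exact norm_sub_le _ _
  have hk : ‖Res s ^ k * (Res s * Res 0)‖ ≤ ‖Res s‖ ^ k * ‖Res s * Res 0‖ := by
    rcases Nat.eq_zero_or_pos k with rfl | hk
    · simp
    · exact (norm_mul_le _ _).trans
        (mul_le_mul_of_nonneg_right (norm_pow_le' _ hk) (norm_nonneg _))
  set r := ‖Res s‖ with hr
  have hr0 : 0 ≤ r := norm_nonneg _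
  have hrk : r ^ k ≤ 1 + r ^ (k + 1) := by
    rcases le_total r 1 with h | h
    · have := pow_le_one₀ (n := k) hr0 h
      have := pow_nonneg hr0 (k + 1)
      linarith
    · have : r ^ k ≤ r ^ (k + 1) := pow_le_pow_right₀ h (Nat.le_succ k)
      linarith
  calc |s| * ‖Res s ^ (k + 1) * Res 0‖ = |s| * ‖Res s ^ k * (Res s * Res 0)‖ := by
        rw [pow_succ, mul_assoc]
    _ ≤ |s| * (r ^ k * ‖Res s * Res 0‖) := by gcongr
    _ = r ^ k * (|s| * ‖Res s * Res 0‖) := by ring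
    _ ≤ r ^ k * (r + ‖Res 0‖) := by gcongr
    _ = r ^ (k + 1) + ‖Res 0‖ * r ^ k := by ring
    _ ≤ (1 + r ^ (k + 1)) + ‖Res 0‖ * (1 + r ^ (k + 1)) := by
        gcongr
        linarith
    _ = _ := by ring

theorem bt_potter (α : ℝ) (hα : 0 < α) (l : ℝ → ℝ) (hsv : SlowlyVarying l) (hmono : Monotone l)
    (S0 : ℝ) : ∃ S : ℝ, S0 ≤ S ∧ 1 ≤ S ∧ 0 < l S ∧ ∃ D : ℝ, 0 < D ∧
      ∀ ξ s : ℝ, S ≤ ξ → ξ ≤ s → ξ ^ α / l ξ * (s / ξ) ^ (α / 2) ≤ D * (s ^ α / l s) := by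
  obtain ⟨_, hpos, hlim⟩ := hsv
  have hb : (1 : ℝ) < 2 ^ (α / 2) := Real.one_lt_rpow (by norm_num) (by positivity)
  have h2 := (hlim 2 (by norm_num)).eventually (gt_mem_nhds hb)
  obtain ⟨S, hS⟩ := eventually_atTop.1
    (hpos.and (h2.and ((eventually_ge_atTop S0).and (eventually_ge_atTop 1))))
  refine ⟨S, (hS S le_rfl).2.2.1, (hS S le_rfl).2.2.2, (hS S le_rfl).1, 2 ^ (α / 2),
    by positivity, ?_⟩
  intro ξ s hξ hs
  have hξ1 : 1 ≤ ξ := (hS ξ hξ).2.2.2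
  have hdouble : ∀ n : ℕ, l (2 ^ n * ξ) ≤ ((2 : ℝ) ^ (α / 2)) ^ n * l ξ := by
    intro n
    induction n with
    | zero => simp
    | succ n ih =>
      have hge : S ≤ 2 ^ n * ξ := by
        have : (1 : ℝ) ≤ 2 ^ n := one_le_pow₀ (by norm_num)
        nlinarith
      have h3 := (hS _ hge).2.1
      have h4 := (hS _ hge).1
      rw [div_lt_iff₀ h4] at h3
      calc l (2 ^ (n + 1) * ξ) = l (2 * (2 ^ n * ξ)) := by ring_nf
        _ ≤ 2 ^ (α / 2) * l (2 ^ n * ξ) := h3.le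
        _ ≤ 2 ^ (α / 2) * (((2 : ℝ) ^ (α / 2)) ^ n * l ξ) := by gcongr
        _ = _ := by ring
  have hξ0 : 0 < ξ := by linarith
  have hs0 : 0 < s := by linarith
  have hlξ := (hS ξ hξ).1
  have hls := (hS s (hξ.trans hs)).1
  obtain ⟨n, hn1, hn2⟩ := exists_nat_pow_near ((one_le_div hξ0).2 hs) (by norm_num : (1 : ℝ) < 2)
  have hl : l s ≤ 2 ^ (α / 2) * (s / ξ) ^ (α / 2) * l ξ := by
    have h5 : s ≤ 2 ^ (n + 1) * ξ := ((div_lt_iff₀ hξ0).1 hn2).le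
    calc l s ≤ l (2 ^ (n + 1) * ξ) := hmono h5
      _ ≤ ((2 : ℝ) ^ (α / 2)) ^ (n + 1) * l ξ := hdouble _
      _ = 2 ^ (α / 2) * ((2 : ℝ) ^ n) ^ (α / 2) * l ξ := by
          rw [pow_succ, ← Real.rpow_natCast ((2 : ℝ) ^ (α / 2)) n, ← Real.rpow_mul (by norm_num),
            mul_comm (α / 2), Real.rpow_mul (by norm_num), Real.rpow_natCast]
          ring
      _ ≤ _ := by gcongr
  have hsplit : s ^ α = ξ ^ α * ((s / ξ) ^ (α / 2) * (s / ξ) ^ (α / 2)) := by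
    rw [← Real.rpow_add (by positivity), add_halves, ← Real.mul_rpow hξ0.le (by positivity),
      mul_div_cancel₀ _ hξ0.ne']
  rw [hsplit, div_mul_eq_mul_div, mul_div_assoc', div_le_div_iff₀ hlξ hls]
  have hq : 0 ≤ ξ ^ α * (s / ξ) ^ (α / 2) := by positivity
  calc ξ ^ α * (s / ξ) ^ (α / 2) * l s
      ≤ ξ ^ α * (s / ξ) ^ (α / 2) * (2 ^ (α / 2) * (s / ξ) ^ (α / 2) * l ξ) := by gcongr
    _ = _ := by ring

theorem bt_ivt (α : ℝ) (hα : 0 < α) (l : ℝ → ℝ) (hmono : Monotone l)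
    (S D : ℝ) (hS1 : 1 ≤ S) (hl : 0 < l S) (hD : 0 < D)
    (hp : ∀ ξ s : ℝ, S ≤ ξ → ξ ≤ s → ξ ^ α / l ξ * (s / ξ) ^ (α / 2) ≤ D * (s ^ α / l s))
    (B t : ℝ) (hB : S ≤ B) (ht : B ^ α / l B ≤ t) : ∃ s : ℝ, B ≤ s ∧ s ^ α / l s = t := by
  have hlp : ∀ s, S ≤ s → 0 < l s := fun s hs => hl.trans_le (hmono hs)
  have htend : Tendsto (fun s : ℝ => S ^ α / l S * (s / S) ^ (α / 2)) atTop atTop := by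
    apply Tendsto.const_mul_atTop (by positivity)
    exact (tendsto_rpow_atTop (by positivity)).comp (tendsto_id.atTop_div_const (by positivity))
  obtain ⟨U, hU⟩ := eventually_atTop.1 (htend.eventually (eventually_gt_atTop (D * t)))
  set E : Set ℝ := {s | B ≤ s ∧ s ^ α ≤ t * l s} with hE
  have hBE : B ∈ E := ⟨le_rfl, (div_le_iff₀ (hlp B hB)).1 ht⟩
  have hbd : BddAbove E := by
    refine ⟨U, fun s hs => ?_⟩
    by_contra hcon
    push Not at hcon
    have hSs : S ≤ s := hB.trans hs.1
    have h1 := hU s hcon.le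
    have h2 := hp S s le_rfl hSs
    have h3 : s ^ α / l s ≤ t := (div_le_iff₀ (hlp s hSs)).2 hs.2
    nlinarith
  set s1 := sSup E with hs1
  have hBs : B ≤ s1 := le_csSup hbd hBE
  have hSs : S ≤ s1 := hB.trans hBs
  have ht0 : 0 < t := by
    refine lt_of_lt_of_le ?_ ht
    have := hlp B hB
    have : 0 < B := by linarith
    positivity
  refine ⟨s1, hBs, ?_⟩
  rw [div_eq_iff (hlp s1 hSs).ne']
  have hcont : ContinuousAt (fun s : ℝ => s ^ α) s1 :=
    Real.continuousAt_rpow_const _ _ (Or.inr hα.le)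
  apply le_antisymm
  · have hmem : s1 ∈ closure E := csSup_mem_closure ⟨B, hBE⟩ hbd
    obtain ⟨u, hu, hlim⟩ := mem_closure_iff_seq_limit.1 hmem
    refine le_of_tendsto (hcont.tendsto.comp hlim) (Eventually.of_forall fun n => ?_)
    refine (hu n).2.trans ?_
    exact mul_le_mul_of_nonneg_left (hmono (le_csSup hbd (hu n))) ht0.le
  · have hlim : Tendsto (fun s : ℝ => s ^ α) (nhdsWithin s1 (Ioi s1)) (nhds (s1 ^ α)) :=
      hcont.tendsto.mono_left nhdsWithin_le_nhds
    refine ge_of_tendsto hlim ?_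
    filter_upwards [self_mem_nhdsWithin] with s hs
    have hs' : s1 < s := hs
    have hn : ¬ s ∈ E := fun h => absurd (le_csSup hbd h) (not_le.2 hs')
    have : t * l s < s ^ α := by
      by_contra hcon
      exact hn ⟨hBs.trans hs'.le, not_lt.1 hcon⟩
    exact (mul_le_mul_of_nonneg_left (hmono hs'.le) ht0.le).trans this.le

end BTMain

section BTFinal

variable {X : Type*} [NormedAddCommGroup X] [InnerProductSpace ℂ X] [CompleteSpace X]

set_option linter.unusedSectionVars false

/-- uniform low-frequency bound -/
theorem bt_low (A : X →ₗ.[ℂ] X) (Res : ℝ → X →L[ℂ] X)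
    (hRes : ∀ s : ℝ, IsResolvent A (Complex.I * (s : ℂ)) (Res s))
    (α : ℝ) (hα : 0 < α) (l : ℝ → ℝ) (hmono : Monotone l)
    (C : ℝ) (hC : 0 < C) (S D : ℝ) (hS1 : 1 ≤ S) (hl : 0 < l S) (hD : 0 < D)
    (hb : ∀ s : ℝ, S ≤ |s| → ‖Res s‖ ≤ C * (|s| ^ α / l |s|))
    (hp : ∀ ξ s : ℝ, S ≤ ξ → ξ ≤ s → ξ ^ α / l ξ * (s / ξ) ^ (α / 2) ≤ D * (s ^ α / l s)) :
    ∃ k : ℕ, ∃ C1 : ℝ, 0 < C1 ∧ ∀ σ : ℝ, S ≤ σ → ∀ s : ℝ, |s| ≤ σ →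
      ‖Res s ^ (k + 1) * Res 0‖ ≤ C1 * ((σ ^ α / l σ) ^ (k + 1) / σ) := by
  have hlp : ∀ s, S ≤ s → 0 < l s := fun s hs => hl.trans_le (hmono hs)
  obtain ⟨k, hk⟩ := exists_nat_ge (2 / α)
  have hMpos : ∀ s, S ≤ s → 0 < s ^ α / l s := fun s hs => by
    have := hlp s hs
    have : 0 < s := by linarith
    positivity
  have hgrow : ∀ ξ s : ℝ, S ≤ ξ → ξ ≤ s →
      (ξ ^ α / l ξ) ^ (k + 1) / ξ ≤ D ^ (k + 1) * ((s ^ α / l s) ^ (k + 1) / s) := by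
    intro ξ s hξ hs
    have hξ0 : 0 < ξ := by linarith
    have hs0 : 0 < s := by linarith
    have h1 : s / ξ ≤ ((s / ξ) ^ (α / 2)) ^ (k + 1) := by
      rw [← Real.rpow_natCast, ← Real.rpow_mul (by positivity)]
      have : (1 : ℝ) ≤ α / 2 * ((k + 1 : ℕ) : ℝ) := by
        rw [div_le_iff₀ hα] at hk
        push_cast
        nlinarith
      calc s / ξ = (s / ξ) ^ (1 : ℝ) := (Real.rpow_one _).symm
        _ ≤ _ := Real.rpow_le_rpow_of_exponent_le ((one_le_div hξ0).2 hs) this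
    have hM := hMpos ξ hξ
    have h2 : (ξ ^ α / l ξ) ^ (k + 1) * (s / ξ) ≤ D ^ (k + 1) * (s ^ α / l s) ^ (k + 1) := by
      calc (ξ ^ α / l ξ) ^ (k + 1) * (s / ξ)
          ≤ (ξ ^ α / l ξ) ^ (k + 1) * ((s / ξ) ^ (α / 2)) ^ (k + 1) := by gcongr
        _ = (ξ ^ α / l ξ * (s / ξ) ^ (α / 2)) ^ (k + 1) := by rw [mul_pow]
        _ ≤ (D * (s ^ α / l s)) ^ (k + 1) := by
            exact pow_le_pow_left₀ (mul_nonneg hM.le (by positivity)) (hp ξ s hξ hs) _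
        _ = _ := by rw [mul_pow]
    rw [mul_div_assoc', le_div_iff₀ hs0]
    calc _ = (ξ ^ α / l ξ) ^ (k + 1) * (s / ξ) := by ring
      _ ≤ _ := h2
  obtain ⟨C0, hC0⟩ := bt_res_loc A Res hRes S
  set e := (S ^ α / l S) ^ (k + 1) / S / D ^ (k + 1) with he
  have he0 : 0 < e := by
    have := hMpos S le_rfl
    have : 0 < S := by linarith
    positivity
  have he1 : ∀ σ, S ≤ σ → e ≤ (σ ^ α / l σ) ^ (k + 1) / σ := by
    intro σ hσ
    rw [he, div_le_iff₀ (by positivity), mul_comm]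
    exact hgrow S σ le_rfl hσ
  have hC00 : 0 ≤ C0 := (norm_nonneg _).trans (hC0 0 (by rw [abs_zero]; linarith))
  set c0 := ‖Res 0‖ with hc0
  have hc00 : 0 ≤ c0 := norm_nonneg _
  refine ⟨k, C0 ^ (k + 1) * c0 / e + (1 + c0) * (1 / e + C ^ (k + 1) * D ^ (k + 1)),
    by positivity, ?_⟩
  intro σ hσ s hs
  set m := (σ ^ α / l σ) ^ (k + 1) / σ with hm
  have hem : e ≤ m := he1 σ hσ
  have hm0 : 0 < m := he0.trans_le hem
  have hme : 1 ≤ m / e := (one_le_div he0).2 hem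
  rcases le_total |s| S with h | h
  · have h1 : ‖Res s ^ (k + 1) * Res 0‖ ≤ C0 ^ (k + 1) * c0 := by
      refine (norm_mul_le _ _).trans ?_
      gcongr
      exact (norm_pow_le' _ (Nat.succ_pos k)).trans (by gcongr; exact hC0 s h)
    calc _ ≤ C0 ^ (k + 1) * c0 := h1
      _ ≤ C0 ^ (k + 1) * c0 * (m / e) := le_mul_of_one_le_right (by positivity) hme
      _ = C0 ^ (k + 1) * c0 / e * m := by ring
      _ ≤ _ := by
        gcongr
        have : 0 ≤ (1 + c0) * (1 / e + C ^ (k + 1) * D ^ (k + 1)) := by positivity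
        linarith
  · have hs0 : 0 < |s| := by linarith
    have h1 := bt_res_pow A Res hRes s k
    have h2 : ‖Res s‖ ^ (k + 1) ≤ C ^ (k + 1) * (|s| ^ α / l |s|) ^ (k + 1) := by
      rw [← mul_pow]
      gcongr
      exact hb s h
    have h3 := hgrow |s| σ h hs
    have h4 : ‖Res s ^ (k + 1) * Res 0‖ ≤ (1 + c0) * (1 + ‖Res s‖ ^ (k + 1)) / |s| := by
      rw [le_div_iff₀ hs0]
      linarith
    calc _ ≤ (1 + c0) * (1 + ‖Res s‖ ^ (k + 1)) / |s| := h4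
      _ ≤ (1 + c0) * (1 + C ^ (k + 1) * (|s| ^ α / l |s|) ^ (k + 1)) / |s| := by gcongr
      _ = (1 + c0) * (1 / |s| + C ^ (k + 1) * ((|s| ^ α / l |s|) ^ (k + 1) / |s|)) := by ring
      _ ≤ (1 + c0) * (m / e + C ^ (k + 1) * (D ^ (k + 1) * m)) := by
          have h5 : 1 / |s| ≤ m / e := le_trans ((div_le_one hs0).2 (by linarith)) hme
          exact mul_le_mul_of_nonneg_left
            (add_le_add h5 (mul_le_mul_of_nonneg_left h3 (by positivity))) (by positivity)
      _ = (1 + c0) * (1 / e + C ^ (k + 1) * D ^ (k + 1)) * m := by ring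
      _ ≤ _ := by
        gcongr
        have : 0 ≤ C0 ^ (k + 1) * c0 / e := by positivity
        linarith

theorem bt_poly (k : ℕ) : ∃ p : Polynomial ℝ,
    (∀ j < k + 1, (Polynomial.derivative^[j] p).eval 0 = 0 ∧
      (Polynomial.derivative^[j] p).eval 1 = 0) ∧
    0 < ∫ u in (0 : ℝ)..1, (p.eval u) ^ 2 := by
  set q : Polynomial ℝ := Polynomial.X * (1 - Polynomial.X) with hq
  refine ⟨q ^ (k + 1), ?_, ?_⟩
  · intro j hj
    have h : q ^ (k + 1 - j) ∣ Polynomial.derivative^[j] (q ^ (k + 1)) :=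
      Polynomial.pow_sub_dvd_iterate_derivative_of_pow_dvd j dvd_rfl
    have h' : q ∣ Polynomial.derivative^[j] (q ^ (k + 1)) :=
      (dvd_pow_self q (by omega)).trans h
    obtain ⟨r, hr⟩ := h'
    rw [hr]
    simp [hq]
  · apply intervalIntegral.intervalIntegral_pos_of_pos_on
    · exact ((Polynomial.continuous _).pow 2).intervalIntegrable _ _
    · intro x hx
      have h1 : 0 < x := hx.1
      have h2 : 0 < 1 - x := by linarith [hx.2]
      simp only [hq, Polynomial.eval_pow, Polynomial.eval_mul, Polynomial.eval_X,
        Polynomial.eval_sub, Polynomial.eval_one]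
      positivity
    · norm_num

theorem bt_poly_bdd (p : Polynomial ℝ) : ∃ B : ℝ, 0 ≤ B ∧ ∀ u ∈ Icc (0 : ℝ) 1, |p.eval u| ≤ B := by
  obtain ⟨B, hB⟩ := isCompact_Icc.exists_bound_of_continuousOn (s := Icc (0 : ℝ) 1)
    (p.continuous.continuousOn)
  exact ⟨B, (norm_nonneg _).trans (hB 0 (by simp)), hB⟩

theorem bt_main (Tsg : C0Semigroup X) (K : ℝ) (hK : ∀ t : ℝ, 0 ≤ t → ‖Tsg.T t‖ ≤ K)
    (A : X →ₗ.[ℂ] X) (hgen : IsGenerator Tsg A)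
    (Res : ℝ → X →L[ℂ] X)
    (hRes : ∀ s : ℝ, IsResolvent A (Complex.I * (s : ℂ)) (Res s))
    (k : ℕ) (C1 : ℝ) (hC1 : 0 < C1) :
    ∃ C2 : ℝ, 0 ≤ C2 ∧ ∀ t σ : ℝ, 1 ≤ t → 0 < σ →
      (∀ s : ℝ, |s| ≤ σ → ‖Res s ^ (k + 1) * Res 0‖ ≤ C1 * (t ^ (k + 1) / σ)) →
      ‖Tsg.T t ∘L Res 0‖ ≤ C2 / σ := by
  obtain ⟨p, hp0, hI⟩ := bt_poly k
  obtain ⟨B0, hB00, hB0⟩ := bt_poly_bdd p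
  obtain ⟨B1, hB10, hB1⟩ := bt_poly_bdd (Polynomial.derivative p)
  obtain ⟨B2, hB20, hB2⟩ := bt_poly_bdd (Polynomial.derivative^[k + 1] p)
  set I := ∫ u in (0 : ℝ)..1, (p.eval u) ^ 2 with hIdef
  set B := B0 + B1 + B2 with hB
  set c0 := ‖Res 0‖ with hc0
  have hc00 : 0 ≤ c0 := norm_nonneg _
  have hK0 : 0 ≤ K := (norm_nonneg _).trans (hK 0 le_rfl)
  set D := C1 + c0 + 1 with hD
  have hR0 : IsResolvent A 0 (Res 0) := by simpa using hRes 0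
  refine ⟨3 * K ^ 2 * D * B / Real.sqrt I, by positivity, ?_⟩
  intro t σ ht hσ hlow
  have ht0 : 0 < t := by linarith
  apply ContinuousLinearMap.opNorm_le_bound _ (by positivity)
  intro z
  change ‖Tsg.T t (Res 0 z)‖ ≤ _
  have hpt : ∀ s : ℝ, ‖btF Tsg t p (Res 0 z) s‖ ≤ D / σ *
      (‖btF Tsg t (Polynomial.derivative^[k + 1] p) z s‖ +
        ‖btF Tsg t (Polynomial.derivative p) z s‖ + ‖btF Tsg t p z s‖) := by
    intro s
    set n2 := ‖btF Tsg t (Polynomial.derivative^[k + 1] p) z s‖ with hn2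
    set n1 := ‖btF Tsg t (Polynomial.derivative p) z s‖ with hn1
    set n0 := ‖btF Tsg t p z s‖ with hn0
    have p2 : 0 ≤ n2 := norm_nonneg _
    have p1 : 0 ≤ n1 := norm_nonneg _
    have p0 : 0 ≤ n0 := norm_nonneg _
    rcases le_total |s| σ with h | h
    · rw [btF_iter Tsg A hgen t ht0 s (Res s) (hRes s) _ (k + 1) p hp0,
        btF_comm Tsg t ht0 _ (Res 0) (bt_commute Tsg A hgen _ _ hR0), norm_smul, norm_pow,
        Complex.norm_real, Real.norm_eq_abs, abs_of_pos (inv_pos.2 ht0)]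
      have h1 := (Res s ^ (k + 1) * Res 0).le_of_opNorm_le (hlow s h)
        (btF Tsg t (Polynomial.derivative^[k + 1] p) z s)
      change ‖(Res s ^ (k + 1)) (Res 0 _)‖ ≤ _ * n2 at h1
      calc _ ≤ t⁻¹ ^ (k + 1) * (C1 * (t ^ (k + 1) / σ) * n2) := by gcongr
        _ = C1 / σ * n2 := by rw [inv_pow]; field_simp
        _ ≤ D / σ * (n2 + n1 + n0) := by
            gcongr
            · rw [hD]; linarith
            · linarith
    · have h1 := btF_high Tsg A hgen t ht0 p (hp0 0 (by omega)).1 (hp0 0 (by omega)).2 s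
        (Res 0) hR0 z
      rw [← hn1, ← hn0, ← hc0] at h1
      rw [div_mul_eq_mul_div, le_div_iff₀ hσ]
      have ht1 : t⁻¹ ≤ 1 := inv_le_one_of_one_le₀ ht
      calc _ ≤ |s| * ‖btF Tsg t p (Res 0 z) s‖ := by rw [mul_comm]; gcongr
        _ ≤ t⁻¹ * c0 * n1 + n0 := h1
        _ ≤ 1 * c0 * n1 + n0 := by gcongr
        _ ≤ D * (n2 + n1 + n0) := by
          rw [hD]
          nlinarith [mul_nonneg hC1.le p2, mul_nonneg hC1.le p1, mul_nonneg hC1.le p0,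
            mul_nonneg hc00 p2, mul_nonneg hc00 p0]
  have plan : ∀ (q : Polynomial ℝ) (Bq : ℝ), (∀ u ∈ Icc (0 : ℝ) 1, |q.eval u| ≤ Bq) →
      ∀ w : X, Integrable (fun ξ : ℝ => ‖btF Tsg t q w (2 * Real.pi * ξ)‖ ^ 2) ∧
      ∫ ξ : ℝ, ‖btF Tsg t q w (2 * Real.pi * ξ)‖ ^ 2 = ∫ x, ‖btG Tsg t q w x‖ ^ 2 := by
    intro q Bq hq w
    have h := plancherel_aux (btG Tsg t q w)
      (memLp_one_iff_integrable.1 (btG_memLp Tsg K hK t ht0 q Bq hq w 1))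
      (btG_memLp Tsg K hK t ht0 q Bq hq w 2)
    simpa only [btG_fourier Tsg t ht0] using h
  have up : ∀ (q : Polynomial ℝ) (Bq : ℝ), (∀ u ∈ Icc (0 : ℝ) 1, |q.eval u| ≤ Bq) → Bq ≤ B →
      ∫ ξ : ℝ, ‖btF Tsg t q z (2 * Real.pi * ξ)‖ ^ 2 ≤ t * (B * (K * ‖z‖)) ^ 2 := by
    intro q Bq hq hle
    rw [(plan q Bq hq z).2]
    exact btG_upper Tsg K hK t ht0 q B (fun u hu => (hq u hu).trans hle) z
  have u2 := up _ B2 hB2 (by linarith)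
  have u1 := up _ B1 hB1 (by linarith)
  have u0 := up _ B0 hB0 (by linarith)
  have i2 := (plan _ B2 hB2 z).1
  have i1 := (plan _ B1 hB1 z).1
  have i0 := (plan _ B0 hB0 z).1
  have hmain : ∫ ξ : ℝ, ‖btF Tsg t p (Res 0 z) (2 * Real.pi * ξ)‖ ^ 2 ≤
      3 * (D / σ) ^ 2 * (3 * (t * (B * (K * ‖z‖)) ^ 2)) := by
    have h1 : ∫ ξ : ℝ, ‖btF Tsg t p (Res 0 z) (2 * Real.pi * ξ)‖ ^ 2 ≤
        ∫ ξ : ℝ, 3 * (D / σ) ^ 2 *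
          (‖btF Tsg t (Polynomial.derivative^[k + 1] p) z (2 * Real.pi * ξ)‖ ^ 2 +
            ‖btF Tsg t (Polynomial.derivative p) z (2 * Real.pi * ξ)‖ ^ 2 +
            ‖btF Tsg t p z (2 * Real.pi * ξ)‖ ^ 2) := by
      apply integral_mono (plan p B0 hB0 (Res 0 z)).1 (((i2.add i1).add i0).const_mul _)
      intro ξ
      have h := hpt (2 * Real.pi * ξ)
      have h2 := pow_le_pow_left₀ (norm_nonneg _) h 2
      refine h2.trans ?_
      change _ ≤ 3 * (D / σ) ^ 2 *
          (‖btF Tsg t (Polynomial.derivative^[k + 1] p) z (2 * Real.pi * ξ)‖ ^ 2 +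
            ‖btF Tsg t (Polynomial.derivative p) z (2 * Real.pi * ξ)‖ ^ 2 +
            ‖btF Tsg t p z (2 * Real.pi * ξ)‖ ^ 2)
      generalize ‖btF Tsg t (Polynomial.derivative^[k + 1] p) z (2 * Real.pi * ξ)‖ = a
      generalize ‖btF Tsg t (Polynomial.derivative p) z (2 * Real.pi * ξ)‖ = b
      generalize ‖btF Tsg t p z (2 * Real.pi * ξ)‖ = c
      have hq : (a + b + c) ^ 2 ≤ 3 * (a ^ 2 + b ^ 2 + c ^ 2) := by
        nlinarith [sq_nonneg (a - b), sq_nonneg (b - c), sq_nonneg (a - c)]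
      calc (D / σ * (a + b + c)) ^ 2 = (D / σ) ^ 2 * (a + b + c) ^ 2 := by ring
        _ ≤ (D / σ) ^ 2 * (3 * (a ^ 2 + b ^ 2 + c ^ 2)) :=
          mul_le_mul_of_nonneg_left hq (sq_nonneg _)
        _ = _ := by ring
    refine h1.trans ?_
    have i21 : Integrable (fun ξ : ℝ =>
        ‖btF Tsg t (Polynomial.derivative^[k + 1] p) z (2 * Real.pi * ξ)‖ ^ 2 +
        ‖btF Tsg t (Polynomial.derivative p) z (2 * Real.pi * ξ)‖ ^ 2) := i2.add i1
    rw [integral_const_mul, integral_add i21 i0, integral_add i2 i1]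
    exact mul_le_mul_of_nonneg_left (by linarith) (by positivity)
  rw [(plan p B0 hB0 (Res 0 z)).2] at hmain
  have hlo := btG_lower Tsg K hK t ht0 p B0 hB0 (Res 0 z)
  rw [← hIdef] at hlo
  have hfin : I * ‖Tsg.T t (Res 0 z)‖ ^ 2 ≤ (3 * K ^ 2 * D * B / σ * ‖z‖) ^ 2 := by
    have h2 := hlo.trans (mul_le_mul_of_nonneg_left hmain (sq_nonneg K))
    have h3 : t * (I * ‖Tsg.T t (Res 0 z)‖ ^ 2) ≤ t * (3 * K ^ 2 * D * B / σ * ‖z‖) ^ 2 := by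
      calc _ = t * I * ‖Tsg.T t (Res 0 z)‖ ^ 2 := by ring
        _ ≤ _ := h2
        _ = _ := by ring
    exact le_of_mul_le_mul_left h3 ht0
  have hsq : (Real.sqrt I * ‖Tsg.T t (Res 0 z)‖) ^ 2 ≤ (3 * K ^ 2 * D * B / σ * ‖z‖) ^ 2 := by
    rw [mul_pow, Real.sq_sqrt hI.le]
    exact hfin
  have hle := le_of_sq_le_sq hsq (by positivity)
  have hsI : 0 < Real.sqrt I := Real.sqrt_pos.2 hI
  calc ‖Tsg.T t (Res 0 z)‖ ≤ (3 * K ^ 2 * D * B / σ * ‖z‖) / Real.sqrt I := by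
        rw [le_div_iff₀ hsI, mul_comm]; exact hle
    _ = _ := by ring

end BTFinal
/-- Under the assumptions of Statement 0, if in addition `ℓ` is
dB-symmetric, then `‖T(t)A⁻¹‖ = O(1 / M⁻¹(t))` as `t → ∞`, where `M⁻¹` is any asymptotic
inverse of `M(s) = s^α / ℓ(s)`. -/
theorem decay_rate_singularity_at_infinity_dB_symmetric
    {X : Type*} [NormedAddCommGroup X] [InnerProductSpace ℂ X] [CompleteSpace X]
    (Tsg : C0Semigroup X) (hbdd : Tsg.Bounded)
    (A : X →ₗ.[ℂ] X) (hgen : IsGenerator Tsg A)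
    (Res : ℝ → X →L[ℂ] X)
    (hRes : ∀ s : ℝ, IsResolvent A (Complex.I * (s : ℂ)) (Res s))
    (α : ℝ) (hα : 0 < α)
    (l : ℝ → ℝ) (hsv : SlowlyVarying l) (hmono : Monotone l) (hdB : DBSymmetric l)
    (hbound : ∃ C > (0 : ℝ), ∃ S : ℝ, ∀ s : ℝ, S ≤ |s| →
      ‖Res s‖ ≤ C * (|s| ^ α / l |s|))
    (Minv : ℝ → ℝ) (hMinv : IsAsympInverse Minv fun s : ℝ => s ^ α / l s) :
    (fun t : ℝ => ‖Tsg.T t ∘L Res 0‖) =O[atTop] fun t : ℝ => (Minv t)⁻¹ := by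
  obtain ⟨K, hK⟩ := hbdd
  obtain ⟨C, hC, S0, hb⟩ := hbound
  obtain ⟨S, hS0, hS1, hl, D, hD, hp⟩ := bt_potter α hα l hsv hmono S0
  obtain ⟨k, C1, hC1, hlow⟩ := bt_low A Res hRes α hα l hmono C hC S D hS1 hl hD
    (fun s hs => hb s (hS0.trans hs)) hp
  obtain ⟨C2, hC2, hmain⟩ := bt_main Tsg K hK A hgen Res hRes k C1 hC1
  have hinv := hMinv.1.eventually (Ioo_mem_nhds (by norm_num : (1 / 2 : ℝ) < 1)
    (by norm_num : (1 : ℝ) < 2))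
  obtain ⟨B0, hB0⟩ := eventually_atTop.1 hinv
  set B := max S B0 with hB
  apply IsBigO.of_bound (2 * C2)
  filter_upwards [eventually_ge_atTop 1, eventually_ge_atTop (B ^ α / l B)] with t ht1 htB
  obtain ⟨s, hs, hst⟩ := bt_ivt α hα l hmono S D hS1 hl hD hp B t (le_max_left _ _) htB
  have hSs : S ≤ s := (le_max_left _ _).trans hs
  have hs0 : 0 < s := by linarith
  have h1 := hmain t s ht1 hs0 (by
    intro u hu
    have := hlow s hSs u hu
    rwa [hst] at this)
  have h2 := hB0 s ((le_max_right _ _).trans hs)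
  simp only [hst] at h2
  have h3 : Minv t < 2 * s := (div_lt_iff₀ hs0).1 h2.2
  have h4 : 1 / 2 * s < Minv t := (lt_div_iff₀ hs0).1 h2.1
  have h5 : 0 < Minv t := by linarith
  rw [norm_norm, Real.norm_eq_abs, abs_of_pos (inv_pos.2 h5)]
  refine h1.trans ?_
  rw [← div_eq_mul_inv, div_le_div_iff₀ hs0 h5]
  nlinarith
end

section
/- Let (T(t))_{t≥0} be a bounded C₀-semigroup on a complex Hilbert space X with generator −A. Assume that σ(A) ∩ iℝ is empty and that ‖(is+A)^{-1}‖ = O(|s|^α / ℓ(|s|)) as |s| → ∞, where α > 0 and ℓ is a decreasing slowly varying function. Then for every ε > 0, ‖T(t)A^{-1}‖ = O( (log t)^ε / (t · k^#(t))^{1/α} ) as t → ∞, where k(t) = 1/ℓ(t^{1/α}) and k^# is the de Bruijn conjugate of k. -/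
open Filter MeasureTheory Set Complex Asymptotics

section Plancherel

open scoped FourierTransform SchwartzMap ContDiff

theorem fourier_L1_ae_eq_L2 {X : Type*} [NormedAddCommGroup X] [InnerProductSpace ℂ X]
    [CompleteSpace X] (f : ℝ → X) (hf1 : Integrable f) (hf2 : MemLp f 2) :
    (𝓕 (hf2.toLp f) : Lp X 2 (volume : Measure ℝ)) =ᵐ[volume] (𝓕 f : ℝ → X) := by
  have hcont : Continuous (𝓕 f : ℝ → X) :=
    VectorFourier.fourierIntegral_continuous Real.continuous_fourierChar
      (innerSL ℝ).continuous₂ hf1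
  apply ae_eq_of_integral_contDiff_smul_eq
  · exact (Lp.memLp _).locallyIntegrable (by norm_num)
  · exact hcont.locallyIntegrable
  · intro g g_smooth g_cpt
    have hg₁ : HasCompactSupport (Complex.ofRealCLM ∘ g) := g_cpt.comp_left rfl
    have hg₂ : ContDiff ℝ ∞ (Complex.ofRealCLM ∘ g) := by fun_prop
    have h1 := congrArg (fun d => d (hg₁.toSchwartzMap hg₂))
      (MeasureTheory.Lp.fourier_toTemperedDistribution_eq (hf2.toLp f))
    simp only [TemperedDistribution.fourier_apply, Lp.toTemperedDistribution_apply] at h1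
    have h2 : ∫ x, (hg₁.toSchwartzMap hg₂) x • (𝓕 (hf2.toLp f) : Lp X 2 (volume : Measure ℝ)) x
       = ∫ x, g x • (𝓕 (hf2.toLp f) : Lp X 2 (volume : Measure ℝ)) x := by simp
    rw [← h2, ← h1]
    have h3 : ∫ x, (𝓕 (hg₁.toSchwartzMap hg₂)) x • (hf2.toLp f) x
        = ∫ x, (𝓕 (hg₁.toSchwartzMap hg₂)) x • f x := by
      apply integral_congr_ae
      filter_upwards [hf2.coeFn_toLp] with x hx
      rw [hx]
    rw [h3]
    have h4 := VectorFourier.integral_fourierIntegral_smul_eq_flip (L := innerₗ ℝ)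
      (μ := (volume : Measure ℝ)) (ν := (volume : Measure ℝ))
      Real.continuous_fourierChar (innerSL ℝ).continuous₂
      (hg₁.toSchwartzMap hg₂).integrable hf1
    rw [flip_innerₗ] at h4
    rw [SchwartzMap.fourier_coe]
    refine Eq.trans h4 ?_
    simp
    rfl

theorem plancherel_L1L2 {X : Type*} [NormedAddCommGroup X] [InnerProductSpace ℂ X]
    [CompleteSpace X] (f : ℝ → X) (hf1 : Integrable f) (hf2 : MemLp f 2) :
    eLpNorm (𝓕 f : ℝ → X) 2 volume = eLpNorm f 2 volume := by
  rw [← eLpNorm_congr_ae (fourier_L1_ae_eq_L2 f hf1 hf2), ← Lp.enorm_def, ← eLpNorm_congr_ae hf2.coeFn_toLp, ← Lp.enorm_def]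
  rw [← ofReal_norm, ← ofReal_norm, Lp.norm_fourier_eq]

end Plancherel


set_option linter.unusedSectionVars false

section Semigroup

variable {X : Type*} [NormedAddCommGroup X] [InnerProductSpace ℂ X] [CompleteSpace X]

theorem integrableOn_pow_mul_exp (a : ℝ) (ha : 0 < a) (m : ℕ) :
    IntegrableOn (fun τ : ℝ => τ ^ m * Real.exp (-a * τ)) (Ioi 0) := by
  have := integrableOn_rpow_mul_exp_neg_mul_rpow (s := m) (p := 1) (b := a)
    (by have : (0:ℝ) ≤ m := Nat.cast_nonneg m
        linarith) one_pos ha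
  simpa using this

theorem norm_kernel (lam : ℂ) (m : ℕ) (τ : ℝ) (hτ : 0 ≤ τ) :
    ‖((τ : ℂ) ^ m * exp (-lam * τ))‖ = τ ^ m * Real.exp (-lam.re * τ) := by
  rw [norm_mul, norm_pow, Complex.norm_exp]
  simp [abs_of_nonneg hτ]

theorem continuousOn_kernel (Tsg : C0Semigroup X) (lam : ℂ) (m : ℕ) (x : X) :
    ContinuousOn (fun τ : ℝ => ((τ : ℂ) ^ m * exp (-lam * τ)) • Tsg.T τ x) (Ici 0) := by
  apply ContinuousOn.smul
  · apply Continuous.continuousOn; fun_prop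
  · exact Tsg.strong_continuity x

theorem norm_kernel_le (Tsg : C0Semigroup X) {K : ℝ} (hK : ∀ t : ℝ, 0 ≤ t → ‖Tsg.T t‖ ≤ K)
    (lam : ℂ) (m : ℕ) (x : X) (τ : ℝ) (hτ : 0 ≤ τ) :
    ‖((τ : ℂ) ^ m * exp (-lam * τ)) • Tsg.T τ x‖ ≤
      K * ‖x‖ * (τ ^ m * Real.exp (-lam.re * τ)) := by
  rw [norm_smul, norm_kernel _ _ _ hτ, mul_comm]
  gcongr
  exact (Tsg.T τ).le_of_opNorm_le (hK τ hτ) x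

theorem integrableOn_kernel (Tsg : C0Semigroup X) {K : ℝ}
    (hK : ∀ t : ℝ, 0 ≤ t → ‖Tsg.T t‖ ≤ K)
    (lam : ℂ) (hlam : 0 < lam.re) (m : ℕ) (x : X) :
    IntegrableOn (fun τ : ℝ => ((τ : ℂ) ^ m * exp (-lam * τ)) • Tsg.T τ x) (Ioi 0) := by
  refine Integrable.mono' ((integrableOn_pow_mul_exp lam.re hlam m).const_mul (K * ‖x‖)) ?_ ?_
  · exact ((continuousOn_kernel Tsg lam m x).mono Ioi_subset_Ici_self).aestronglyMeasurable
      measurableSet_Ioi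
  · filter_upwards [self_mem_ae_restrict measurableSet_Ioi] with τ hτ
    exact norm_kernel_le Tsg hK lam m x τ (le_of_lt hτ)

/-- the Laplace transform of the semigroup as a bounded operator -/
theorem exists_laplace (Tsg : C0Semigroup X) {K : ℝ}
    (hK : ∀ t : ℝ, 0 ≤ t → ‖Tsg.T t‖ ≤ K) (lam : ℂ) (hlam : 0 < lam.re) :
    ∃ L : X →L[ℂ] X, (∀ x, L x = ∫ τ in Ioi (0:ℝ), exp (-lam * τ) • Tsg.T τ x) ∧
      ‖L‖ ≤ K / lam.re := by
  have hK0 : 0 ≤ K := (norm_nonneg _).trans (hK 0 le_rfl)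
  have hintg : ∀ x, IntegrableOn (fun τ : ℝ => exp (-lam * τ) • Tsg.T τ x) (Ioi 0) := by
    intro x
    simpa using integrableOn_kernel Tsg hK lam hlam 0 x
  let L0 : X →ₗ[ℂ] X :=
    { toFun := fun x => ∫ τ in Ioi (0:ℝ), exp (-lam * τ) • Tsg.T τ x
      map_add' := by
        intro x y
        simp only [map_add, smul_add]
        exact integral_add (hintg x) (hintg y)
      map_smul' := by
        intro c x
        simp only [map_smul, RingHom.id_apply]
        rw [← integral_smul]
        congr 1; ext τ; rw [smul_comm] }
  have hb : ∀ x, ‖L0 x‖ ≤ K / lam.re * ‖x‖ := by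
    intro x
    have h1 : ‖L0 x‖ ≤ ∫ τ in Ioi (0:ℝ), K * ‖x‖ * Real.exp (-lam.re * τ) := by
      apply norm_integral_le_of_norm_le
      · have := (integrableOn_pow_mul_exp lam.re hlam 0).const_mul (K * ‖x‖)
        simpa using this
      · filter_upwards [self_mem_ae_restrict measurableSet_Ioi] with τ hτ
        have := norm_kernel_le Tsg hK lam 0 x τ (le_of_lt hτ)
        simpa using this
    refine h1.trans (le_of_eq ?_)
    rw [integral_const_mul, integral_exp_mul_Ioi (by linarith)]
    simp
    field_simp
  exact ⟨L0.mkContinuous _ hb, fun x => rfl, L0.mkContinuous_norm_le (by positivity) hb⟩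

/-- operators commuting with the semigroup commute with its Laplace transform -/
theorem laplace_commute (Tsg : C0Semigroup X) {K : ℝ}
    (hK : ∀ t : ℝ, 0 ≤ t → ‖Tsg.T t‖ ≤ K) (lam : ℂ) (hlam : 0 < lam.re)
    (L : X →L[ℂ] X) (hL : ∀ x, L x = ∫ τ in Ioi (0:ℝ), exp (-lam * τ) • Tsg.T τ x)
    (S : X →L[ℂ] X) (hS : ∀ t : ℝ, 0 ≤ t → Commute S (Tsg.T t)) : Commute S L := by
  have hintg : ∀ x, IntegrableOn (fun τ : ℝ => exp (-lam * τ) • Tsg.T τ x) (Ioi 0) := by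
    intro x
    simpa using integrableOn_kernel Tsg hK lam hlam 0 x
  ext x
  simp only [mul_apply_eq_comp, hL]
  rw [← ContinuousLinearMap.integral_comp_comm _ (hintg x)]
  apply setIntegral_congr_fun measurableSet_Ioi
  intro τ hτ
  simp only [map_smul]
  congr 1
  exact congrArg (fun f => f x) (hS τ (le_of_lt hτ)).eq

theorem semigroup_commute (Tsg : C0Semigroup X) (s t : ℝ) (hs : 0 ≤ s) (ht : 0 ≤ t) :
    Commute (Tsg.T s) (Tsg.T t) := by
  have h1 := Tsg.map_add s t hs ht
  have h2 := Tsg.map_add t s ht hs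
  rw [add_comm] at h2
  exact h1.symm.trans h2

/-- right derivative of orbits -/
theorem orbit_hasDerivWithinAt (Tsg : C0Semigroup X) (A : X →ₗ.[ℂ] X) (hgen : IsGenerator Tsg A)
    (x : A.domain) (t : ℝ) (ht : 0 ≤ t) :
    HasDerivWithinAt (fun τ : ℝ => Tsg.T τ (x : X)) (-(Tsg.T t (A x))) (Ioi t) t := by
  have h0 := (hgen x (A x)).1 ⟨x.2, rfl⟩
  have h1 := ((Tsg.T t).continuous.tendsto _).comp h0
  rw [hasDerivWithinAt_iff_tendsto_slope' (by simp)]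
  have h2 : Tendsto (fun τ : ℝ => τ - t) (nhdsWithin t (Ioi t)) (nhdsWithin 0 (Ioi 0)) := by
    apply tendsto_nhdsWithin_of_tendsto_nhds_of_eventually_within
    · have : Tendsto (fun τ : ℝ => τ - t) (nhds t) (nhds (t - t)) := 
        (continuous_id.sub continuous_const).tendsto t
      rw [sub_self] at this
      exact this.mono_left nhdsWithin_le_nhds
    · filter_upwards [self_mem_nhdsWithin] with τ hτ
      simpa using hτ
  have h3 := h1.comp h2
  rw [map_neg] at h3
  refine h3.congr' ?_
  filter_upwards [self_mem_nhdsWithin] with τ hτ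
  have hτ' : 0 ≤ τ - t := by have : t < τ := hτ
                             linarith
  simp only [Function.comp, slope_def_module, map_smul, map_sub]
  have := Tsg.map_add t (τ - t) ht hτ'
  rw [add_sub_cancel] at this
  rw [this, ← Complex.ofReal_inv, Complex.coe_smul]
  rfl

theorem kernel_tendsto_zero (Tsg : C0Semigroup X) {K : ℝ}
    (hK : ∀ t : ℝ, 0 ≤ t → ‖Tsg.T t‖ ≤ K) (lam : ℂ) (hlam : 0 < lam.re) (m : ℕ) (x : X) :
    Tendsto (fun τ : ℝ => ((τ : ℂ) ^ m * exp (-lam * τ)) • Tsg.T τ x) atTop (nhds 0) := by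
  have h1 : Tendsto (fun τ : ℝ => τ ^ m * Real.exp (-lam.re * τ)) atTop (nhds 0) := by
    have := tendsto_rpow_mul_exp_neg_mul_atTop_nhds_zero (m : ℝ) lam.re hlam
    simpa using this
  have h2 := h1.const_mul (K * ‖x‖)
  rw [mul_zero] at h2
  refine squeeze_zero_norm' ?_ h2
  filter_upwards [eventually_ge_atTop 0] with τ hτ
  exact norm_kernel_le Tsg hK lam m x τ hτ

theorem laplace_left_inv (Tsg : C0Semigroup X) {K : ℝ}
    (hK : ∀ t : ℝ, 0 ≤ t → ‖Tsg.T t‖ ≤ K) (lam : ℂ) (hlam : 0 < lam.re)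
    (L : X →L[ℂ] X) (hL : ∀ x, L x = ∫ τ in Ioi (0:ℝ), exp (-lam * τ) • Tsg.T τ x)
    (A : X →ₗ.[ℂ] X) (hgen : IsGenerator Tsg A) (x : A.domain) :
    L (lam • (x : X) + A x) = x := by
  set z := lam • (x : X) + A x with hz
  have hintg : IntegrableOn (fun τ : ℝ => exp (-lam * τ) • Tsg.T τ z) (Ioi 0) := by
    simpa using integrableOn_kernel Tsg hK lam hlam 0 z
  have hlim := intervalIntegral_tendsto_integral_Ioi 0 hintg tendsto_id
  rw [← hL] at hlim
  have hev : ∀ N : ℝ, 0 ≤ N → ∫ τ in (0:ℝ)..N, exp (-lam * τ) • Tsg.T τ z =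
      (x : X) - exp (-lam * N) • Tsg.T N x := by
    intro N hN
    have key := intervalIntegral.integral_eq_sub_of_hasDeriv_right_of_le (a := 0) (b := N)
      (f := fun τ : ℝ => -(exp (-lam * τ) • Tsg.T τ (x : X)))
      (f' := fun τ : ℝ => exp (-lam * τ) • Tsg.T τ z) hN ?_ ?_ ?_
    · rw [key]
      simp [Tsg.map_zero]
      abel
    · have := (continuousOn_kernel Tsg lam 0 (x : X)).neg
      simp only [pow_zero, one_mul] at this
      exact this.mono Icc_subset_Ici_self
    · intro t ht
      have h1 : HasDerivWithinAt (fun τ : ℝ => exp (-lam * τ)) (exp (-lam * t) * (-lam))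
          (Ioi t) t := by
        have : HasDerivAt (fun τ : ℂ => exp (-lam * τ)) (exp (-lam * t) * (-lam)) (t : ℂ) := by
          have := ((hasDerivAt_id (t : ℂ)).const_mul (-lam)).cexp
          simpa using this
        exact this.comp_ofReal.hasDerivWithinAt
      have h2 := (h1.smul (orbit_hasDerivWithinAt Tsg A hgen x t ht.1.le)).neg
      have h3 : exp (-lam * t) • Tsg.T t z = -(exp (-lam * t) • -(Tsg.T t) (A x) +
          (exp (-lam * t) * -lam) • (Tsg.T t) (x : X)) := by
        simp only [hz, map_add, map_smul, smul_add, smul_neg, mul_neg, neg_smul, smul_smul]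
        abel
      rw [h3]
      exact h2
    · have := continuousOn_kernel Tsg lam 0 z
      simp only [pow_zero, one_mul] at this
      exact (this.mono (by rw [uIcc_of_le hN]; exact Icc_subset_Ici_self)).intervalIntegrable
  have h0 := kernel_tendsto_zero Tsg hK lam hlam 0 (x : X)
  simp only [pow_zero, one_mul] at h0
  have hlim2 : Tendsto (fun N : ℝ => ∫ τ in (0:ℝ)..N, exp (-lam * τ) • Tsg.T τ z) atTop
      (nhds (x : X)) := by
    have h1 : Tendsto (fun N : ℝ => (x : X) - exp (-lam * N) • Tsg.T N x) atTop
        (nhds ((x : X) - 0)) := tendsto_const_nhds.sub h0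
    rw [sub_zero] at h1
    refine h1.congr' ?_
    filter_upwards [eventually_ge_atTop 0] with N hN
    exact (hev N hN).symm
  exact tendsto_nhds_unique hlim hlim2

end Semigroup

section Powers

variable {X : Type*} [NormedAddCommGroup X] [InnerProductSpace ℂ X] [CompleteSpace X]

theorem laplace_tail (Tsg : C0Semigroup X) {K : ℝ}
    (hK : ∀ t : ℝ, 0 ≤ t → ‖Tsg.T t‖ ≤ K) (lam : ℂ) (hlam : 0 < lam.re)
    (L : X →L[ℂ] X) (hL : ∀ x, L x = ∫ τ in Ioi (0:ℝ), exp (-lam * τ) • Tsg.T τ x)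
    (x : X) (t : ℝ) (ht : 0 ≤ t) :
    exp (-lam * t) • Tsg.T t (L x) = L x - ∫ τ in (0:ℝ)..t, exp (-lam * τ) • Tsg.T τ x := by
  have hintg : IntegrableOn (fun τ : ℝ => exp (-lam * τ) • Tsg.T τ x) (Ioi 0) := by
    simpa using integrableOn_kernel Tsg hK lam hlam 0 x
  have h1 : exp (-lam * t) • Tsg.T t (L x) =
      ∫ σ in Ioi (0:ℝ), exp (-lam * ((σ + t : ℝ) : ℂ)) • Tsg.T (σ + t) x := by
    rw [hL, ← ContinuousLinearMap.integral_comp_comm _ hintg, ← integral_smul]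
    apply setIntegral_congr_fun measurableSet_Ioi
    intro σ hσ
    simp only [map_smul, smul_smul]
    rw [add_comm σ t, Tsg.map_add t σ ht (le_of_lt hσ), ← Complex.exp_add]
    simp only [ContinuousLinearMap.comp_apply]
    congr 2
    push_cast
    ring
  have h2 : ∫ σ in Ioi (0:ℝ), exp (-lam * ((σ + t : ℝ) : ℂ)) • Tsg.T (σ + t) x
      = ∫ σ in Ioi t, exp (-lam * (σ : ℂ)) • Tsg.T σ x := by
    have := (measurePreserving_add_right (volume : Measure ℝ) t).setIntegral_preimage_emb
      (measurableEmbedding_addRight t) (fun σ : ℝ => exp (-lam * (σ : ℂ)) • Tsg.T σ x) (Ioi t)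
    simpa using this
  rw [h1, h2, hL, eq_sub_iff_add_eq, add_comm]
  exact intervalIntegral.integral_interval_add_Ioi hintg (hintg.mono_set (Ioi_subset_Ioi ht))

theorem laplace_power_step (Tsg : C0Semigroup X) {K : ℝ}
    (hK : ∀ t : ℝ, 0 ≤ t → ‖Tsg.T t‖ ≤ K) (lam : ℂ) (hlam : 0 < lam.re)
    (L : X →L[ℂ] X) (hL : ∀ x, L x = ∫ τ in Ioi (0:ℝ), exp (-lam * τ) • Tsg.T τ x)
    (n : ℕ) (x : X) :
    ∫ τ in Ioi (0:ℝ), ((τ : ℂ) ^ (n + 1) * exp (-lam * τ)) • Tsg.T τ x =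
      ((n : ℂ) + 1) • ∫ τ in Ioi (0:ℝ), ((τ : ℂ) ^ n * exp (-lam * τ)) • Tsg.T τ (L x) := by
  have hint1 := integrableOn_kernel Tsg hK lam hlam (n + 1) x
  have hint2 := (integrableOn_kernel Tsg hK lam hlam n (L x)).smul ((n : ℂ) + 1)
  have key := integral_Ioi_of_hasDerivAt_of_tendsto (a := (0:ℝ)) (m := (0 : X))
    (f := fun τ : ℝ => ((τ : ℂ) ^ (n + 1) * exp (-lam * τ)) • Tsg.T τ (L x))
    (f' := fun τ : ℝ => ((n : ℂ) + 1) • (((τ : ℂ) ^ n * exp (-lam * τ)) • Tsg.T τ (L x))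
      - ((τ : ℂ) ^ (n + 1) * exp (-lam * τ)) • Tsg.T τ x)
    ((continuousOn_kernel Tsg lam (n + 1) (L x)) 0 (by simp)) ?_ (hint2.sub hint1)
    (kernel_tendsto_zero Tsg hK lam hlam (n + 1) (L x))
  · have hsub := integral_sub hint2 hint1
    simp only [Pi.smul_apply] at hsub
    rw [hsub] at key
    rw [integral_smul] at key
    simp only [ofReal_zero, ne_eq, Nat.add_eq_zero_iff, one_ne_zero, and_false, not_false_eq_true,
      zero_pow, zero_mul, zero_smul, sub_zero] at key
    exact (sub_eq_zero.1 key).symm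
  · intro t ht
    have ht0 : (0:ℝ) < t := ht
    set g : ℝ → X := fun τ : ℝ => exp (-lam * τ) • Tsg.T τ x with hg
    have hgc : ContinuousOn g (Ici 0) := by
      have := continuousOn_kernel Tsg lam 0 x
      simpa [hg] using this
    have hG : HasDerivAt (fun τ : ℝ => L x - ∫ σ in (0:ℝ)..τ, g σ) (- g t) t := by
      have h1 : HasDerivAt (fun τ : ℝ => ∫ σ in (0:ℝ)..τ, g σ) (g t) t := by
        apply intervalIntegral.integral_hasDerivAt_right
        · exact (hgc.mono (by rw [uIcc_of_le ht0.le]; exact Icc_subset_Ici_self)).intervalIntegrable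
        · exact ContinuousOn.stronglyMeasurableAtFilter isOpen_Ioi
            (hgc.mono Ioi_subset_Ici_self) t ht
        · exact hgc.continuousAt (Ici_mem_nhds ht0)
      exact h1.const_sub (L x)
    have hp : HasDerivAt (fun τ : ℝ => (τ : ℂ) ^ (n + 1)) (((n : ℂ) + 1) * (t : ℂ) ^ n) t := by
      have := (hasDerivAt_pow (n + 1) (t : ℂ)).comp_ofReal
      simpa using this
    have hprod := hp.smul hG
    have heq : (fun τ : ℝ => ((τ : ℂ) ^ (n + 1) * exp (-lam * τ)) • Tsg.T τ (L x)) =ᶠ[nhds t]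
        (fun τ : ℝ => (τ : ℂ) ^ (n + 1)) • (fun τ : ℝ => L x - ∫ σ in (0:ℝ)..τ, g σ) := by
      filter_upwards [Ioi_mem_nhds ht0] with τ hτ
      simp only [Pi.smul_apply', mul_smul]
      rw [laplace_tail Tsg hK lam hlam L hL x τ (le_of_lt hτ)]
    refine HasDerivAt.congr_of_eventuallyEq ?_ heq
    convert hprod using 1
    rw [← laplace_tail Tsg hK lam hlam L hL x t ht0.le]
    simp only [hg, smul_neg, mul_smul]
    abel

theorem laplace_power (Tsg : C0Semigroup X) {K : ℝ}
    (hK : ∀ t : ℝ, 0 ≤ t → ‖Tsg.T t‖ ≤ K) (lam : ℂ) (hlam : 0 < lam.re)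
    (L : X →L[ℂ] X) (hL : ∀ x, L x = ∫ τ in Ioi (0:ℝ), exp (-lam * τ) • Tsg.T τ x)
    (n : ℕ) (x : X) :
    ∫ τ in Ioi (0:ℝ), ((τ : ℂ) ^ n * exp (-lam * τ)) • Tsg.T τ x =
      (n.factorial : ℂ) • (L ^ (n + 1)) x := by
  induction n generalizing x with
  | zero => simp [hL]
  | succ n ih =>
    rw [laplace_power_step Tsg hK lam hlam L hL, ih, smul_smul, pow_succ L (n + 1),
      mul_apply_eq_comp]
    congr 1
    push_cast [Nat.factorial_succ]
    ring

end Powers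

section TimeDecay

open scoped FourierTransform

variable {X : Type*} [NormedAddCommGroup X] [InnerProductSpace ℂ X] [CompleteSpace X]

theorem plancherel_integral (f : ℝ → X) (hf1 : Integrable f) (hf2 : MemLp f 2) :
    Integrable (fun ξ => ‖(𝓕 f : ℝ → X) ξ‖ ^ 2) ∧
    ∫ ξ, ‖(𝓕 f : ℝ → X) ξ‖ ^ 2 = ∫ τ, ‖f τ‖ ^ 2 := by
  have hmem : MemLp (𝓕 f : ℝ → X) 2 := 
    (memLp_congr_ae (fourier_L1_ae_eq_L2 f hf1 hf2)).1 (Lp.memLp _)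
  have h := plancherel_L1L2 f hf1 hf2
  rw [hmem.eLpNorm_eq_integral_rpow_norm (by norm_num) (by norm_num),
    hf2.eLpNorm_eq_integral_rpow_norm (by norm_num) (by norm_num)] at h
  refine ⟨hmem.integrable_norm_pow (by norm_num), ?_⟩
  have hn1 : 0 ≤ ∫ ξ, ‖(𝓕 f : ℝ → X) ξ‖ ^ 2 := integral_nonneg fun _ => by positivity
  have hn2 : 0 ≤ ∫ ξ, ‖f ξ‖ ^ 2 := integral_nonneg fun _ => by positivity
  simp only [ENNReal.toReal_ofNat, Real.rpow_ofNat] at h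
  rw [ENNReal.ofReal_eq_ofReal_iff (by positivity) (by positivity)] at h
  exact (Real.rpow_left_inj hn1 hn2 (by norm_num)).1 h

theorem time_kernel_memLp (Tsg : C0Semigroup X) {K : ℝ}
    (hK : ∀ t : ℝ, 0 ≤ t → ‖Tsg.T t‖ ≤ K) (a : ℝ) (ha : 0 < a) (m : ℕ) (x : X) :
    Integrable ((Ioi (0:ℝ)).indicator fun τ : ℝ => ((τ : ℂ) ^ m * exp (-(a:ℂ) * τ)) • Tsg.T τ x) ∧
    MemLp ((Ioi (0:ℝ)).indicator fun τ : ℝ => ((τ : ℂ) ^ m * exp (-(a:ℂ) * τ)) • Tsg.T τ x) 2 := by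
  have hintg := integrableOn_kernel Tsg hK (a:ℂ) (by simpa using ha) m x
  refine ⟨(integrable_indicator_iff measurableSet_Ioi).2 hintg, ?_⟩
  rw [memLp_indicator_iff_restrict measurableSet_Ioi, memLp_two_iff_integrable_sq_norm hintg.1]
  have h2 := (integrableOn_pow_mul_exp (2 * a) (by linarith) (2 * m)).const_mul ((K * ‖x‖) ^ 2)
  refine Integrable.mono' h2 (hintg.1.norm.pow 2) ?_
  filter_upwards [self_mem_ae_restrict measurableSet_Ioi] with τ hτ
  have h3 := norm_kernel_le Tsg hK (a:ℂ) m x τ (le_of_lt hτ)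
  rw [Real.norm_of_nonneg (by positivity)]
  refine (pow_le_pow_left₀ (norm_nonneg _) h3 2).trans (le_of_eq ?_)
  rw [mul_pow, mul_pow (τ ^ m), ← pow_mul, ← Real.exp_nat_mul, mul_comm m 2]
  simp only [ofReal_re]
  congr 3
  push_cast
  ring

theorem time_kernel_fourier (Tsg : C0Semigroup X) {K : ℝ}
    (hK : ∀ t : ℝ, 0 ≤ t → ‖Tsg.T t‖ ≤ K) (a : ℝ) (ha : 0 < a) (m : ℕ) (x : X)
    (Lf : ℝ → X →L[ℂ] X)
    (hL : ∀ s x, Lf s x = ∫ τ in Ioi (0:ℝ), exp (-((a:ℂ) + I * s) * τ) • Tsg.T τ x) (ξ : ℝ) :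
    (𝓕 ((Ioi (0:ℝ)).indicator fun τ : ℝ => ((τ : ℂ) ^ m * exp (-(a:ℂ) * τ)) • Tsg.T τ x) :
      ℝ → X) ξ = (m.factorial : ℂ) • ((Lf (2 * Real.pi * ξ)) ^ (m + 1)) x := by
  rw [← laplace_power Tsg hK ((a:ℂ) + I * (2 * Real.pi * ξ : ℝ)) (by simpa using ha) _
    (hL (2 * Real.pi * ξ)) m x, Real.fourier_real_eq_integral_exp_smul,
    ← integral_indicator measurableSet_Ioi]
  congr 1
  ext τ
  by_cases hτ : τ ∈ Ioi (0:ℝ)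
  · simp only [indicator_of_mem hτ, smul_smul]
    congr 1
    rw [mul_left_comm, ← Complex.exp_add]
    congr 2
    push_cast
    ring
  · simp [indicator_of_notMem hτ]

theorem time_decay (Tsg : C0Semigroup X) {K : ℝ}
    (hK : ∀ t : ℝ, 0 ≤ t → ‖Tsg.T t‖ ≤ K) (t : ℝ) (ht : 0 < t) (m : ℕ)
    (Lf : ℝ → X →L[ℂ] X)
    (hL : ∀ s x, Lf s x = ∫ τ in Ioi (0:ℝ), exp (-(((t⁻¹ : ℝ) : ℂ) + I * s) * τ) • Tsg.T τ x)
    (B : X →L[ℂ] X) (hB : ∀ s, Commute B (Lf s)) (Q : ℝ)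
    (hQ : ∀ s, ‖(Lf s) ^ m * B‖ ≤ Q) (x : X) :
    ‖Tsg.T t (B x)‖ ≤ Real.exp 1 * 2 ^ m * m.factorial * K ^ 2 * Q / t ^ m * ‖x‖ := by
  have hK0 : 0 ≤ K := (norm_nonneg _).trans (hK 0 le_rfl)
  have hQ0 : 0 ≤ Q := (norm_nonneg _).trans (hQ 0)
  set a : ℝ := t⁻¹ with ha_def
  have ha : 0 < a := inv_pos.2 ht
  set F : ℕ → X → ℝ → X := fun m x => 
    (Ioi (0:ℝ)).indicator fun τ : ℝ => ((τ : ℂ) ^ m * exp (-(a:ℂ) * τ)) • Tsg.T τ x with hF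
  have h1 := plancherel_integral (F m (B x)) (time_kernel_memLp Tsg hK a ha m (B x)).1
    (time_kernel_memLp Tsg hK a ha m (B x)).2
  have h0 := plancherel_integral (F 0 x) (time_kernel_memLp Tsg hK a ha 0 x).1
    (time_kernel_memLp Tsg hK a ha 0 x).2
  have hF1 : ∀ ξ, ‖(𝓕 (F m (B x)) : ℝ → X) ξ‖ ^ 2 ≤
      (m.factorial * Q) ^ 2 * ‖(𝓕 (F 0 x) : ℝ → X) ξ‖ ^ 2 := by
    intro ξ
    rw [time_kernel_fourier Tsg hK a ha m (B x) Lf hL, time_kernel_fourier Tsg hK a ha 0 x Lf hL,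
      ← mul_pow]
    apply pow_le_pow_left₀ (norm_nonneg _)
    rw [norm_smul]
    simp only [Complex.norm_natCast, Nat.factorial_zero, Nat.cast_one, zero_add, pow_one, one_smul]
    rw [mul_assoc (m.factorial : ℝ) Q]
    refine mul_le_mul_of_nonneg_left ?_ (Nat.cast_nonneg _)
    set L := Lf (2 * Real.pi * ξ) with hLdef
    have e1 : (L ^ (m + 1)) (B x) = (L ^ m * B) (L x) := by
      have hc : B * L = L * B := (hB (2 * Real.pi * ξ)).eq
      have : L ^ (m + 1) * B = L ^ m * B * L := by
        rw [pow_succ, mul_assoc, mul_assoc, hc]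
      exact congrArg (fun f => f x) this
    rw [e1]
    exact ContinuousLinearMap.le_of_opNorm_le _ (hQ _) _
  have hcomp : ∫ τ, ‖F m (B x) τ‖ ^ 2 ≤ (m.factorial * Q) ^ 2 * ∫ τ, ‖F 0 x τ‖ ^ 2 := by
    rw [← h1.2, ← h0.2, ← integral_const_mul]
    exact integral_mono h1.1 (h0.1.const_mul _) hF1
  have hup : ∫ τ, ‖F 0 x τ‖ ^ 2 ≤ (K * ‖x‖) ^ 2 * (t / 2) := by
    have e : ∫ τ, ‖F 0 x τ‖ ^ 2 ≤ 
        ∫ τ, (Ioi (0:ℝ)).indicator (fun τ => (K * ‖x‖) ^ 2 * Real.exp (-(2 * a) * τ)) τ := by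
      apply integral_mono
      · exact (time_kernel_memLp Tsg hK a ha 0 x).2.integrable_norm_pow (by norm_num)
      · rw [integrable_indicator_iff measurableSet_Ioi]
        have h2 := (integrableOn_pow_mul_exp (2 * a) (by linarith) 0).const_mul ((K * ‖x‖) ^ 2)
        simpa [IntegrableOn] using h2
      · intro τ
        by_cases hτ : τ ∈ Ioi (0:ℝ)
        · simp only [hF, indicator_of_mem hτ]
          have h3 := norm_kernel_le Tsg hK (a:ℂ) 0 x τ (le_of_lt hτ)
          refine (pow_le_pow_left₀ (norm_nonneg _) h3 2).trans (le_of_eq ?_)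
          rw [mul_pow, pow_zero, one_mul, ← Real.exp_nat_mul]
          simp only [ofReal_re]
          congr 2
          push_cast
          ring
        · simp [hF, indicator_of_notMem hτ]
    refine e.trans (le_of_eq ?_)
    rw [integral_indicator measurableSet_Ioi, integral_const_mul,
      integral_exp_mul_Ioi (by linarith)]
    simp [ha_def]
    exact Or.inl (by ring)
  have hlow : ((t / 2) ^ m * Real.exp (-1)  * ‖Tsg.T t (B x)‖) ^ 2 * (t / 2) ≤ 
      K ^ 2 * ∫ τ, ‖F m (B x) τ‖ ^ 2 := by
    have e0 : ∫ τ in Ioc (t / 2) t, ((t / 2) ^ m * Real.exp (-1)  * ‖Tsg.T t (B x)‖) ^ 2 =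
      ((t / 2) ^ m * Real.exp (-1)  * ‖Tsg.T t (B x)‖) ^ 2 * (t / 2) := by
      rw [setIntegral_const]
      simp only [measureReal_def, Real.volume_Ioc, smul_eq_mul]
      rw [ENNReal.toReal_ofReal (by linarith)]
      ring
    have hI : Integrable (fun τ => K ^ 2 * ‖F m (B x) τ‖ ^ 2) :=
      ((time_kernel_memLp Tsg hK a ha m (B x)).2.integrable_norm_pow (by norm_num)).const_mul _
    rw [← e0, ← integral_const_mul]
    refine le_trans ?_ (setIntegral_le_integral (s := Ioc (t / 2) t) hI ?_)
    · apply setIntegral_mono_on _ hI.integrableOn measurableSet_Ioc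
      · intro τ hτ
        have hτ0 : 0 < τ := by have := hτ.1; linarith
        have hmem : τ ∈ Ioi (0:ℝ) := hτ0
        rw [← mul_pow]
        apply pow_le_pow_left₀ (by positivity)
        simp only [hF, indicator_of_mem hmem]
        rw [norm_smul, norm_kernel _ _ _ hτ0.le]
        have e3 : ‖Tsg.T t (B x)‖ ≤ K * ‖Tsg.T τ (B x)‖ := by
          have := Tsg.map_add (t - τ) τ (by linarith [hτ.2]) hτ0.le
          rw [sub_add_cancel] at this
          rw [this]
          exact ContinuousLinearMap.le_of_opNorm_le _ (hK _ (by linarith [hτ.2])) _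
        have e4 : Real.exp (-1) ≤ Real.exp (-(a:ℂ).re * τ) := by
          apply Real.exp_le_exp.2
          simp only [ofReal_re, ha_def]
          have : t⁻¹ * τ ≤ 1 := by
            rw [inv_mul_le_iff₀ ht]; linarith [hτ.2]
          linarith
        have e5 : (t / 2) ^ m ≤ τ ^ m := pow_le_pow_left₀ (by linarith) hτ.1.le m
        calc (t / 2) ^ m * Real.exp (-1) * ‖Tsg.T t (B x)‖ 
            ≤ τ ^ m * Real.exp (-(a:ℂ).re * τ) * (K * ‖Tsg.T τ (B x)‖) := by gcongr
          _ = _ := by ring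
      · exact integrableOn_const (by simp)
    · exact Eventually.of_forall fun τ => by positivity
  have hfin : ((t / 2) ^ m * Real.exp (-1)  * ‖Tsg.T t (B x)‖) ^ 2 ≤
      (m.factorial * K ^ 2 * Q * ‖x‖) ^ 2 := by
    have : ((t / 2) ^ m * Real.exp (-1)  * ‖Tsg.T t (B x)‖) ^ 2 * (t / 2) ≤
      (m.factorial * K ^ 2 * Q * ‖x‖) ^ 2 * (t / 2) := by
      calc _ ≤ _ := hlow
        _ ≤ K ^ 2 * ((m.factorial * Q) ^ 2 * ((K * ‖x‖) ^ 2 * (t / 2))) := by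
            gcongr
            exact hcomp.trans (by gcongr)
        _ = _ := by ring
    exact le_of_mul_le_mul_right this (by linarith)
  have hfin2 := le_of_sq_le_sq hfin (by positivity)
  have ee : Real.exp (-1) = (Real.exp 1)⁻¹ := Real.exp_neg 1
  rw [ee, div_pow] at hfin2
  have hx : ‖Tsg.T t (B x)‖ = (t ^ m / 2 ^ m * (Real.exp 1)⁻¹ * ‖Tsg.T t (B x)‖) * 
      (Real.exp 1 * 2 ^ m / t ^ m) := by
    field_simp
  rw [hx]
  calc _ ≤ (m.factorial * K ^ 2 * Q * ‖x‖) * (Real.exp 1 * 2 ^ m / t ^ m) := by gcongr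
    _ = _ := by ring

end TimeDecay

section OpEstimates

variable {X : Type*} [NormedAddCommGroup X] [InnerProductSpace ℂ X] [CompleteSpace X]

theorem clm_norm_pow_le {K : ℝ} (P : X →L[ℂ] X) (hP : ‖P‖ ≤ K) (n : ℕ) : ‖P ^ n‖ ≤ K ^ n := by
  induction n with
  | zero =>
    rw [pow_zero, pow_zero]
    exact ContinuousLinearMap.norm_id_le
  | succ n ih =>
    rw [pow_succ, pow_succ]
    exact (norm_mul_le _ _).trans (mul_le_mul ih hP (norm_nonneg _)
      (pow_nonneg ((norm_nonneg _).trans hP) n))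

theorem norm_P_le {K r : ℝ} (hr : 0 < r) (Lr : X →L[ℂ] X) (hLr : ‖Lr‖ ≤ K / r) :
    ‖(r : ℂ) • Lr‖ ≤ K := by
  rw [norm_smul, Complex.norm_real, Real.norm_of_nonneg hr.le]
  calc r * ‖Lr‖ ≤ r * (K / r) := by gcongr
    _ = K := by field_simp

theorem low_pass_error {K r : ℝ} (hK : 1 ≤ K) (hr : 0 < r) (Ai Lr : X →L[ℂ] X)
    (hcomm : Commute Ai Lr) (hLr : ‖Lr‖ ≤ K / r)
    (hres : (r : ℂ) • (Lr * Ai) = Ai - Lr) (n : ℕ) :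
    ‖Ai * (1 - ((r : ℂ) • Lr) ^ n)‖ ≤ n * K ^ (n + 1) / r := by
  set P := (r : ℂ) • Lr with hPdef
  have hP : ‖P‖ ≤ K := norm_P_le hr Lr hLr
  have h1 : Ai * (1 - P) = Lr := by
    rw [mul_sub, mul_one, hPdef, mul_smul_comm, hcomm.eq, hres]; abel
  have hc : Commute Ai P := hcomm.smul_right _
  induction n with
  | zero => simp
  | succ n ih =>
    have e : Ai * (1 - P ^ (n + 1)) = Ai * (1 - P ^ n) + P ^ n * Lr := by
      rw [← h1, ← mul_assoc (P ^ n), ← (hc.pow_right n).eq, pow_succ]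
      noncomm_ring
    rw [e]
    have h2 : ‖P ^ n * Lr‖ ≤ K ^ n * (K / r) :=
      (norm_mul_le _ _).trans (mul_le_mul (clm_norm_pow_le P hP n) hLr (norm_nonneg _)
        (by positivity))
    have h3 : (n:ℝ) * K ^ (n + 1) / r + K ^ n * (K / r) = ((n + 1 : ℕ) : ℝ) * K ^ (n + 1) / r := by
      push_cast
      field_simp
      ring
    calc _ ≤ _ := norm_add_le _ _
      _ ≤ (n:ℝ) * K ^ (n + 1) / r + K ^ n * (K / r) := add_le_add ih h2
      _ = ((n + 1 : ℕ) : ℝ) * K ^ (n + 1) / r := h3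
      _ ≤ _ := by
        gcongr
        omega

theorem high_freq {K r s : ℝ} {lam : ℂ} (hK : 1 ≤ K) (hr : 0 < r) (hrs : r ≤ |s|)
    (hlam : |s| ≤ ‖(r : ℂ) - lam‖) (L Lr : X →L[ℂ] X)
    (hLr : ‖Lr‖ ≤ K / r)
    (hres : ((r : ℂ) - lam) • (L * Lr) = L - Lr) (i : ℕ) :
    ‖L * ((r : ℂ) • Lr) ^ i‖ ≤ (r / |s|) ^ i * ‖L‖ + i * K ^ (i + 1) / r := by
  set P := (r : ℂ) • Lr with hPdef
  have hP : ‖P‖ ≤ K := norm_P_le hr Lr hLr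
  have hs : 0 < |s| := hr.trans_le hrs
  have hn : 0 < ‖(r : ℂ) - lam‖ := hs.trans_le hlam
  have hne : (r : ℂ) - lam ≠ 0 := norm_pos_iff.1 hn
  induction i with
  | zero => simp
  | succ i ih =>
    have e1 : L * P = ((r : ℂ) * ((r : ℂ) - lam)⁻¹) • (L - Lr) := by
      rw [← hres, hPdef, mul_smul_comm, smul_smul, mul_assoc, inv_mul_cancel₀ hne, mul_one]
    have e : L * P ^ (i + 1) = ((r : ℂ) * ((r : ℂ) - lam)⁻¹) • (L * P ^ i - Lr * P ^ i) := by
      rw [pow_succ', ← mul_assoc, e1, smul_mul_assoc, sub_mul]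
    have h2 : ‖Lr * P ^ i‖ ≤ (K / r) * K ^ i :=
      (norm_mul_le _ _).trans (mul_le_mul hLr (clm_norm_pow_le P hP i) (norm_nonneg _)
        (by positivity))
    have h3 : ‖(r : ℂ) * ((r : ℂ) - lam)⁻¹‖ ≤ r / |s| := by
      rw [norm_mul, norm_inv, Complex.norm_real, Real.norm_of_nonneg hr.le, ← div_eq_mul_inv]
      gcongr
    have h4 : r / |s| ≤ 1 := (div_le_one hs).2 hrs
    rw [e, norm_smul]
    calc _ ≤ (r / |s|) * (((r / |s|) ^ i * ‖L‖ + i * K ^ (i + 1) / r) + (K / r) * K ^ i) := by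
          gcongr
          exact (norm_sub_le _ _).trans (add_le_add ih h2)
      _ = (r / |s|) ^ (i + 1) * ‖L‖ + (r / |s|) * (i * K ^ (i + 1) / r + (K / r) * K ^ i) := by
          ring
      _ ≤ (r / |s|) ^ (i + 1) * ‖L‖ + 1 * (i * K ^ (i + 1) / r + (K / r) * K ^ i) := by
          gcongr
      _ = (r / |s|) ^ (i + 1) * ‖L‖ + ((i + 1 : ℕ) : ℝ) * K ^ (i + 1) / r := by
          push_cast
          ring
      _ ≤ _ := by
        gcongr
        omega

theorem op_estimate (K s0 V0 C1 CA : ℝ) (j p : ℕ) (M : ℝ → ℝ) (hK : 1 ≤ K) (hs0 : 1 ≤ s0)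
    (hV0 : 0 ≤ V0) (hC1 : 0 ≤ C1) (hCA : 0 ≤ CA) (hM0 : 0 < M s0)
    (hmono : ∀ s r, s0 ≤ s → s ≤ r → M s ≤ M r)
    (hM1 : ∀ s r, s0 ≤ s → s ≤ r → M s ^ (p + 1) / s ≤ M r ^ (p + 1) / r)
    (hM2 : ∀ r s, s0 ≤ r → r ≤ s → (r / s) ^ j * M s ≤ 2 * M r) :
    ∃ C : ℝ, 0 ≤ C ∧ ∀ (r s : ℝ) (lam : ℂ) (Ai L Lr : X →L[ℂ] X), s0 ≤ r →
      |s| ≤ ‖(r : ℂ) - lam‖ → |s| ≤ ‖lam‖ → ‖Ai‖ ≤ CA → ‖Lr‖ ≤ K / r →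
      (|s| ≤ s0 → ‖L‖ ≤ V0) → (s0 ≤ |s| → ‖L‖ ≤ C1 * M |s|) →
      Commute Ai L → Commute Ai Lr → Commute L Lr →
      lam • (L * Ai) = Ai - L → ((r : ℂ) - lam) • (L * Lr) = L - Lr →
      ‖L ^ (p + 1) * (Ai * ((r : ℂ) • Lr) ^ (j * (p + 1)))‖ ≤ C * (M r ^ (p + 1) / r) := by
  set N := j * (p + 1) with hN
  set D1 := V0 ^ (p + 1) * (CA * K ^ N) * (s0 / M s0 ^ (p + 1)) with hD1
  set D2 := C1 ^ p * (CA / M s0 + C1) * K ^ N with hD2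
  set C3 := 2 * C1 + j * K ^ (j + 1) / M s0 with hC3
  set D3 := C3 ^ p * (CA * K ^ j / M s0 + C3) with hD3
  have hD1' : 0 ≤ D1 := by positivity
  have hD2' : 0 ≤ D2 := by positivity
  have hC3' : 0 ≤ C3 := by positivity
  have hD3' : 0 ≤ D3 := by positivity
  refine ⟨D1 + D2 + D3, by positivity, ?_⟩
  intro r s lam Ai L Lr hr hrl hsl hAi hLr hlow hhigh cAL cALr cLLr hres1 hres2
  have hr0 : 0 < r := by linarith
  have hMr0 : 0 < M r := hM0.trans_le (hmono s0 r le_rfl hr)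
  set P := (r : ℂ) • Lr with hPdef
  have hP : ‖P‖ ≤ K := norm_P_le hr0 Lr hLr
  have hPn : ∀ n, ‖P ^ n‖ ≤ K ^ n := clm_norm_pow_le P hP
  have cAP : Commute Ai P := cALr.smul_right _
  have cLP : Commute L P := cLLr.smul_right _
  have hY : 0 ≤ M r ^ (p + 1) / r := by positivity
  rcases le_or_gt |s| s0 with hs | hs
  · have h1 : ‖L ^ (p + 1) * (Ai * P ^ N)‖ ≤ V0 ^ (p + 1) * (CA * K ^ N) := by
      refine (norm_mul_le _ _).trans (mul_le_mul (clm_norm_pow_le L (hlow hs) _) ?_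
        (norm_nonneg _) (by positivity))
      exact (norm_mul_le _ _).trans (mul_le_mul hAi (hPn N) (norm_nonneg _) hCA)
    have h2 : V0 ^ (p + 1) * (CA * K ^ N) ≤ D1 * (M r ^ (p + 1) / r) := by
      calc V0 ^ (p + 1) * (CA * K ^ N) = D1 * (M s0 ^ (p + 1) / s0) := by
            rw [hD1]; field_simp
        _ ≤ _ := by gcongr D1 * ?_; exact hM1 s0 r le_rfl hr
    calc _ ≤ _ := h1.trans h2
      _ ≤ _ := by gcongr; linarith
  · have hs0' : 0 < |s| := by linarith
    have hlam0 : 0 < ‖lam‖ := hs0'.trans_le hsl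
    have hLA : L * Ai = lam⁻¹ • (Ai - L) := by
      rw [← hres1, smul_smul, inv_mul_cancel₀ (norm_pos_iff.1 hlam0), one_smul]
    have hinv : ‖lam⁻¹‖ ≤ 1 / |s| := by
      rw [norm_inv, ← one_div]; gcongr
    have hLb := hhigh hs.le
    rcases le_or_gt |s| r with hsr | hsr
    · have hMs0 : 0 < M |s| := hM0.trans_le (hmono s0 |s| le_rfl hs.le)
      have hMs : M s0 ≤ M |s| := hmono s0 |s| le_rfl hs.le
      have e : L ^ (p + 1) * (Ai * P ^ N) = L ^ p * (L * Ai) * P ^ N := by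
        rw [pow_succ]; noncomm_ring
      have h1 : ‖L * Ai‖ ≤ (CA / M s0 + C1) * (M |s| / |s|) := by
        rw [hLA, norm_smul]
        calc _ ≤ 1 / |s| * (CA + C1 * M |s|) := by
              gcongr
              exact (norm_sub_le _ _).trans (add_le_add hAi hLb)
          _ ≤ 1 / |s| * (CA / M s0 * M |s| + C1 * M |s|) := by
              gcongr
              rw [div_mul_eq_mul_div, le_div_iff₀ hM0]
              gcongr
          _ = _ := by ring
      rw [e]
      calc _ ≤ ‖L ^ p‖ * ‖L * Ai‖ * ‖P ^ N‖ :=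
            (norm_mul_le _ _).trans (mul_le_mul_of_nonneg_right (norm_mul_le _ _) (norm_nonneg _))
        _ ≤ (C1 * M |s|) ^ p * ((CA / M s0 + C1) * (M |s| / |s|)) * K ^ N := by
            gcongr
            · exact clm_norm_pow_le L hLb p
            · exact hPn N
        _ = D2 * (M |s| ^ (p + 1) / |s|) := by rw [hD2, mul_pow, pow_succ (M |s|)]; ring
        _ ≤ D2 * (M r ^ (p + 1) / r) := by gcongr D2 * ?_; exact hM1 |s| r hs.le hsr
        _ ≤ _ := by gcongr; linarith
    · have hMr : M s0 ≤ M r := hmono s0 r le_rfl hr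
      have e : L ^ (p + 1) * (Ai * P ^ N) = (L * P ^ j) ^ p * (L * Ai * P ^ j) := by
        have c1 : P ^ (j * p) * L = L * P ^ (j * p) := (cLP.pow_right _).symm.eq
        have c2 : Ai * P ^ (j * p) = P ^ (j * p) * Ai := (cAP.pow_right _).eq
        have hPN : P ^ N = P ^ (j * p) * P ^ j := by
          rw [hN, mul_add, mul_one, pow_add]
        rw [(cLP.pow_right j).mul_pow, ← pow_mul, hPN, pow_succ L p]
        calc L ^ p * L * (Ai * (P ^ (j * p) * P ^ j))
            = L ^ p * (L * (Ai * P ^ (j * p))) * P ^ j := by simp only [mul_assoc]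
          _ = L ^ p * ((L * P ^ (j * p)) * Ai) * P ^ j := by rw [c2]; simp only [mul_assoc]
          _ = L ^ p * P ^ (j * p) * (L * Ai * P ^ j) := by rw [← c1]; simp only [mul_assoc]
      have hj : (j:ℝ) * K ^ (j + 1) ≤ j * K ^ (j + 1) / M s0 * M r := by
        rw [div_mul_eq_mul_div, le_div_iff₀ hM0]
        exact mul_le_mul_of_nonneg_left hMr (by positivity)
      have hca : CA * K ^ j ≤ CA * K ^ j / M s0 * M r := by
        rw [div_mul_eq_mul_div, le_div_iff₀ hM0]
        exact mul_le_mul_of_nonneg_left hMr (by positivity)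
      have h1 : ‖L * P ^ j‖ ≤ C3 * M r := by
        calc _ ≤ (r / |s|) ^ j * ‖L‖ + j * K ^ (j + 1) / r :=
              high_freq hK hr0 hsr.le hrl L Lr hLr hres2 j
          _ ≤ (r / |s|) ^ j * (C1 * M |s|) + j * K ^ (j + 1) / 1 := by
              gcongr
              linarith
          _ = C1 * ((r / |s|) ^ j * M |s|) + j * K ^ (j + 1) := by ring
          _ ≤ C1 * (2 * M r) + j * K ^ (j + 1) / M s0 * M r := 
              add_le_add (mul_le_mul_of_nonneg_left (hM2 r |s| hr hsr.le) hC1) hj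
          _ = _ := by rw [hC3]; ring
      have h2 : ‖L * Ai * P ^ j‖ ≤ (CA * K ^ j / M s0 + C3) * (M r / r) := by
        rw [hLA, smul_mul_assoc, norm_smul, sub_mul]
        calc _ ≤ 1 / r * (CA * K ^ j + C3 * M r) := by
              gcongr
              · exact hinv.trans (by gcongr)
              · refine (norm_sub_le _ _).trans (add_le_add ?_ h1)
                exact (norm_mul_le _ _).trans (mul_le_mul hAi (hPn j) (norm_nonneg _) hCA)
          _ ≤ 1 / r * (CA * K ^ j / M s0 * M r + C3 * M r) :=
              mul_le_mul_of_nonneg_left (add_le_add hca le_rfl) (by positivity)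
          _ = _ := by ring
      rw [e]
      calc _ ≤ (C3 * M r) ^ p * ((CA * K ^ j / M s0 + C3) * (M r / r)) :=
            (norm_mul_le _ _).trans (mul_le_mul (clm_norm_pow_le _ h1 p) h2 (norm_nonneg _)
              (by positivity))
        _ = D3 * (M r ^ (p + 1) / r) := by rw [hD3, mul_pow, pow_succ (M r)]; ring
        _ ≤ _ := by gcongr; linarith

end OpEstimates

section Assembly

variable {X : Type*} [NormedAddCommGroup X] [InnerProductSpace ℂ X] [CompleteSpace X]

theorem res_id {A : X →ₗ.[ℂ] X} {mu lam : ℂ} {R L : X →L[ℂ] X} (hR : IsResolvent A mu R)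
    (hL : ∀ x : A.domain, L (lam • (x : X) + A x) = x) :
    (lam - mu) • (L * R) = R - L := by
  ext z
  have h1 := hR.eq_apply z
  have h2 := hL ⟨R z, hR.mem_domain z⟩
  have h3 : A ⟨R z, hR.mem_domain z⟩ = z - mu • R z := by
    exact eq_sub_of_add_eq' h1
  rw [h3, map_add, map_sub, map_smul, map_smul] at h2
  change (lam - mu) • L (R z) = R z - L z
  rw [sub_smul, ← sub_eq_zero]
  rw [← sub_eq_zero] at h2
  rw [← h2]
  simp only
  abel

theorem res_commute_T {A : X →ₗ.[ℂ] X} {mu : ℂ} {R : X →L[ℂ] X} (Tsg : C0Semigroup X)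
    (hgen : IsGenerator Tsg A) (hR : IsResolvent A mu R) (t : ℝ) (ht : 0 ≤ t) :
    Commute R (Tsg.T t) := by
  have key : ∀ x : A.domain, ∃ h : Tsg.T t x ∈ A.domain, A ⟨Tsg.T t x, h⟩ = Tsg.T t (A x) := by
    intro x
    rw [hgen]
    have h0 := (hgen x (A x)).1 ⟨x.2, rfl⟩
    have h1 := ((Tsg.T t).continuous.tendsto _).comp h0
    rw [map_neg] at h1
    refine h1.congr' ?_
    filter_upwards [self_mem_nhdsWithin] with τ hτ
    have hc : Tsg.T t (Tsg.T τ x) = Tsg.T τ (Tsg.T t x) :=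
      congrArg (fun S : X →L[ℂ] X => S x) (semigroup_commute Tsg t τ ht (le_of_lt hτ)).eq
    simp [hc]
  refine ContinuousLinearMap.ext fun z => ?_
  change R (Tsg.T t z) = Tsg.T t (R z)
  obtain ⟨h, hA⟩ := key ⟨R z, hR.mem_domain z⟩
  have h2 := hR.left_inv ⟨Tsg.T t (R z), h⟩
  rw [hA] at h2
  simp only at h2
  rw [← map_smul, ← map_add, hR.eq_apply] at h2
  exact h2

theorem res_injective {A : X →ₗ.[ℂ] X} {mu : ℂ} {R : X →L[ℂ] X} (hR : IsResolvent A mu R)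
    (z : X) (hz : R z = 0) : z = 0 := by
  have h1 := hR.eq_apply z
  have h2 : (⟨R z, hR.mem_domain z⟩ : A.domain) = 0 := Subtype.ext hz
  rw [h2, hz, smul_zero, zero_add, A.map_zero] at h1
  exact h1.symm

theorem res_local_bdd {A : X →ₗ.[ℂ] X} (Res : ℝ → X →L[ℂ] X)
    (hRes : ∀ s : ℝ, IsResolvent A (Complex.I * (s : ℂ)) (Res s)) (s0 : ℝ) :
    ∃ V : ℝ, 0 ≤ V ∧ ∀ s, |s| ≤ s0 → ‖Res s‖ ≤ V := by
  have h : ∃ V : ℝ, ∀ s ∈ Icc (-s0) s0, ‖Res s‖ ≤ V := by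
    refine isCompact_Icc.induction_on (p := fun u => ∃ V : ℝ, ∀ s ∈ u, ‖Res s‖ ≤ V)
      ⟨0, by simp⟩ ?_ ?_ ?_
    · rintro u v huv ⟨V, hV⟩
      exact ⟨V, fun s hs => hV s (huv hs)⟩
    · rintro u v ⟨V, hV⟩ ⟨W, hW⟩
      refine ⟨max V W, fun s hs => ?_⟩
      rcases hs with hs | hs
      · exact (hV s hs).trans (le_max_left _ _)
      · exact (hW s hs).trans (le_max_right _ _)
    · intro s _
      refine ⟨Metric.ball s (1 / (2 * (‖Res s‖ + 1))),
        mem_nhdsWithin_of_mem_nhds (Metric.ball_mem_nhds _ (by positivity)),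
        2 * ‖Res s‖, fun s' hs' => ?_⟩
      have h1 := res_id (hRes s) (hRes s').left_inv
      have h2 : ‖Complex.I * (s' : ℂ) - Complex.I * (s : ℂ)‖ = |s' - s| := by
        rw [← mul_sub, norm_mul, Complex.norm_I, one_mul, ← Complex.ofReal_sub, Complex.norm_real,
          Real.norm_eq_abs]
      have h3 : Res s' = Res s -
          (Complex.I * (s' : ℂ) - Complex.I * (s : ℂ)) • (Res s' * Res s) := by
        rw [h1]; abel
      have h4 : ‖Res s'‖ ≤ ‖Res s‖ + |s' - s| * (‖Res s'‖ * ‖Res s‖) := by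
        calc ‖Res s'‖ = ‖Res s - (Complex.I * (s' : ℂ) - Complex.I * (s : ℂ)) •
              (Res s' * Res s)‖ := by rw [← h3]
          _ ≤ _ := norm_sub_le _ _
          _ ≤ _ := by
            rw [norm_smul, h2]
            gcongr
            exact norm_mul_le _ _
      rw [Metric.mem_ball, Real.dist_eq, lt_div_iff₀ (by positivity)] at hs'
      have h5 : |s' - s| * ‖Res s‖ ≤ 1 / 2 := by
        nlinarith [abs_nonneg (s' - s)]
      nlinarith [norm_nonneg (Res s'), mul_le_mul_of_nonneg_left h5 (norm_nonneg (Res s'))]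
  obtain ⟨V, hV⟩ := h
  exact ⟨max V 0, le_max_right _ _, fun s hs => (hV s (abs_le.1 hs)).trans (le_max_left _ _)⟩

/-- second resolvent identity between two Laplace transforms -/
theorem res_id2 {lam mu : ℂ} {Ai L Lr : X →L[ℂ] X} (hinj : ∀ z, Ai z = 0 → z = 0)
    (cAL : Commute Ai L) (cALr : Commute Ai Lr) (cLLr : Commute L Lr)
    (h1 : lam • (L * Ai) = Ai - L) (h2 : mu • (Lr * Ai) = Ai - Lr) :
    (mu - lam) • (L * Lr) = L - Lr := by
  have e : Ai * ((mu - lam) • (L * Lr)) = Ai * (L - Lr) := by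
    have e1 : Ai * (L * Lr) = L * (Lr * Ai) := by
      rw [← mul_assoc, cAL.eq, mul_assoc, cALr.eq]
    have e2 : Ai * (L * Lr) = Lr * (L * Ai) := by
      rw [cLLr.eq, ← mul_assoc, cALr.eq, mul_assoc, cAL.eq]
    rw [mul_smul_comm, sub_smul]
    nth_rewrite 1 [e1]
    rw [e2, ← mul_smul_comm mu L, ← mul_smul_comm lam Lr, h1, h2, mul_sub, mul_sub, mul_sub, cAL.eq, cALr.eq,
      cLLr.eq]
    abel
  ext z
  have e' := congrArg (fun S : X →L[ℂ] X => S z) e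
  have e'' : Ai (((mu - lam) • (L * Lr)) z - (L - Lr) z) = 0 := by
    rw [map_sub, sub_eq_zero]; exact e'
  exact sub_eq_zero.1 (hinj _ e'')

/-- main operator theoretic estimate -/
theorem main_decay (Tsg : C0Semigroup X) {K : ℝ} (hK : ∀ t : ℝ, 0 ≤ t → ‖Tsg.T t‖ ≤ K)
    (hK1 : 1 ≤ K)
    (A : X →ₗ.[ℂ] X) (hgen : IsGenerator Tsg A) (Res : ℝ → X →L[ℂ] X)
    (hRes : ∀ s : ℝ, IsResolvent A (Complex.I * (s : ℂ)) (Res s))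
    (s0 C0 : ℝ) (j p : ℕ) (M : ℝ → ℝ) (hs0 : 1 ≤ s0) (hC0 : 0 ≤ C0) (hM0 : 0 < M s0)
    (hmono : ∀ s r, s0 ≤ s → s ≤ r → M s ≤ M r)
    (hM1 : ∀ s r, s0 ≤ s → s ≤ r → M s ^ (p + 1) / s ≤ M r ^ (p + 1) / r)
    (hM2 : ∀ r s, s0 ≤ r → r ≤ s → (r / s) ^ j * M s ≤ 2 * M r)
    (hb : ∀ s, s0 ≤ |s| → ‖Res s‖ ≤ C0 * M |s|) :
    ∃ C : ℝ, 0 ≤ C ∧ ∀ t r : ℝ, 0 < t → s0 ≤ r → M r ≤ 2 * t → ‖Tsg.T t ∘L Res 0‖ ≤ C / r := by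
  have hK0 : 0 ≤ K := by linarith
  obtain ⟨V, hV, hVb⟩ := res_local_bdd Res hRes s0
  obtain ⟨C, hC, hop⟩ := op_estimate (X := X) K s0 ((1 + K) * V) ((1 + K) * C0) ‖Res 0‖ j p M hK1 hs0
    (by positivity) (by positivity) (norm_nonneg _) hM0 hmono hM1 hM2
  set N := j * (p + 1) with hN
  set E := Real.exp 1 * 2 ^ (p + 1) * (p + 1).factorial * K ^ 2 * C * 2 ^ (p + 1) with hE
  have hE0 : 0 ≤ E := by positivity
  refine ⟨E + K * (N * K ^ (N + 1)), by positivity, ?_⟩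
  intro t r ht hr hMt
  have hr0 : 0 < r := by linarith
  set Ai := Res 0 with hAi
  have hRes0 : IsResolvent A 0 Ai := by simpa using hRes 0
  have cAT : ∀ t : ℝ, 0 ≤ t → Commute Ai (Tsg.T t) := res_commute_T Tsg hgen hRes0
  have hrre : 0 < ((r : ℂ)).re := by simpa using hr0
  obtain ⟨Lr, hLr, hLrn⟩ := exists_laplace Tsg hK (r : ℂ) hrre
  simp only [Complex.ofReal_re] at hLrn
  have hre : ∀ s : ℝ, 0 < (((t⁻¹ : ℝ) : ℂ) + I * s).re := by
    intro s
    simp [ht]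
  choose Lf hLf hLfn using fun s : ℝ => exists_laplace Tsg hK (((t⁻¹ : ℝ) : ℂ) + I * s) (hre s)
  have cALr : Commute Ai Lr := laplace_commute Tsg hK _ hrre Lr hLr Ai cAT
  have cALf : ∀ s, Commute Ai (Lf s) := fun s =>
    laplace_commute Tsg hK _ (hre s) (Lf s) (hLf s) Ai cAT
  have cLrT : ∀ t : ℝ, 0 ≤ t → Commute Lr (Tsg.T t) := fun t ht =>
    (laplace_commute Tsg hK _ hrre Lr hLr (Tsg.T t)
      fun t' ht' => semigroup_commute Tsg t t' ht ht').symm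
  have cLL : ∀ s, Commute (Lf s) Lr := fun s =>
    (laplace_commute Tsg hK _ (hre s) (Lf s) (hLf s) Lr cLrT).symm
  have i1 : ∀ s : ℝ, (((t⁻¹ : ℝ) : ℂ) + I * s) • (Lf s * Ai) = Ai - Lf s := fun s => by
    have := res_id hRes0 (laplace_left_inv Tsg hK _ (hre s) (Lf s) (hLf s) A hgen)
    simpa only [sub_zero] using this
  have i2 : (r : ℂ) • (Lr * Ai) = Ai - Lr := by
    have := res_id hRes0 (laplace_left_inv Tsg hK _ hrre Lr hLr A hgen)
    simpa only [sub_zero] using this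
  have i3 : ∀ s : ℝ, ((r : ℂ) - (((t⁻¹ : ℝ) : ℂ) + I * s)) • (Lf s * Lr) = Lf s - Lr := fun s =>
    res_id2 (res_injective hRes0) (cALf s) cALr (cLL s) (i1 s) i2
  have hLfR : ∀ s, ‖Lf s‖ ≤ (1 + K) * ‖Res s‖ := by
    intro s
    have h1 := res_id (hRes s) (laplace_left_inv Tsg hK _ (hre s) (Lf s) (hLf s) A hgen)
    rw [add_sub_cancel_right] at h1
    have h2 : Lf s = Res s - ((t⁻¹ : ℝ) : ℂ) • (Lf s * Res s) := by rw [h1]; abel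
    have h3 : t⁻¹ * ‖Lf s‖ ≤ K := by
      have := hLfn s
      have e : (((t⁻¹ : ℝ) : ℂ) + I * s).re = t⁻¹ := by simp
      rw [e, le_div_iff₀ (by positivity)] at this
      linarith
    calc ‖Lf s‖ = ‖Res s - ((t⁻¹ : ℝ) : ℂ) • (Lf s * Res s)‖ := by rw [← h2]
      _ ≤ ‖Res s‖ + ‖((t⁻¹ : ℝ) : ℂ) • (Lf s * Res s)‖ := norm_sub_le _ _
      _ ≤ ‖Res s‖ + t⁻¹ * (‖Lf s‖ * ‖Res s‖) := by
        rw [norm_smul, Complex.norm_real, Real.norm_of_nonneg (by positivity)]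
        gcongr
        exact norm_mul_le _ _
      _ = ‖Res s‖ + (t⁻¹ * ‖Lf s‖) * ‖Res s‖ := by ring
      _ ≤ ‖Res s‖ + K * ‖Res s‖ := by gcongr
      _ = _ := by ring
  set P := (r : ℂ) • Lr with hP
  have hQ : ∀ s, ‖(Lf s) ^ (p + 1) * (Ai * P ^ N)‖ ≤ C * (M r ^ (p + 1) / r) := by
    intro s
    refine hop r s (((t⁻¹ : ℝ) : ℂ) + I * s) Ai (Lf s) Lr hr ?_ ?_ le_rfl hLrn ?_ ?_ (cALf s) cALr
      (cLL s) (i1 s) (i3 s)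
    · have := Complex.abs_im_le_norm ((r : ℂ) - (((t⁻¹ : ℝ) : ℂ) + I * s))
      simpa [-Complex.ofReal_inv] using this
    · have := Complex.abs_im_le_norm (((t⁻¹ : ℝ) : ℂ) + I * s)
      simpa [-Complex.ofReal_inv] using this
    · intro hs
      exact (hLfR s).trans (by gcongr; exact hVb s hs)
    · intro hs
      rw [mul_assoc]
      exact (hLfR s).trans (by gcongr; exact hb s hs)
  have hB : ∀ s, Commute (Ai * P ^ N) (Lf s) := fun s =>
    (cALf s).mul_left ((((cLL s).symm.smul_left _)).pow_left N)
  have hdec := time_decay Tsg hK t ht (p + 1) Lf hLf (Ai * P ^ N) hB _ hQ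
  have hMr : 0 ≤ M r := hM0.le.trans (hmono s0 r le_rfl hr)
  have hd1 : ‖Tsg.T t * (Ai * P ^ N)‖ ≤ E / r := by
    refine ContinuousLinearMap.opNorm_le_bound _ (by positivity) fun x => ?_
    refine (hdec x).trans (mul_le_mul_of_nonneg_right ?_ (norm_nonneg x))
    have : M r ^ (p + 1) ≤ 2 ^ (p + 1) * t ^ (p + 1) := by
      rw [← mul_pow]; gcongr
    rw [div_le_iff₀ (by positivity), hE]
    calc Real.exp 1 * 2 ^ (p + 1) * (p + 1).factorial * K ^ 2 * (C * (M r ^ (p + 1) / r))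
        = Real.exp 1 * 2 ^ (p + 1) * (p + 1).factorial * K ^ 2 * C * (M r ^ (p + 1)) / r := by ring
      _ ≤ Real.exp 1 * 2 ^ (p + 1) * (p + 1).factorial * K ^ 2 * C *
            (2 ^ (p + 1) * t ^ (p + 1)) / r := by gcongr
      _ = _ := by ring
  have hd2 := low_pass_error hK1 hr0 Ai Lr cALr hLrn i2 N
  have e : Tsg.T t ∘L Ai = Tsg.T t * (Ai * P ^ N) + Tsg.T t * (Ai * (1 - P ^ N)) := by
    change Tsg.T t * Ai = _
    noncomm_ring
  rw [e]
  calc _ ≤ _ := norm_add_le _ _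
    _ ≤ E / r + K * (N * K ^ (N + 1) / r) := by
      gcongr
      exact (norm_mul_le _ _).trans (mul_le_mul (hK t ht.le) hd2 (norm_nonneg _) hK0)
    _ = _ := by ring

end Assembly

section RealPart

theorem sv_pos {l : ℝ → ℝ} (hsv : SlowlyVarying l) (hanti : Antitone l) (s : ℝ) : 0 < l s := by
  obtain ⟨s', hs', h⟩ := ((eventually_ge_atTop s).and hsv.2.1).exists
  exact h.trans_le (hanti hs')

theorem sv_potter {l : ℝ → ℝ} (hsv : SlowlyVarying l) (hanti : Antitone l) :
    ∃ s1 : ℝ, 1 ≤ s1 ∧ ∀ r s, s1 ≤ r → r ≤ s → l r ≤ 2 * (s / r) * l s := by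
  have hpos := sv_pos hsv hanti
  have h1 := (hsv.2.2 2 two_pos).eventually (lt_mem_nhds (show (1/2 : ℝ) < 1 by norm_num))
  obtain ⟨S, hS⟩ := eventually_atTop.1 h1
  refine ⟨max S 1, le_max_right _ _, fun r s hr hrs => ?_⟩
  have hr1 : 1 ≤ r := (le_max_right _ _).trans hr
  have hrS : S ≤ r := (le_max_left _ _).trans hr
  have hr0 : 0 < r := by linarith
  have hit : ∀ n : ℕ, l r ≤ 2 ^ n * l (2 ^ n * r) := by
    intro n
    induction n with
    | zero => simp
    | succ n ih =>
      have h2 : (1:ℝ) ≤ 2 ^ n := one_le_pow₀ (by norm_num)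
      have h3 := hS (2 ^ n * r) (by nlinarith)
      rw [lt_div_iff₀ (hpos _)] at h3
      have h4 : 2 * (2 ^ n * r) = 2 ^ (n + 1) * r := by ring
      rw [h4] at h3
      calc l r ≤ 2 ^ n * l (2 ^ n * r) := ih
        _ ≤ 2 ^ n * (2 * l (2 ^ (n + 1) * r)) := by
          apply mul_le_mul_of_nonneg_left _ (by positivity)
          linarith
        _ = _ := by ring
  obtain ⟨n, hn1, hn2⟩ := exists_nat_pow_near ((one_le_div hr0).2 hrs) (show (1:ℝ) < 2 by norm_num)
  have hs : s ≤ 2 ^ (n + 1) * r := by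
    rw [div_lt_iff₀ hr0] at hn2; exact hn2.le
  calc l r ≤ 2 ^ (n + 1) * l (2 ^ (n + 1) * r) := hit _
    _ ≤ 2 ^ (n + 1) * l s := mul_le_mul_of_nonneg_left (hanti hs) (by positivity)
    _ ≤ 2 * (s / r) * l s := by
      apply mul_le_mul_of_nonneg_right _ (hpos s).le
      rw [pow_succ]; linarith

theorem M_mono {l : ℝ → ℝ} (hpos : ∀ s, 0 < l s) (hanti : Antitone l) {α : ℝ} (hα : 0 < α)
    (s r : ℝ) (hs : 0 ≤ s) (hsr : s ≤ r) : s ^ α / l s ≤ r ^ α / l r :=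
  div_le_div₀ (Real.rpow_nonneg (hs.trans hsr) _) (Real.rpow_le_rpow hs hsr hα.le) (hpos r)
    (hanti hsr)

theorem M_mono2 {l : ℝ → ℝ} (hpos : ∀ s, 0 < l s) (hanti : Antitone l) {α : ℝ}
    (p : ℕ) (hp : 1 ≤ α * (p + 1 : ℕ))
    (s r : ℝ) (hs : 0 < s) (hsr : s ≤ r) :
    (s ^ α / l s) ^ (p + 1) / s ≤ (r ^ α / l r) ^ (p + 1) / r := by
  have e : ∀ x : ℝ, 0 < x →
      (x ^ α / l x) ^ (p + 1) / x = x ^ (α * (p + 1 : ℕ) - 1) / l x ^ (p + 1) := by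
    intro x hx
    rw [div_pow, ← Real.rpow_natCast (x ^ α), ← Real.rpow_mul hx.le, Real.rpow_sub hx,
      Real.rpow_one, div_right_comm]
  rw [e s hs, e r (hs.trans_le hsr)]
  exact div_le_div₀ (Real.rpow_nonneg (hs.le.trans hsr) _)
    (Real.rpow_le_rpow hs.le hsr (by linarith)) (pow_pos (hpos r) _)
    (pow_le_pow_left₀ (hpos r).le (hanti hsr) _)

theorem M_potter {l : ℝ → ℝ} (hpos : ∀ s, 0 < l s) {α : ℝ}
    (j : ℕ) (hj : α + 1 ≤ j) (r s : ℝ) (hr : 0 < r) (hrs : r ≤ s)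
    (h : l r ≤ 2 * (s / r) * l s) :
    (r / s) ^ j * (s ^ α / l s) ≤ 2 * (r ^ α / l r) := by
  have hs : 0 < s := hr.trans_le hrs
  have h1 : (r / s) ^ j ≤ (r / s) ^ α * (r / s) := by
    calc (r / s) ^ j = (r / s) ^ (j : ℝ) := (Real.rpow_natCast _ _).symm
      _ ≤ (r / s) ^ (α + 1) :=
        Real.rpow_le_rpow_of_exponent_ge (by positivity) ((div_le_one hs).2 hrs) hj
      _ = _ := by rw [Real.rpow_add (by positivity), Real.rpow_one]
  have hls := hpos s
  have hlr := hpos r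
  calc (r / s) ^ j * (s ^ α / l s) ≤ (r / s) ^ α * (r / s) * (s ^ α / l s) := by gcongr
    _ = r ^ α * (r / s / l s) := by
      rw [Real.div_rpow hr.le hs.le]
      have : s ^ α ≠ 0 := (Real.rpow_pos_of_pos hs α).ne'
      field_simp
    _ ≤ r ^ α * (2 / l r) := by
      apply mul_le_mul_of_nonneg_left _ (by positivity)
      rw [div_le_div_iff₀ hls hlr]
      calc r / s * l r ≤ r / s * (2 * (s / r) * l s) := by gcongr
        _ = 2 * l s := by field_simp
    _ = _ := by ring

end RealPart


/-- Let `(T(t))_{t≥0}` be a bounded `C₀`-semigroup on a complex Hilbert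
space `X` with generator `−A`.  Assume `σ(A) ∩ iℝ = ∅` and
`‖(is+A)⁻¹‖ = O(|s|^α / ℓ(|s|))` as `|s| → ∞`, with `α > 0` and `ℓ` decreasing and slowly
varying.  Then for every `ε > 0`,
`‖T(t)A⁻¹‖ = O((log t)^ε / (t · k^#(t))^{1/α})` as `t → ∞`, where `k(t) = 1/ℓ(t^{1/α})`
and `k^#` is the de Bruijn conjugate of `k`. -/
theorem decay_rate_singularity_at_infinity_ell_decreasing
    {X : Type*} [NormedAddCommGroup X] [InnerProductSpace ℂ X] [CompleteSpace X]
    (Tsg : C0Semigroup X) (hbdd : Tsg.Bounded)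
    (A : X →ₗ.[ℂ] X) (hgen : IsGenerator Tsg A)
    (Res : ℝ → X →L[ℂ] X)
    (hRes : ∀ s : ℝ, IsResolvent A (Complex.I * (s : ℂ)) (Res s))
    (α : ℝ) (hα : 0 < α)
    (l : ℝ → ℝ) (hsv : SlowlyVarying l) (hanti : Antitone l)
    (hbound : ∃ C > (0 : ℝ), ∃ S : ℝ, ∀ s : ℝ, S ≤ |s| →
      ‖Res s‖ ≤ C * (|s| ^ α / l |s|)) :
    ∀ ε > (0 : ℝ), ∀ ks : ℝ → ℝ,
      IsDeBruijnConjugate (fun t : ℝ => (l (t ^ (1 / α)))⁻¹) ks →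
      (fun t : ℝ => ‖Tsg.T t ∘L Res 0‖) =O[atTop]
        fun t : ℝ => Real.log t ^ ε / (t * ks t) ^ (1 / α) := by
  intro ε hε ks hks
  obtain ⟨K', hK'⟩ := hbdd
  obtain ⟨C0, hC0, S, hS⟩ := hbound
  have hpos := sv_pos hsv hanti
  obtain ⟨s1, hs1, hpot⟩ := sv_potter hsv hanti
  set s0 := max s1 S with hs0
  have hs0s1 : s1 ≤ s0 := le_max_left _ _
  have hs01 : 1 ≤ s0 := hs1.trans hs0s1
  obtain ⟨C, hC, hmain⟩ := main_decay Tsg (K := max K' 1)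
    (fun t ht => (hK' t ht).trans (le_max_left _ _)) (le_max_right _ _) A hgen Res hRes s0 C0
    (⌈α⌉₊ + 1) ⌈1 / α⌉₊ (fun s => s ^ α / l s) hs01 hC0.le
    (div_pos (Real.rpow_pos_of_pos (by linarith) _) (hpos _))
    (fun s r hs hsr => M_mono hpos hanti hα s r (by linarith) hsr)
    (fun s r hs hsr => M_mono2 hpos hanti _ (by
      have h1 : 1 / α ≤ ((⌈1 / α⌉₊ + 1 : ℕ) : ℝ) := by
        push_cast
        linarith [Nat.le_ceil (1 / α)]
      calc (1:ℝ) = α * (1 / α) := by field_simp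
        _ ≤ _ := by gcongr) s r (by linarith) hsr)
    (fun r s hr hrs => M_potter hpos _ (by
      push_cast
      linarith [Nat.le_ceil α]) r s (by linarith) hrs (hpot r s (by linarith) hrs))
    (fun s hs => hS s ((le_max_right _ _).trans hs))
  obtain ⟨⟨_, hkpos, _⟩, _, hk3⟩ := hks
  refine IsBigO.of_bound C ?_
  have e1 := hk3.eventually (lt_mem_nhds (show (1/2 : ℝ) < 1 by norm_num))
  have e2 := hk3.eventually (gt_mem_nhds (show (1 : ℝ) < 2 by norm_num))
  filter_upwards [hkpos, e1, e2, eventually_gt_atTop (2 * (s0 ^ α / l s0)),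
    eventually_ge_atTop (Real.exp 1)] with t hkt h1 h2 h3 h4
  have ht : 0 < t := (Real.exp_pos 1).trans_le h4
  have hu : 0 < t * ks t := mul_pos ht hkt
  set r := (t * ks t) ^ (1 / α) with hr
  have hr0 : 0 < r := Real.rpow_pos_of_pos hu _
  have hrα : r ^ α = t * ks t := by
    rw [hr, ← Real.rpow_mul hu.le, one_div_mul_cancel hα.ne', Real.rpow_one]
  have hM : r ^ α / l r = t * (ks t * (l r)⁻¹) := by rw [hrα]; ring
  have hM2 : r ^ α / l r ≤ 2 * t := by rw [hM]; nlinarith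
  have hrs : s0 ≤ r := by
    by_contra hcon
    push Not at hcon
    have h5 := M_mono hpos hanti hα r s0 hr0.le hcon.le
    rw [hM] at h5
    nlinarith
  have hlog : 1 ≤ Real.log t ^ ε :=
    Real.one_le_rpow ((Real.le_log_iff_exp_le ht).2 h4) hε.le
  have hfin := hmain t r ht hrs hM2
  rw [norm_norm, Real.norm_of_nonneg (by positivity)]
  refine hfin.trans ?_
  rw [div_eq_mul_one_div]
  gcongr
end
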